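/- Let κ be a field, ℓ a prime different from char(κ), and K = κ(t) the rational function field. Then vcd_ℓ(K) = vcd_ℓ(κ) + 1, where vcd_ℓ denotes the virtual ℓ-cohomological dimension of the absolute Galois group. -/

import Mathlib

set_option linter.unusedSectionVars false

section ContinuousCohomology

variable (G : Type) [Group G] [TopologicalSpace G]
variable (M : Type) [AddCommGroup M] [DistribMulAction G M]

/-- The differential of the complex of inhomogeneous cochains of `G` with
coefficients in the `G`-module `M`. -/
def cochainD (n : ℕ) (f : (Fin n → G) → M) : (Fin (n + 1) → G) → M :=
  fun g => g 0 • f (fun i => g i.succ) +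
    ∑ j : Fin (n + 1), (-1 : ℤ) ^ ((j : ℕ) + 1) • f (Fin.contractNth j (· * ·) g)

theorem cochainD_add (n : ℕ) (f₁ f₂ : (Fin n → G) → M) :
    cochainD G M n (f₁ + f₂) = cochainD G M n f₁ + cochainD G M n f₂ := by
  funext g
  simp only [cochainD, Pi.add_apply, smul_add, Finset.sum_add_distrib]
  abel

theorem cochainD_zero (n : ℕ) : cochainD G M n 0 = 0 := by
  funext g; simp [cochainD]

theorem cochainD_neg (n : ℕ) (f : (Fin n → G) → M) :
    cochainD G M n (-f) = -cochainD G M n f := by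
  funext g
  simp only [cochainD, Pi.neg_apply, smul_neg, Finset.sum_neg_distrib, Pi.add_apply]
  abel

/-- Continuous (i.e. locally constant, the coefficients being discrete)
inhomogeneous `n`-cocycles of `G` with coefficients in `M`. -/
def contCocycles (n : ℕ) : AddSubgroup ((Fin n → G) → M) where
  carrier := {f | IsLocallyConstant f ∧ cochainD G M n f = 0}
  add_mem' := fun hf hg =>
    ⟨hf.1.comp₂ hg.1 (· + ·), by rw [cochainD_add, hf.2, hg.2, add_zero]⟩
  zero_mem' := ⟨IsLocallyConstant.const 0, cochainD_zero G M n⟩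
  neg_mem' := fun hf =>
    ⟨hf.1.comp (fun y => -y), by rw [cochainD_neg, hf.2, neg_zero]⟩

/-- Continuous inhomogeneous `(n+1)`-coboundaries of `G` with coefficients in `M`. -/
def contCoboundaries (n : ℕ) : AddSubgroup ((Fin (n + 1) → G) → M) where
  carrier := {f | ∃ g, IsLocallyConstant g ∧ cochainD G M n g = f}
  add_mem' := by
    intro a b ha hb
    obtain ⟨g₁, h₁, e₁⟩ := ha
    obtain ⟨g₂, h₂, e₂⟩ := hb
    exact ⟨g₁ + g₂, h₁.comp₂ h₂ (· + ·), by rw [cochainD_add, e₁, e₂]⟩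
  zero_mem' := ⟨0, IsLocallyConstant.const 0, cochainD_zero G M n⟩
  neg_mem' := by
    intro a ha
    obtain ⟨g, h, e⟩ := ha
    exact ⟨-g, h.comp (fun y => -y), by rw [cochainD_neg, e]⟩

/-- Continuous group cohomology of `G` with coefficients in the discrete
`G`-module `M`. -/
def contH : ℕ → Type
  | 0 => ↥(contCocycles G M 0)
  | n + 1 => ↥(contCocycles G M (n + 1)) ⧸
      (contCoboundaries G M n).comap (contCocycles G M (n + 1)).subtype

/-- The `ℓ`-cohomological dimension of a topological group `G`: the supremum of
the degrees in which `G` has nonvanishing continuous cohomology with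
coefficients in some discrete `ℓ`-primary torsion `G`-module. -/
noncomputable def contCohomDim (ℓ : ℕ) : ℕ∞ :=
  sSup {d : ℕ∞ | ∃ i : ℕ, d = i ∧
    ∃ (M : Type) (_ : AddCommGroup M) (_ : DistribMulAction G M),
      (∀ x : M, IsLocallyConstant fun g : G => g • x) ∧
      (∀ x : M, ∃ k : ℕ, ℓ ^ k • x = 0) ∧
      Nontrivial (contH G M i)}

end ContinuousCohomology

section Vcd

/-- A chosen square root of `-1` in the algebraic closure of a field `F`. -/
noncomputable def sqrtNegOne (F : Type) [Field F] : AlgebraicClosure F :=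
  Classical.choose (IsAlgClosed.exists_pow_nat_eq (-1 : AlgebraicClosure F) (n := 2) (by norm_num))

/-- The virtual `ℓ`-cohomological dimension of a field `F`: the `ℓ`-cohomological
dimension of the absolute Galois group of the (non-formally-real) extension
`F(√-1)`. -/
noncomputable def vcdl (ℓ : ℕ) (F : Type) [Field F] : ℕ∞ :=
  contCohomDim
    (AlgebraicClosure F ≃ₐ[↥(IntermediateField.adjoin F {sqrtNegOne F})]
      AlgebraicClosure F) ℓ

end Vcd

section CochainComplex

variable {G : Type} [Group G] [TopologicalSpace G] {A B C : Type} [AddCommGroup A] [DistribMulAction G A]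
  [AddCommGroup B] [DistribMulAction G B] [AddCommGroup C] [DistribMulAction G C]

theorem cochainD_comp_cochainD (n : ℕ) (f : (Fin n → G) → A) :
    cochainD G A (n + 1) (cochainD G A n f) = 0 := by
  have h := groupCohomology.inhomogeneousCochains.d_comp_d n (Rep.ofDistribMulAction ℤ G A)
  exact congrArg (fun φ => φ.hom f) h

theorem cochainD_map (φ : A →+ B) (hφ : ∀ (g : G) a, φ (g • a) = g • φ a) (n : ℕ)
    (f : (Fin n → G) → A) :
    cochainD G B n (fun x => φ (f x)) = fun x => φ (cochainD G A n f x) := by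
  funext g
  simp only [cochainD, map_add, map_sum, hφ, map_zsmul]

theorem cochainD_sub (n : ℕ) (f₁ f₂ : (Fin n → G) → A) :
    cochainD G A n (f₁ - f₂) = cochainD G A n f₁ - cochainD G A n f₂ := by
  rw [sub_eq_add_neg, cochainD_add, cochainD_neg, sub_eq_add_neg]

/-- The expansion of the differential of a cochain in its first variable. -/
theorem cochainD_cons (n : ℕ) (f : (Fin (n + 1) → G) → A) (x : G) (g : Fin (n + 1) → G) :
    cochainD G A (n + 1) f (Fin.cons x g) = x • f g - f (Fin.cons (x * g 0) fun i => g i.succ) -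
      ∑ j : Fin (n + 1), (-1 : ℤ) ^ ((j : ℕ) + 1) •
        f (Fin.cons x (Fin.contractNth j (· * ·) g)) := by
  have h0 : Fin.contractNth 0 (· * ·) (Fin.cons x g : Fin (n + 2) → G) =
      Fin.cons (x * g 0) fun i => g i.succ := by
    funext k
    refine Fin.cases ?_ (fun i => ?_) k
    · rw [Fin.contractNth_apply_of_eq _ _ _ _ rfl]; simp
    · rw [Fin.contractNth_apply_of_gt _ _ _ _ (by simp)]; simp
  have hs : ∀ j : Fin (n + 1), Fin.contractNth j.succ (· * ·) (Fin.cons x g : Fin (n + 2) → G) =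
      Fin.cons x (Fin.contractNth j (· * ·) g) := by
    intro j
    funext k
    refine Fin.cases ?_ (fun i => ?_) k
    · rw [Fin.contractNth_apply_of_lt _ _ _ _ (by simp)]; simp
    · rcases lt_trichotomy (i : ℕ) j with h | h | h
      · rw [Fin.contractNth_apply_of_lt _ _ _ _ (by simpa using h), Fin.cons_succ,
          Fin.contractNth_apply_of_lt _ _ _ _ h]
        rfl
      · rw [Fin.contractNth_apply_of_eq _ _ _ _ (by simpa using h), Fin.cons_succ, Fin.cons_succ,
          Fin.contractNth_apply_of_eq _ _ _ _ h]
        rfl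
      · rw [Fin.contractNth_apply_of_gt _ _ _ _ (by simpa using h), Fin.cons_succ, Fin.cons_succ,
          Fin.contractNth_apply_of_gt _ _ _ _ h]
  simp only [cochainD, Fin.cons_zero, Fin.cons_succ]
  rw [Fin.sum_univ_succ, h0]
  simp only [hs, Fin.val_zero, Fin.val_succ, zero_add, pow_one, neg_smul, one_smul]
  simp only [pow_succ _ (_ + 1), mul_neg, mul_one, neg_smul, Finset.sum_neg_distrib]
  abel

/-- A `G`-module is smooth if all orbit maps are locally constant. -/
def IsSmooth (G M : Type) [Group G] [TopologicalSpace G] [AddCommGroup M]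
    [DistribMulAction G M] : Prop :=
  ∀ x : M, IsLocallyConstant fun g : G => g • x

/-- The vanishing of the continuous cohomology of `G` with coefficients in `M` in
degree `n + 1`. -/
def HVan (G M : Type) [Group G] [TopologicalSpace G] [AddCommGroup M]
    [DistribMulAction G M] (n : ℕ) : Prop :=
  ∀ f : (Fin (n + 1) → G) → M, IsLocallyConstant f → cochainD G M (n + 1) f = 0 →
    ∃ g, IsLocallyConstant g ∧ cochainD G M n g = f

theorem IsLocallyConstant.cochainD [IsTopologicalGroup G] (hA : IsSmooth G A) {n : ℕ}
    {f : (Fin n → G) → A} (hf : IsLocallyConstant f) : IsLocallyConstant (cochainD G A n f) := by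
  have hsum : ∀ (s : Finset (Fin (n + 1))), IsLocallyConstant fun g : Fin (n + 1) → G =>
      ∑ j ∈ s, (-1 : ℤ) ^ ((j : ℕ) + 1) • f (Fin.contractNth j (· * ·) g) := by
    intro s
    induction s using Finset.cons_induction with
    | empty =>
      simp only [Finset.sum_empty]
      exact IsLocallyConstant.const 0
    | cons j s hj ih =>
      simp only [Finset.sum_cons]
      refine IsLocallyConstant.comp₂ ?_ ih (· + ·)
      refine IsLocallyConstant.comp ?_ (fun m => (-1 : ℤ) ^ ((j : ℕ) + 1) • m)
      refine hf.comp_continuous (f := fun g : Fin (n + 1) → G => Fin.contractNth j (· * ·) g) ?_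
      refine continuous_pi fun k => ?_
      rcases lt_trichotomy (k : ℕ) j with h | h | h
      · simp only [Fin.contractNth_apply_of_lt _ _ _ _ h]; fun_prop
      · simp only [Fin.contractNth_apply_of_eq _ _ _ _ h]; fun_prop
      · simp only [Fin.contractNth_apply_of_gt _ _ _ _ h]; fun_prop
  refine IsLocallyConstant.comp₂ ?_ (hsum Finset.univ) (· + ·)
  rw [IsLocallyConstant.iff_eventually_eq]
  intro g
  have h1 := ((IsLocallyConstant.iff_eventually_eq _).1 (hf.comp_continuous
    (f := fun g : Fin (n + 1) → G => fun i : Fin n => g i.succ) (by fun_prop))) g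
  have h2 := ((IsLocallyConstant.iff_eventually_eq _).1 ((hA (f fun i => g i.succ)).comp_continuous
    (f := fun g : Fin (n + 1) → G => g 0) (by fun_prop))) g
  filter_upwards [h1, h2] with y hy1 hy2
  simp only [Function.comp_def] at hy1 hy2
  rw [hy1, hy2]

theorem IsLocallyConstant.exists_lift {X : Type} [TopologicalSpace X] {α β : Type} {p : α → β}
    (hp : Function.Surjective p) {f : X → β} (hf : IsLocallyConstant f) :
    ∃ g : X → α, IsLocallyConstant g ∧ ∀ x, p (g x) = f x :=
  ⟨fun x => Function.surjInv hp (f x), hf.comp (Function.surjInv hp), fun _ => Function.surjInv_eq hp _⟩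

theorem IsLocallyConstant.of_comp_injective {X : Type} [TopologicalSpace X] {α β : Type}
    {i : α → β} (hi : Function.Injective i) {f : X → α}
    (hf : IsLocallyConstant fun x => i (f x)) : IsLocallyConstant f := by
  rw [IsLocallyConstant.iff_eventually_eq] at hf ⊢
  exact fun x => (hf x).mono fun y hy => hi hy

section Exact

variable [IsTopologicalGroup G] {i : A →+ B} {p : B →+ C}

theorem HVan.middle (hi : ∀ (g : G) a, i (g • a) = g • i a)
    (hp : ∀ (g : G) b, p (g • b) = g • p b) (hinj : Function.Injective i)
    (hsurj : Function.Surjective p) (hex : ∀ b, p b = 0 → ∃ a, i a = b) (hB : IsSmooth G B)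
    {n : ℕ} (h1 : HVan G A n) (h2 : HVan G C n) : HVan G B n := by
  intro f hf hdf
  obtain ⟨c, hc, hdc⟩ := h2 (fun x => p (f x)) (hf.comp p)
    (by rw [cochainD_map p hp, hdf]; funext; simp)
  obtain ⟨b, hb, hbc⟩ := hc.exists_lift hsurj
  have hpb : ∀ x, p ((f - cochainD G B n b) x) = 0 := by
    intro x
    have := congrFun (cochainD_map p hp n b) x
    simp only [hbc, hdc] at this
    simp [← this]
  choose a ha using fun x => hex _ (hpb x)
  have hla : IsLocallyConstant a := by
    refine IsLocallyConstant.of_comp_injective hinj ?_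
    simp only [ha]
    exact hf.sub (hb.cochainD hB)
  have hda : cochainD G A (n + 1) a = 0 := by
    funext x
    apply hinj
    rw [← congrFun (cochainD_map i hi (n + 1) a) x]
    simp only [ha]
    have := congrFun (cochainD_sub (n + 1) f (cochainD G B n b)) x
    rw [hdf, cochainD_comp_cochainD, sub_zero] at this
    exact this.trans (map_zero i).symm
  obtain ⟨a', ha', hda'⟩ := h1 a hla hda
  refine ⟨(fun x => i (a' x)) + b, (ha'.comp i).add hb, ?_⟩
  rw [cochainD_add, cochainD_map i hi, hda']
  funext x
  simp [ha]

theorem HVan.right (hi : ∀ (g : G) a, i (g • a) = g • i a)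
    (hp : ∀ (g : G) b, p (g • b) = g • p b) (hinj : Function.Injective i)
    (hsurj : Function.Surjective p) (hex : ∀ b, p b = 0 ↔ ∃ a, i a = b) (hB : IsSmooth G B)
    {n : ℕ} (h1 : HVan G B n) (h2 : HVan G A (n + 1)) : HVan G C n := by
  intro f hf hdf
  obtain ⟨b, hb, hbf⟩ := hf.exists_lift hsurj
  have hpb : ∀ x, p (cochainD G B (n + 1) b x) = 0 := by
    intro x
    have := congrFun (cochainD_map p hp (n + 1) b) x
    simp only [hbf] at this
    rw [← this]
    exact congrFun hdf x
  choose a ha using fun x => (hex _).1 (hpb x)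
  have hla : IsLocallyConstant a := by
    refine IsLocallyConstant.of_comp_injective hinj ?_
    simp only [ha]
    exact hb.cochainD hB
  have hda : cochainD G A (n + 2) a = 0 := by
    funext x
    apply hinj
    rw [← congrFun (cochainD_map i hi (n + 2) a) x]
    simp only [ha]
    rw [show (fun x => cochainD G B (n + 1) b x) = cochainD G B (n + 1) b from rfl,
      cochainD_comp_cochainD]
    simp
  obtain ⟨a', ha', hda'⟩ := h2 a hla hda
  obtain ⟨b', hb', hdb'⟩ := h1 (b - fun x => i (a' x)) (hb.sub (ha'.comp i)) (by
    rw [cochainD_sub, cochainD_map i hi, hda']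
    funext x
    simp [ha])
  refine ⟨fun x => p (b' x), hb'.comp p, ?_⟩
  rw [cochainD_map p hp, hdb']
  funext x
  simp [hbf, (hex (i (a' x))).2 ⟨_, rfl⟩]

theorem HVan.left (hi : ∀ (g : G) a, i (g • a) = g • i a)
    (hp : ∀ (g : G) b, p (g • b) = g • p b) (hinj : Function.Injective i)
    (hsurj : Function.Surjective p) (hex : ∀ b, p b = 0 ↔ ∃ a, i a = b) (hB : IsSmooth G B)
    {n : ℕ} (h1 : HVan G C n) (h2 : HVan G B (n + 1)) : HVan G A (n + 1) := by
  intro f hf hdf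
  obtain ⟨b, hb, hdb⟩ := h2 (fun x => i (f x)) (hf.comp i) (by
    rw [cochainD_map i hi, hdf]; funext; simp)
  obtain ⟨c, hc, hdc⟩ := h1 (fun x => p (b x)) (hb.comp p) (by
    rw [cochainD_map p hp, hdb]
    funext x
    exact (hex _).2 ⟨_, rfl⟩)
  obtain ⟨b', hb', hbc⟩ := hc.exists_lift hsurj
  have hpb : ∀ x, p ((b - cochainD G B n b') x) = 0 := by
    intro x
    have := congrFun (cochainD_map p hp n b') x
    simp only [hbc, hdc] at this
    simp [this]
  choose a ha using fun x => (hex _).1 (hpb x)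
  refine ⟨a, IsLocallyConstant.of_comp_injective hinj ?_, ?_⟩
  · simp only [ha]
    exact hb.sub (hb'.cochainD hB)
  · funext x
    apply hinj
    rw [← congrFun (cochainD_map i hi (n + 1) a) x]
    simp only [ha]
    have := congrFun (cochainD_sub (n + 1) b (cochainD G B n b')) x
    rw [cochainD_comp_cochainD, hdb, sub_zero] at this
    exact this

theorem HVan.of_equiv (e : A ≃+ B) (he : ∀ (g : G) a, e (g • a) = g • e a) {n : ℕ}
    (h : HVan G A n) : HVan G B n := by
  have he' : ∀ (g : G) b, e.symm (g • b) = g • e.symm b := fun g b => by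
    rw [AddEquiv.symm_apply_eq, he, AddEquiv.apply_symm_apply]
  intro f hf hdf
  obtain ⟨a, ha, hda⟩ := h (fun x => e.symm.toAddMonoidHom (f x)) (hf.comp _) (by
    rw [cochainD_map _ he', hdf]; funext; simp)
  refine ⟨fun x => e.toAddMonoidHom (a x), ha.comp _, ?_⟩
  rw [cochainD_map _ he, hda]
  funext x
  simp

end Exact

end CochainComplex

section Profinite

variable {G : Type} [Group G] [TopologicalSpace G] [IsTopologicalGroup G] [CompactSpace G]
  [TotallyDisconnectedSpace G]

theorem exists_normal_subset_of_mem_nhds {U : Set G} (hU : U ∈ nhds 1) :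
    ∃ V : Subgroup G, V.Normal ∧ IsOpen (V : Set G) ∧ (V : Set G) ⊆ U := by
  obtain ⟨s', hs', ho, h1s⟩ := mem_nhds_iff.1 hU
  obtain ⟨V, hV⟩ := ProfiniteGrp.exist_openNormalSubgroup_sub_open_nhds_of_one ho h1s
  exact ⟨V.toSubgroup, V.isNormal', V.toOpenSubgroup.isOpen, hV.trans hs'⟩

theorem IsLocallyConstant.exists_normal {X : Type} {f : G → X}
    (hf : IsLocallyConstant f) :
    ∃ V : Subgroup G, V.Normal ∧ IsOpen (V : Set G) ∧ ∀ x, ∀ v ∈ V, f (x * v) = f x := by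
  have ho : IsOpen {y : G × G | f (y.1 * y.2) = f y.1} := by
    have h1 : IsLocallyConstant fun y : G × G => f (y.1 * y.2) :=
      hf.comp_continuous (f := fun y : G × G => y.1 * y.2) (by fun_prop)
    have h2 : IsLocallyConstant fun y : G × G => f y.1 :=
      hf.comp_continuous (f := fun y : G × G => y.1) (by fun_prop)
    have h3 := (h1.comp₂ h2 (fun a b => a = b)).isOpen_fiber True
    simpa using h3
  obtain ⟨u, v, hu, hv, hu', hv', huv⟩ := generalized_tube_lemma (isCompact_univ (X := G))
    (isCompact_singleton (x := (1 : G))) ho (by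
      rintro ⟨x, y⟩ ⟨-, hy⟩
      simp_all)
  obtain ⟨V, hVn, hVo, hV⟩ := exists_normal_subset_of_mem_nhds (hv.mem_nhds (hv' rfl))
  exact ⟨V, hVn, hVo, fun x w hw => huv (Set.mk_mem_prod (hu' trivial) (hV hw))⟩

theorem exists_normal_le_of_finite {ι : Type} {s : Set ι} (hs : s.Finite)
    {V : ι → Subgroup G} (hV : ∀ i, (V i).Normal ∧ IsOpen (V i : Set G)) :
    ∃ W : Subgroup G, W.Normal ∧ IsOpen (W : Set G) ∧ ∀ i ∈ s, W ≤ V i := by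
  induction s, hs using Set.Finite.induction_on with
  | empty => exact ⟨⊤, inferInstance, isOpen_univ, by simp⟩
  | @insert j _ _ _ ih =>
    obtain ⟨W, hWn, hWo, hW⟩ := ih
    have := (hV j).1
    refine ⟨W ⊓ V j, inferInstance, hWo.inter (hV j).2, fun i hi => ?_⟩
    rcases hi with rfl | hi
    · exact inf_le_right
    · exact inf_le_left.trans (hW i hi)

theorem Subgroup.exists_normal_subset_pi {H : Subgroup G} {n : ℕ} {U : Set (Fin n → H)}
    (hU : U ∈ nhds 1) :
    ∃ V : Subgroup G, V.Normal ∧ IsOpen (V : Set G) ∧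
      ∀ h : Fin n → H, (∀ i, (h i : G) ∈ V) → h ∈ U := by
  rw [nhds_pi, Filter.mem_pi] at hU
  obtain ⟨I, -, t, ht, htU⟩ := hU
  have : ∀ i, ∃ V : Subgroup G, (V.Normal ∧ IsOpen (V : Set G)) ∧
      ∀ h : H, (h : G) ∈ V → h ∈ t i := by
    intro i
    have h1 := ht i
    rw [Pi.one_apply, nhds_subtype_eq_comap, Filter.mem_comap] at h1
    obtain ⟨s, hs, hst⟩ := h1
    obtain ⟨V, hVn, hVo, hV⟩ := exists_normal_subset_of_mem_nhds hs
    exact ⟨V, ⟨hVn, hVo⟩, fun h hh => hst (hV hh)⟩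
  choose V hVno hV using this
  obtain ⟨W, hWn, hWo, hW⟩ := exists_normal_le_of_finite (Set.finite_univ (α := Fin n)) hVno
  exact ⟨W, hWn, hWo, fun h hh => htU fun i _ => hV i _ (hW i (Set.mem_univ i) (hh i))⟩

theorem IsLocallyConstant.exists_normal_pi {X : Type} {H : Subgroup G}
    (hH : IsClosed (H : Set G)) {n : ℕ} {f : (Fin n → H) → X} (hf : IsLocallyConstant f) :
    ∃ V : Subgroup G, V.Normal ∧ IsOpen (V : Set G) ∧
      ∀ h h' : Fin n → H, (∀ i, (h i : G)⁻¹ * h' i ∈ V) → f h = f h' := by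
  have : CompactSpace H := isCompact_iff_compactSpace.1 hH.isCompact
  obtain ⟨W, -, hWo, hW⟩ := hf.exists_normal
  obtain ⟨V, hVn, hVo, hV⟩ := Subgroup.exists_normal_subset_pi
    (U := (W : Set (Fin n → H))) (hWo.mem_nhds W.one_mem)
  refine ⟨V, hVn, hVo, fun h h' hh => ?_⟩
  have := hW h (h⁻¹ * h') (hV _ hh)
  rwa [mul_inv_cancel_left, eq_comm] at this

end Profinite

section Coind

/-- The group of locally constant functions `G → M`. -/
def Coind (G M : Type) [TopologicalSpace G] [AddCommGroup M] : AddSubgroup (G → M) where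
  carrier := {f | IsLocallyConstant f}
  add_mem' := fun hf hg => hf.add hg
  zero_mem' := IsLocallyConstant.const 0
  neg_mem' := fun hf => hf.neg

variable {G : Type} [Group G] [TopologicalSpace G] [IsTopologicalGroup G]
  {M : Type} [AddCommGroup M]

/-- `G` acts on locally constant functions by right translation. -/
instance : DistribMulAction G (Coind G M) where
  smul g f := ⟨fun x => f.1 (x * g), f.2.comp_continuous (continuous_mul_const g)⟩
  one_smul f := Subtype.ext (funext fun x => congrArg f.1 (mul_one x))
  mul_smul g h f := Subtype.ext (funext fun x => congrArg f.1 (mul_assoc x g h).symm)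
  smul_zero _ := rfl
  smul_add _ _ _ := rfl

theorem Coind.smul_apply (g : G) (f : Coind G M) (x : G) : (g • f).1 x = f.1 (x * g) := rfl

variable [DistribMulAction G M]

/-- The image of `M` in the group of locally constant functions `G → M`. -/
def coindConst (G M : Type) [Group G] [TopologicalSpace G]
    [AddCommGroup M] [DistribMulAction G M] : AddSubgroup (Coind G M) where
  carrier := {f | ∃ m : M, ∀ x : G, f.1 x = x • m}
  add_mem' := by
    rintro f g ⟨m, hm⟩ ⟨m', hm'⟩
    exact ⟨m + m', fun x => by rw [smul_add, ← hm, ← hm']; rfl⟩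
  zero_mem' := ⟨0, fun x => (smul_zero x).symm⟩
  neg_mem' := by
    rintro f ⟨m, hm⟩
    exact ⟨-m, fun x => by rw [smul_neg, ← hm]; rfl⟩

theorem smul_mem_coindConst (g : G) {f : Coind G M} (hf : f ∈ coindConst G M) :
    g • f ∈ coindConst G M := by
  obtain ⟨m, hm⟩ := hf
  exact ⟨g • m, fun x => by rw [Coind.smul_apply, hm, mul_smul]⟩

/-- The dimension shift of a `G`-module `M`: the quotient of the coinduced module
by `M`. -/
def Shift (G M : Type) [Group G] [TopologicalSpace G]
    [AddCommGroup M] [DistribMulAction G M] : Type :=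
  Coind G M ⧸ coindConst G M

instance : AddCommGroup (Shift G M) := inferInstanceAs (AddCommGroup (Coind G M ⧸ coindConst G M))

/-- The projection from the coinduced module to the dimension shift. -/
def Shift.mk (G M : Type) [Group G] [TopologicalSpace G]
    [AddCommGroup M] [DistribMulAction G M] : Coind G M →+ Shift G M :=
  QuotientAddGroup.mk' _

theorem Shift.mk_surjective : Function.Surjective (Shift.mk G M) :=
  QuotientAddGroup.mk'_surjective _

theorem Shift.mk_eq_zero_iff (f : Coind G M) : Shift.mk G M f = 0 ↔ f ∈ coindConst G M :=
  QuotientAddGroup.eq_zero_iff f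

instance : DistribMulAction G (Shift G M) where
  smul g := QuotientAddGroup.map (coindConst G M) (coindConst G M) (DistribSMul.toAddMonoidHom (Coind G M) g)
    fun f hf => smul_mem_coindConst g (f := f) hf
  one_smul f := by
    obtain ⟨f, rfl⟩ := Shift.mk_surjective f
    exact congrArg (Shift.mk G M) (one_smul G f)
  mul_smul g h f := by
    obtain ⟨f, rfl⟩ := Shift.mk_surjective f
    exact congrArg (Shift.mk G M) (mul_smul g h f)
  smul_zero g := map_zero (QuotientAddGroup.map _ _ _ _)
  smul_add g := map_add (QuotientAddGroup.map _ _ _ _)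

theorem Shift.mk_smul (g : G) (f : Coind G M) : Shift.mk G M (g • f) = g • Shift.mk G M f := rfl

/-- The embedding of a smooth module in the coinduced module. -/
def coindEmb (hM : IsSmooth G M) : M →+ Coind G M where
  toFun m := ⟨fun x => x • m, hM m⟩
  map_zero' := Subtype.ext (funext fun x => smul_zero x)
  map_add' _ _ := Subtype.ext (funext fun x => smul_add x _ _)

theorem coindEmb_smul (hM : IsSmooth G M) (g : G) (m : M) :
    coindEmb hM (g • m) = g • coindEmb hM m :=
  Subtype.ext (funext fun x => (mul_smul x g m).symm)

theorem coindEmb_injective (hM : IsSmooth G M) : Function.Injective (coindEmb hM) := by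
  intro a b h
  simpa [coindEmb] using congrFun (congrArg Subtype.val h) 1

theorem Shift.mk_eq_zero_iff_exists (hM : IsSmooth G M) (f : Coind G M) :
    Shift.mk G M f = 0 ↔ ∃ m, coindEmb hM m = f := by
  rw [Shift.mk_eq_zero_iff]
  exact ⟨fun ⟨m, hm⟩ => ⟨m, Subtype.ext (funext fun x => (hm x).symm)⟩,
    fun ⟨m, hm⟩ => ⟨m, fun x => by rw [← hm]; rfl⟩⟩

variable [CompactSpace G] [TotallyDisconnectedSpace G]

omit [DistribMulAction G M] in
theorem Coind.isSmooth : IsSmooth G (Coind G M) := by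
  intro f
  obtain ⟨V, -, hVo, hV⟩ := f.2.exists_normal
  rw [IsLocallyConstant.iff_eventually_eq]
  intro g
  have : (fun h => g⁻¹ * h) ⁻¹' (V : Set G) ∈ nhds g :=
    (hVo.preimage (by fun_prop)).mem_nhds (by simp)
  filter_upwards [this] with h hh
  refine Subtype.ext (funext fun x => ?_)
  have := hV (x * g) _ hh
  rwa [mul_assoc, mul_inv_cancel_left] at this

theorem Shift.isSmooth : IsSmooth G (Shift G M) := by
  intro f
  obtain ⟨f, rfl⟩ := Shift.mk_surjective f
  exact (Coind.isSmooth f).comp (Shift.mk G M)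

omit [DistribMulAction G M] in
theorem Coind.exists_pow_smul_eq_zero {ℓ : ℕ} (hM : ∀ x : M, ∃ k : ℕ, ℓ ^ k • x = 0)
    (f : Coind G M) : ∃ k : ℕ, ℓ ^ k • f = 0 := by
  choose k hk using hM
  obtain ⟨N, hN⟩ := (f.2.range_finite.image k).bddAbove
  refine ⟨N, Subtype.ext (funext fun x => ?_)⟩
  obtain ⟨c, hc⟩ := Nat.exists_eq_add_of_le (hN ⟨f.1 x, ⟨x, rfl⟩, rfl⟩)
  show ℓ ^ N • f.1 x = 0
  rw [hc, add_comm, pow_add, mul_smul, hk, smul_zero]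

theorem Shift.exists_pow_smul_eq_zero {ℓ : ℕ} (hM : ∀ x : M, ∃ k : ℕ, ℓ ^ k • x = 0)
    (f : Shift G M) : ∃ k : ℕ, ℓ ^ k • f = 0 := by
  obtain ⟨f, rfl⟩ := Shift.mk_surjective f
  obtain ⟨k, hk⟩ := Coind.exists_pow_smul_eq_zero hM f
  exact ⟨k, by rw [← map_nsmul, hk, map_zero]⟩

omit [DistribMulAction G M] in
/-- Coinduced modules are acyclic for closed subgroups. -/
theorem Coind.hVan (H : Subgroup G) (hH : IsClosed (H : Set G)) (n : ℕ) :
    HVan H (Coind G M) n := by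
  intro f hf hdf
  have : CompactSpace H := isCompact_iff_compactSpace.1 hH.isCompact
  obtain ⟨V₁, hV₁n, hV₁o, hV₁⟩ := hf.exists_normal_pi hH
  choose V₂ hV₂n hV₂o hV₂ using fun φ : Coind G M => φ.2.exists_normal
  obtain ⟨W, hWn, hWo, hW⟩ := exists_normal_le_of_finite hf.range_finite
    fun φ => ⟨hV₂n φ, hV₂o φ⟩
  obtain ⟨V, hVn, hVo, hVV₁, hVW⟩ : ∃ V : Subgroup G, V.Normal ∧ IsOpen (V : Set G) ∧
      V ≤ V₁ ∧ V ≤ W :=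
    ⟨V₁ ⊓ W, inferInstance, hV₁o.inter hWo, inf_le_left, inf_le_right⟩
  let q : G →* G ⧸ V := QuotientGroup.mk' V
  have hq : ∀ x y, q x = q y ↔ x⁻¹ * y ∈ V := fun x y => QuotientGroup.eq
  have hqn : ∀ x : G, ∀ᶠ y in nhds x, q x = q y := by
    intro x
    have : (fun y => x⁻¹ * y) ⁻¹' (V : Set G) ∈ nhds x :=
      (hVo.preimage (by fun_prop)).mem_nhds (by simp)
    filter_upwards [this] with y hy
    exact (hq x y).2 hy
  have key : ∀ (h h' : Fin (n + 1) → H) (x x' : G), (∀ i, q (h i) = q (h' i)) →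
      q x = q x' → (f h).1 x = (f h').1 x' := by
    intro h h' x x' hh hx
    rw [hV₁ h h' fun i => hVV₁ ((hq _ _).1 (hh i)),
      ← hV₂ (f h') x _ (hW _ ⟨h', rfl⟩ (hVW ((hq _ _).1 hx))), mul_inv_cancel_left]
  -- an approximate equivariant retraction `s : G → H`
  obtain ⟨r, s, hrs, hr⟩ : ∃ (r : G → G ⧸ V) (s : G → H), (∀ x, q x = r x * q (s x)) ∧
      ∀ x y, (∃ h ∈ H, q x = q y * q h) → r x = r y := by
    have hout : ∀ x : G, ∃ h : H,
        q x = (QuotientGroup.mk (q x) : (G ⧸ V) ⧸ H.map q).out * q h := by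
      intro x
      obtain ⟨⟨_, h, hh, rfl⟩, e⟩ := QuotientGroup.mk_out_eq_mul (H.map q) (q x)
      exact ⟨⟨h, hh⟩⁻¹, by simp [e]⟩
    choose s hs using hout
    refine ⟨_, s, hs, ?_⟩
    rintro x y ⟨h, hh, e⟩
    rw [(QuotientGroup.eq (s := H.map q)).2]
    rw [e]
    exact ⟨h⁻¹, H.inv_mem hh, by simp⟩
  have hs1 : ∀ x (h : H), q (s (x * h)) = q (s x) * q h := by
    intro x h
    have e1 : r (x * h) = r x := hr _ _ ⟨h, h.2, map_mul q _ _⟩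
    have e2 := hrs (x * h)
    rw [map_mul, e1, hrs x, mul_assoc] at e2
    exact (mul_left_cancel e2).symm
  have hs2 : ∀ x y, q x = q y → q (s x) = q (s y) := by
    intro x y hxy
    have e1 : r x = r y := hr _ _ ⟨1, H.one_mem, by simpa using hxy⟩
    have e2 := hrs x
    rw [hxy, hrs y, e1] at e2
    exact (mul_left_cancel e2).symm
  have hlc : ∀ h : Fin n → H,
      IsLocallyConstant fun x => (f (Fin.cons (s x) h)).1 (x * (s x : G)⁻¹) := by
    intro h
    rw [IsLocallyConstant.iff_eventually_eq]
    intro x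
    filter_upwards [hqn x] with y hy
    refine key _ _ _ _ (fun i => ?_) ?_
    · refine Fin.cases ?_ (fun j => ?_) i
      · simpa using (hs2 x y hy).symm
      · simp
    · rw [map_mul, map_mul, map_inv, map_inv, hs2 x y hy, hy]
  refine ⟨fun h => ⟨_, hlc h⟩, ?_, ?_⟩
  · rw [IsLocallyConstant.iff_eventually_eq]
    intro h
    have h1 : ∀ i, ∀ᶠ y : Fin n → H in nhds h, q (h i) = q (y i) := fun i =>
      (Continuous.tendsto (f := fun y : Fin n → H => (y i : G)) (by fun_prop) h).eventually
        (hqn (h i))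
    filter_upwards [Filter.eventually_all.2 h1] with y hy
    refine Subtype.ext (funext fun x => ?_)
    refine (key _ _ _ _ (fun i => ?_) rfl).symm
    refine Fin.cases ?_ (fun j => ?_) i
    · simp
    · simpa using hy j
  · funext h
    refine Subtype.ext (funext fun x => ?_)
    let ev : ∀ y : G, Coind G M →+ M := fun y =>
      { toFun := fun φ => φ.1 y, map_zero' := rfl, map_add' := fun _ _ => rfl }
    have e := congrArg (ev (x * (s x : G)⁻¹)) (congrFun hdf (Fin.cons (s x) h))
    rw [cochainD_cons, map_sub, map_sub, map_sum, Pi.zero_apply, map_zero, sub_sub,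
      sub_eq_zero] at e
    have e1 : ev (x * (s x : G)⁻¹) (s x • f h) = (f h).1 x := by
      show (f h).1 (x * (s x : G)⁻¹ * s x) = _
      rw [inv_mul_cancel_right]
    rw [← e1, e]
    show ev x (_ + _) = _
    rw [map_add, map_sum]
    congr 1
    · show (f (Fin.cons (s (x * h 0)) fun i => h i.succ)).1 (x * h 0 * (s (x * h 0) : G)⁻¹) = _
      refine key _ _ _ _ (fun i => ?_) ?_
      · refine Fin.cases ?_ (fun j => ?_) i
        · simpa using hs1 x (h 0)
        · simp
      · rw [map_mul, map_mul, map_mul, map_inv, map_inv, hs1]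
        group

end Coind

section Transport

variable {G : Type} [Group G] [TopologicalSpace G] {H : Type} [Group H] [TopologicalSpace H]
  {A B : Type} [AddCommGroup A] [DistribMulAction G A] [AddCommGroup B] [DistribMulAction H B]

theorem cochainD_comp (φ : H →* G) (j : A →+ B) (hj : ∀ h a, j (φ h • a) = h • j a) (n : ℕ)
    (f : (Fin n → G) → A) :
    cochainD H B n (fun x => j (f fun i => φ (x i))) =
      fun x => j (cochainD G A n f fun i => φ (x i)) := by
  funext x
  simp only [cochainD, map_add, map_sum, hj, map_zsmul]
  congr 1
  refine Finset.sum_congr rfl fun k _ => ?_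
  congr 3
  funext i
  simp only [Fin.contractNth]
  split_ifs <;> simp

theorem HVan.of_equiv₂ (e : G ≃* H) (he : Continuous e) (he' : Continuous e.symm) (j : A ≃+ B)
    (hj : ∀ g a, j (g • a) = e g • j a) {n : ℕ} (h : HVan G A n) : HVan H B n := by
  intro f hf hdf
  have hj' : ∀ (g : G) b, j.symm (e g • b) = g • j.symm b := fun g b => by
    rw [AddEquiv.symm_apply_eq, hj, AddEquiv.apply_symm_apply]
  have hj'' : ∀ (h : H) a, j (e.symm h • a) = h • j a := fun h a => by
    rw [hj, MulEquiv.apply_symm_apply]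
  obtain ⟨g, hg, hdg⟩ := h (fun x => j.symm (f fun i => e (x i)))
    ((hf.comp_continuous (f := fun (x : Fin (n + 1) → G) i => e (x i)) (by fun_prop)).comp j.symm)
    (by
      have := cochainD_comp e.toMonoidHom j.symm.toAddMonoidHom hj' (n + 1) f
      refine this.trans ?_
      rw [hdf]
      funext
      exact map_zero j.symm)
  refine ⟨fun x => j (g fun i => e.symm (x i)), (hg.comp_continuous
    (f := fun (x : Fin n → H) i => e.symm (x i)) (by fun_prop)).comp j, ?_⟩
  refine (cochainD_comp e.symm.toMonoidHom j.toAddMonoidHom hj'' n g).trans ?_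
  rw [hdg]
  funext x
  simp

variable [DistribMulAction H A]

theorem hVan_zero_iff : HVan G A 0 ↔ ∀ f : G → A, IsLocallyConstant f →
    (∀ x y, f (x * y) = f x + x • f y) → ∃ a, ∀ x, f x = x • a - a := by
  constructor
  · intro h f hf hd
    obtain ⟨g, -, hg⟩ := h (fun x => f (x 0))
      (hf.comp_continuous (f := fun x : Fin 1 → G => x 0) (by fun_prop)) (by
        funext x
        simp [cochainD, Fin.sum_univ_two, Fin.contractNth, hd])
    refine ⟨g Fin.elim0, fun x => ?_⟩
    have := congrFun hg fun _ => x
    simp only [cochainD] at this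
    rw [← this]
    simp [sub_eq_add_neg]
    congr 2 <;> · congr 1; exact Subsingleton.elim _ _
  · intro h f hf hd
    obtain ⟨a, ha⟩ := h (fun x => f fun _ => x)
      (hf.comp_continuous (f := fun x : G => fun _ : Fin 1 => x) (by fun_prop)) (by
        intro x y
        have := congrFun hd ![x, y]
        simp [cochainD, Fin.sum_univ_two] at this
        have e1 : Fin.contractNth 0 (· * ·) ![x, y] = fun _ => x * y := by
          funext i; fin_cases i; simp [Fin.contractNth]
        have e2 : Fin.contractNth 1 (· * ·) ![x, y] = fun _ => x := by
          funext i; fin_cases i; simp [Fin.contractNth]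
        have e3 : (fun _ => y : Fin 1 → G) = ![y] := by
          funext i; fin_cases i; rfl
        simp [e1, e2] at this
        rw [← sub_eq_zero, ← neg_eq_zero, ← this]
        abel_nf)
    refine ⟨fun _ => a, IsLocallyConstant.const a, ?_⟩
    funext x
    have e : x = fun _ => x 0 := by
      funext i; fin_cases i; rfl
    rw [e, ha]
    simp [cochainD, sub_eq_add_neg]

end Transport

section DimensionShift

variable {G : Type} [Group G] [TopologicalSpace G] [IsTopologicalGroup G] [CompactSpace G]
  [TotallyDisconnectedSpace G] {M : Type} [AddCommGroup M] [DistribMulAction G M]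

theorem IsSmooth.subgroup (hM : IsSmooth G M) (H : Subgroup G) : IsSmooth H M :=
  fun m => (hM m).comp_continuous continuous_subtype_val

theorem HVan.of_subgroup_top {n : ℕ} (h : HVan (⊤ : Subgroup G) M n) : HVan G M n :=
  h.of_equiv₂ (Subgroup.topEquiv (G := G)) continuous_subtype_val
    (Continuous.subtype_mk continuous_id _) (AddEquiv.refl M) fun _ _ => rfl

theorem hVan_subgroup_succ_iff (hM : IsSmooth G M) {H : Subgroup G} (hH : IsClosed (H : Set G))
    (n : ℕ) : HVan H M (n + 1) ↔ HVan H (Shift G M) n :=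
  ⟨fun h => HVan.right (G := H) (i := coindEmb hM) (p := Shift.mk G M) (fun g a => coindEmb_smul hM g a)
      (fun g b => Shift.mk_smul (g : G) b) (coindEmb_injective hM) Shift.mk_surjective
      (Shift.mk_eq_zero_iff_exists hM) (Coind.isSmooth.subgroup H) (Coind.hVan H hH n) h,
    fun h => HVan.left (G := H) (i := coindEmb hM) (p := Shift.mk G M) (fun g a => coindEmb_smul hM g a)
      (fun g b => Shift.mk_smul (g : G) b) (coindEmb_injective hM) Shift.mk_surjective
      (Shift.mk_eq_zero_iff_exists hM) (Coind.isSmooth.subgroup H) h (Coind.hVan H hH (n + 1))⟩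

omit [DistribMulAction G M] in
theorem Coind.hVan_self (n : ℕ) : HVan G (Coind G M) n :=
  (Coind.hVan ⊤ isClosed_univ n).of_subgroup_top

theorem hVan_succ_iff (hM : IsSmooth G M) (n : ℕ) : HVan G M (n + 1) ↔ HVan G (Shift G M) n :=
  ⟨fun h => HVan.right (coindEmb_smul hM) Shift.mk_smul (coindEmb_injective hM)
      Shift.mk_surjective (Shift.mk_eq_zero_iff_exists hM) Coind.isSmooth (Coind.hVan_self n) h,
    fun h => HVan.left (coindEmb_smul hM) Shift.mk_smul (coindEmb_injective hM)
      Shift.mk_surjective (Shift.mk_eq_zero_iff_exists hM) Coind.isSmooth h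
      (Coind.hVan_self (n + 1))⟩

end DimensionShift

section Inflation

variable {G Q : Type} [Group G] [Group Q] {π : G →* Q} {hπ : Function.Surjective π}
  {M : Type} [AddCommGroup M] [DistribMulAction G M]

/-- The invariants of a `G`-module under the kernel of a surjection `π : G → Q`, viewed as a
`Q`-module. -/
def KerInv (π : G →* Q) (_ : Function.Surjective π) (M : Type) [AddCommGroup M]
    [DistribMulAction G M] : AddSubgroup M where
  carrier := {m | ∀ g, π g = 1 → g • m = m}
  add_mem' := fun ha hb g hg => by rw [smul_add, ha g hg, hb g hg]
  zero_mem' := fun g _ => smul_zero g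
  neg_mem' := fun ha g hg => by rw [smul_neg, ha g hg]

theorem KerInv.smul_eq {m : M} (hm : m ∈ KerInv π hπ M) {g h : G} (hgh : π g = π h) :
    g • m = h • m := by
  have := hm (h⁻¹ * g) (by simp [hgh])
  rwa [mul_smul, inv_smul_eq_iff] at this

theorem KerInv.smul_mem {m : M} (hm : m ∈ KerInv π hπ M) (g : G) : g • m ∈ KerInv π hπ M := by
  intro h hh
  rw [← mul_smul]
  exact KerInv.smul_eq hm (by simp [hh])

noncomputable instance : DistribMulAction Q (KerInv π hπ M) where
  smul q m := ⟨Function.surjInv hπ q • m.1, KerInv.smul_mem m.2 _⟩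
  one_smul m := Subtype.ext ((KerInv.smul_eq m.2
    (by rw [Function.surjInv_eq hπ, map_one])).trans (one_smul G m.1))
  mul_smul p q m := Subtype.ext ((KerInv.smul_eq m.2
    (by rw [map_mul, Function.surjInv_eq hπ, Function.surjInv_eq hπ, Function.surjInv_eq hπ])).trans
      (mul_smul _ _ m.1))
  smul_zero q := Subtype.ext (smul_zero _)
  smul_add q a b := Subtype.ext (smul_add _ a.1 b.1)

theorem KerInv.coe_smul (g : G) (m : KerInv π hπ M) : ((π g • m : KerInv π hπ M) : M) = g • m.1 :=
  KerInv.smul_eq m.2 (Function.surjInv_eq hπ _)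

/-- Functoriality of the invariants. -/
def KerInv.map {M' : Type} [AddCommGroup M'] [DistribMulAction G M'] (j : M →+ M')
    (hj : ∀ (g : G) m, j (g • m) = g • j m) : KerInv π hπ M →+ KerInv π hπ M' where
  toFun m := ⟨j m.1, fun g hg => by rw [← hj, m.2 g hg]⟩
  map_zero' := Subtype.ext (map_zero j)
  map_add' a b := Subtype.ext (map_add j _ _)

theorem KerInv.map_smul {M' : Type} [AddCommGroup M'] [DistribMulAction G M'] (j : M →+ M')
    (hj : ∀ (g : G) m, j (g • m) = g • j m) (q : Q) (m : KerInv π hπ M) :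
    KerInv.map j hj (q • m) = q • KerInv.map j hj m :=
  Subtype.ext (hj _ _)

variable [TopologicalSpace G] [TopologicalSpace Q]

theorem IsLocallyConstant.of_comp_quotientMap (hq : Topology.IsQuotientMap π) {X : Type} {f : Q → X}
    (hf : IsLocallyConstant fun g => f (π g)) : IsLocallyConstant f := by
  intro s
  exact hq.isOpen_preimage.1 (hf s)

theorem KerInv.isSmooth (hq : Topology.IsQuotientMap π) (hM : IsSmooth G M) :
    IsSmooth Q (KerInv π hπ M) := by
  intro m
  refine IsLocallyConstant.of_comp_quotientMap hq ?_
  refine IsLocallyConstant.of_comp_injective Subtype.val_injective ?_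
  simp only [KerInv.coe_smul]
  exact hM m.1

variable [IsTopologicalGroup G] [CompactSpace G] [TotallyDisconnectedSpace G]
  [IsTopologicalGroup Q] [CompactSpace Q] [TotallyDisconnectedSpace Q]

theorem KerInv.coind_hVan (hq : Topology.IsQuotientMap π) (n : ℕ) :
    HVan Q (KerInv π hπ (Coind G M)) n := by
  let j : Coind Q M →+ KerInv π hπ (Coind G M) :=
    { toFun := fun φ => ⟨⟨fun g => φ.1 (π g), φ.2.comp_continuous hq.continuous⟩, fun g hg =>
        Subtype.ext (funext fun x => by
          show φ.1 (π (x * g)) = φ.1 (π x)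
          rw [map_mul, hg, mul_one])⟩
      map_zero' := rfl
      map_add' := fun _ _ => rfl }
  have hj : Function.Bijective j := by
    constructor
    · intro a b hab
      refine Subtype.ext (funext fun q => ?_)
      obtain ⟨g, rfl⟩ := hπ q
      exact congrFun (congrArg (fun y => y.1.1) hab) g
    · intro ψ
      have h1 : ∀ g, ψ.1.1 (Function.surjInv hπ (π g)) = ψ.1.1 g := by
        intro g
        have := congrFun (congrArg Subtype.val
          (ψ.2 (g⁻¹ * Function.surjInv hπ (π g)) (by simp [Function.surjInv_eq]))) g
        rwa [Coind.smul_apply, mul_inv_cancel_left] at this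
      refine ⟨⟨fun q => ψ.1.1 (Function.surjInv hπ q),
        IsLocallyConstant.of_comp_quotientMap hq ?_⟩, ?_⟩
      · simp only [h1]
        exact ψ.1.2
      · exact Subtype.ext (Subtype.ext (funext h1))
  refine (Coind.hVan_self (G := Q) (M := M) n).of_equiv (AddEquiv.ofBijective j hj) ?_
  intro q φ
  obtain ⟨g, rfl⟩ := hπ q
  refine Subtype.ext ?_
  show _ = ((π g • (j φ) : KerInv π hπ (Coind G M)) : Coind G M)
  rw [KerInv.coe_smul]
  refine Subtype.ext (funext fun x => ?_)
  show φ.1 (π x * π g) = φ.1 (π (x * g))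
  rw [map_mul]

theorem KerInv.mk_surjective (hM : IsSmooth G M) (h : HVan π.ker M 0) :
    Function.Surjective (KerInv.map (π := π) (hπ := hπ) (Shift.mk G M) Shift.mk_smul) := by
  rintro ⟨s, hs⟩
  obtain ⟨φ, rfl⟩ := Shift.mk_surjective s
  have h1 : ∀ g : π.ker, ∃ m, coindEmb hM m = (g : G) • φ - φ := by
    intro g
    rw [← Shift.mk_eq_zero_iff_exists, map_sub, Shift.mk_smul, hs g g.2, sub_self]
  choose f hf using h1
  obtain ⟨m, hm⟩ := hVan_zero_iff.1 h f (by
    refine IsLocallyConstant.of_comp_injective (coindEmb_injective hM) ?_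
    simp only [hf]
    exact (Coind.isSmooth.subgroup π.ker φ).sub (IsLocallyConstant.const φ)) (by
    intro x y
    apply coindEmb_injective hM
    rw [map_add, hf, hf]
    show _ = _ + coindEmb hM ((x : G) • f y)
    rw [coindEmb_smul, hf, Subgroup.coe_mul, mul_smul, smul_sub]
    abel)
  refine ⟨⟨φ - coindEmb hM m, fun g hg => ?_⟩, Subtype.ext ?_⟩
  · have h2 := hf ⟨g, hg⟩
    rw [hm ⟨g, hg⟩, map_sub] at h2
    have h3 : coindEmb hM ((⟨g, hg⟩ : π.ker) • m) = g • coindEmb hM m := coindEmb_smul hM g m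
    rw [h3] at h2
    rw [smul_sub]
    have := sub_eq_zero.2 h2
    rw [← sub_eq_zero, ← neg_eq_zero, ← this]
    simp only
    abel
  · show Shift.mk G M _ = _
    rw [map_sub, (Shift.mk_eq_zero_iff_exists hM _).2 ⟨m, rfl⟩, sub_zero]

theorem KerInv.hVan_succ_iff (hq : Topology.IsQuotientMap π) (hM : IsSmooth G M)
    (h : HVan π.ker M 0) (n : ℕ) :
    HVan Q (KerInv π hπ M) (n + 1) ↔ HVan Q (KerInv π hπ (Shift G M)) n := by
  have hi := KerInv.map_smul (π := π) (hπ := hπ) (coindEmb hM) (coindEmb_smul hM)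
  have hp := KerInv.map_smul (π := π) (hπ := hπ) (Shift.mk G M) Shift.mk_smul
  have hinj : Function.Injective (KerInv.map (π := π) (hπ := hπ) (coindEmb hM)
      (coindEmb_smul hM)) := fun a b hab =>
    Subtype.ext (coindEmb_injective hM (congrArg Subtype.val hab))
  have hex : ∀ b, KerInv.map (π := π) (hπ := hπ) (Shift.mk G M) Shift.mk_smul b = 0 ↔
      ∃ a, KerInv.map (π := π) (hπ := hπ) (coindEmb hM) (coindEmb_smul hM) a = b := by
    intro b
    constructor
    · intro hb
      obtain ⟨m, hm⟩ := (Shift.mk_eq_zero_iff_exists hM b.1).1 (congrArg Subtype.val hb)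
      refine ⟨⟨m, fun g hg => coindEmb_injective hM ?_⟩, Subtype.ext hm⟩
      rw [coindEmb_smul, hm, b.2 g hg]
    · rintro ⟨a, rfl⟩
      exact Subtype.ext ((Shift.mk_eq_zero_iff_exists hM _).2 ⟨a.1, rfl⟩)
  have hsm := KerInv.isSmooth (hπ := hπ) hq (Coind.isSmooth (G := G) (M := M))
  exact ⟨fun h' => HVan.right hi hp hinj (KerInv.mk_surjective hM h) hex hsm
      (KerInv.coind_hVan hq n) h',
    fun h' => HVan.left hi hp hinj (KerInv.mk_surjective hM h) hex hsm h'
      (KerInv.coind_hVan hq (n + 1))⟩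

theorem KerInv.hVan_zero_iff (hq : Topology.IsQuotientMap π) (hM : IsSmooth G M)
    (h : HVan π.ker M 0) : HVan G M 0 ↔ HVan Q (KerInv π hπ M) 0 := by
  rw [_root_.hVan_zero_iff, _root_.hVan_zero_iff]
  constructor
  · intro hG f hf hd
    obtain ⟨m, hm⟩ := hG (fun g => (f (π g)).1)
      ((hf.comp_continuous hq.continuous).comp Subtype.val) (fun x y => by
        rw [map_mul, hd, AddSubgroup.coe_add, KerInv.coe_smul])
    have h1 : f 1 = 0 := by simpa using hd 1 1
    refine ⟨⟨m, fun g hg => ?_⟩, fun q => ?_⟩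
    · have := hm g
      rw [hg, h1] at this
      exact (sub_eq_zero.1 this.symm)
    · obtain ⟨g, rfl⟩ := hπ q
      refine Subtype.ext ?_
      rw [AddSubgroup.coe_sub, KerInv.coe_smul, hm]
  · intro hQ f hf hd
    obtain ⟨m, hm⟩ := _root_.hVan_zero_iff.1 h (fun g => f g)
      (hf.comp_continuous continuous_subtype_val) (fun x y => hd x y)
    have h1 : ∀ g, π g = 1 → f g = g • m - m := fun g hg => hm ⟨g, hg⟩
    let f' : G → M := fun g => f g - (g • m - m)
    have hf' : IsLocallyConstant f' := hf.sub ((hM m).sub (IsLocallyConstant.const m))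
    have hd' : ∀ x y, f' (x * y) = f' x + x • f' y := by
      intro x y
      simp only [f', hd, mul_smul, smul_sub]
      abel
    have h0 : ∀ g, π g = 1 → f' g = 0 := fun g hg => by simp [f', h1 g hg]
    have h2 : ∀ x g, π g = 1 → f' (x * g) = f' x := fun x g hg => by
      rw [hd', h0 g hg, smul_zero, add_zero]
    have h3 : ∀ x g, π g = 1 → g • f' x = f' x := fun x g hg => by
      have e1 := hd' g x
      rw [h0 g hg, zero_add] at e1
      rw [← e1, ← h2 x (x⁻¹ * g * x) (by simp [hg])]
      congr 1
      group
    have h4 : ∀ g, f' (Function.surjInv hπ (π g)) = f' g := fun g => by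
      rw [← h2 g (g⁻¹ * Function.surjInv hπ (π g)) (by simp [Function.surjInv_eq]),
        mul_inv_cancel_left]
    obtain ⟨a, ha⟩ := hQ (fun q => ⟨f' (Function.surjInv hπ q), h3 _⟩) (by
      refine IsLocallyConstant.of_comp_quotientMap hq ?_
      refine IsLocallyConstant.of_comp_injective Subtype.val_injective ?_
      simp only [h4]
      exact hf') (by
      intro x y
      obtain ⟨x, rfl⟩ := hπ x
      obtain ⟨y, rfl⟩ := hπ y
      refine Subtype.ext ?_
      rw [AddSubgroup.coe_add, KerInv.coe_smul]
      simp only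
      rw [← map_mul, h4, h4, h4, hd'])
    refine ⟨a.1 + m, fun x => ?_⟩
    have e := congrArg Subtype.val (ha (π x))
    rw [AddSubgroup.coe_sub, KerInv.coe_smul] at e
    simp only [h4] at e
    have e2 : f x = f' x + (x • m - m) := (sub_add_cancel _ _).symm
    rw [smul_add, e2, e]
    abel

theorem KerInv.hVan_iff [T1Space Q] (hq : Topology.IsQuotientMap π) (n : ℕ) :
    ∀ (M : Type) [AddCommGroup M] [DistribMulAction G M], IsSmooth G M →
      (∀ i, HVan π.ker M i) → (HVan G M n ↔ HVan Q (KerInv π hπ M) n) := by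
  induction n with
  | zero => exact fun M _ _ hM h => KerInv.hVan_zero_iff hq hM (h 0)
  | succ n ih =>
    intro M _ _ hM h
    have hcl : IsClosed (π.ker : Set G) := isClosed_singleton.preimage hq.continuous
    rw [_root_.hVan_succ_iff hM, KerInv.hVan_succ_iff hq hM (h 0)]
    exact ih _ Shift.isSmooth fun i => (hVan_subgroup_succ_iff hM hcl i).1 (h (i + 1))

end Inflation

section CohomDim

variable {G : Type} [Group G] [TopologicalSpace G]

theorem nontrivial_contH_iff {M : Type} [AddCommGroup M] [DistribMulAction G M] (n : ℕ) :
    Nontrivial (contH G M (n + 1)) ↔ ¬ HVan G M n := by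
  show Nontrivial (↥(contCocycles G M (n + 1)) ⧸
      (contCoboundaries G M n).comap (contCocycles G M (n + 1)).subtype) ↔ _
  rw [← not_subsingleton_iff_nontrivial, not_iff_not, QuotientAddGroup.subsingleton_iff]
  constructor
  · intro h f hf hd
    have : (⟨f, hf, hd⟩ : contCocycles G M (n + 1)) ∈
      (contCoboundaries G M n).comap (contCocycles G M (n + 1)).subtype := h ▸ AddSubgroup.mem_top _
    exact this
  · intro h
    rw [AddSubgroup.eq_top_iff']
    exact fun f => h f.1 f.2.1 f.2.2

/-- The vanishing of the cohomology of `G` in degree `n + 1` for all smooth `ℓ`-primary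
coefficient modules. -/
def CdVan (G : Type) [Group G] [TopologicalSpace G] (ℓ n : ℕ) : Prop :=
  ∀ (M : Type) [AddCommGroup M] [DistribMulAction G M], IsSmooth G M →
    (∀ x : M, ∃ k : ℕ, ℓ ^ k • x = 0) → HVan G M n

variable [IsTopologicalGroup G] [CompactSpace G] [TotallyDisconnectedSpace G] {ℓ : ℕ}

theorem CdVan.succ {n : ℕ} (h : CdVan G ℓ n) : CdVan G ℓ (n + 1) := fun _ _ _ hM hℓ =>
  (hVan_succ_iff hM n).2 (h _ Shift.isSmooth (Shift.exists_pow_smul_eq_zero hℓ))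

theorem CdVan.mono {n m : ℕ} (h : CdVan G ℓ n) (hnm : n ≤ m) : CdVan G ℓ m := by
  induction m, hnm using Nat.le_induction with
  | base => exact h
  | succ m _ ih => exact ih.succ

theorem contCohomDim_le_iff (n : ℕ) : contCohomDim G ℓ ≤ n ↔ CdVan G ℓ n := by
  rw [contCohomDim, sSup_le_iff]
  constructor
  · intro h M _ _ hM hℓ
    by_contra hv
    have := h ((n + 1 : ℕ) : ℕ∞) ⟨n + 1, rfl, M, _, _, hM, hℓ, (nontrivial_contH_iff n).2 hv⟩
    norm_cast at this
    omega
  · rintro h _ ⟨i, rfl, M, _, _, hM, hℓ, hi⟩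
    by_contra! hlt
    norm_cast at hlt
    obtain ⟨m, rfl⟩ : ∃ m, i = m + 1 := ⟨i - 1, by omega⟩
    exact (nontrivial_contH_iff m).1 hi (h.mono (by omega) M hM hℓ)

theorem contCohomDim_eq_add_one {Q : Type} [Group Q] [TopologicalSpace Q] [IsTopologicalGroup Q]
    [CompactSpace Q] [TotallyDisconnectedSpace Q] (h0 : ¬ CdVan G ℓ 0)
    (h : ∀ n, CdVan G ℓ (n + 1) ↔ CdVan Q ℓ n) : contCohomDim G ℓ = contCohomDim Q ℓ + 1 := by
  have key : ∀ n : ℕ, contCohomDim G ℓ ≤ n ↔ contCohomDim Q ℓ + 1 ≤ n := by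
    intro n
    cases n with
    | zero =>
      rw [contCohomDim_le_iff, iff_false_left h0, Nat.cast_zero, nonpos_iff_eq_zero]
      simp
    | succ n =>
      rw [contCohomDim_le_iff, h, ← contCohomDim_le_iff, Nat.cast_add, Nat.cast_one,
        ENat.add_le_add_iff_right ENat.one_ne_top]
  refine eq_of_forall_ge_iff fun c => ?_
  induction c with
  | top => simp
  | coe n => exact key n

variable {Q : Type} [Group Q] [TopologicalSpace Q] [IsTopologicalGroup Q]
    [CompactSpace Q] [TotallyDisconnectedSpace Q] [T1Space Q] {π : G →* Q}

theorem CdVan.of_ker (hπ : Function.Surjective π) (hq : Topology.IsQuotientMap π)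
    (hN : ∀ (M : Type) [AddCommGroup M] [DistribMulAction G M], IsSmooth G M →
      (∀ x : M, ∃ k : ℕ, ℓ ^ k • x = 0) → HVan π.ker M 1) {n : ℕ} (h : CdVan Q ℓ n) :
    CdVan G ℓ (n + 1) := by
  intro M _ _ hM hℓ
  have hcl : IsClosed (π.ker : Set G) := isClosed_singleton.preimage hq.continuous
  have hN' : ∀ i (M : Type) [AddCommGroup M] [DistribMulAction G M], IsSmooth G M →
      (∀ x : M, ∃ k : ℕ, ℓ ^ k • x = 0) → HVan π.ker M (i + 1) := by
    intro i
    induction i with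
    | zero => exact hN
    | succ i ih =>
      exact fun _ _ _ hM hℓ => (hVan_subgroup_succ_iff hM hcl (i + 1)).2
        (ih _ Shift.isSmooth (Shift.exists_pow_smul_eq_zero hℓ))
  rw [hVan_succ_iff hM, KerInv.hVan_iff (hπ := hπ) hq n _ Shift.isSmooth
    fun i => (hVan_subgroup_succ_iff hM hcl i).1 (hN' i M hM hℓ)]
  refine h _ (KerInv.isSmooth hq Shift.isSmooth) fun x => ?_
  obtain ⟨k, hk⟩ := Shift.exists_pow_smul_eq_zero hℓ x.1
  exact ⟨k, Subtype.ext hk⟩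

end CohomDim

section Devissage

variable {G : Type} [Group G] {M : Type} [AddCommGroup M] [DistribMulAction G M]

/-- The action on a stable subgroup. -/
abbrev stableAction (S : AddSubgroup M) (hS : ∀ (g : G), ∀ m ∈ S, g • m ∈ S) :
    DistribMulAction G S where
  smul g m := ⟨g • m.1, hS g _ m.2⟩
  one_smul m := Subtype.ext (one_smul G m.1)
  mul_smul g h m := Subtype.ext (mul_smul g h m.1)
  smul_zero g := Subtype.ext (smul_zero g)
  smul_add g a b := Subtype.ext (smul_add g a.1 b.1)

variable [TopologicalSpace G]

theorem IsSmooth.of_injective {A : Type} [AddCommGroup A] [DistribMulAction G A] {i : A →+ M}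
    (hi : ∀ (g : G) a, i (g • a) = g • i a) (hinj : Function.Injective i) (hM : IsSmooth G M) :
    IsSmooth G A := by
  intro a
  refine IsLocallyConstant.of_comp_injective hinj ?_
  simp only [hi]
  exact hM (i a)

theorem IsSmooth.of_surjective {A : Type} [AddCommGroup A] [DistribMulAction G A] {p : M →+ A}
    (hp : ∀ (g : G) a, p (g • a) = g • p a) (hsurj : Function.Surjective p) (hM : IsSmooth G M) :
    IsSmooth G A := by
  intro a
  obtain ⟨m, rfl⟩ := hsurj a
  simp only [← hp]
  exact (hM m).comp p

theorem HVan.of_retract {A : Type} [AddCommGroup A] [DistribMulAction G A] {i : A →+ M}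
    (hi : ∀ (g : G) a, i (g • a) = g • i a) {r : M →+ A} (hr : ∀ (g : G) m, r (g • m) = g • r m)
    (hri : ∀ a, r (i a) = a) {n : ℕ} (h : HVan G M n) : HVan G A n := by
  intro f hf hd
  obtain ⟨g, hg, hdg⟩ := h (fun x => i (f x)) (hf.comp i)
    (by rw [cochainD_map i hi, hd]; funext; simp)
  refine ⟨fun x => r (g x), hg.comp r, ?_⟩
  rw [cochainD_map r hr, hdg]
  simp [hri]

variable [IsTopologicalGroup G]

theorem hVan_of_killed_pow {ℓ n : ℕ}
    (h : ∀ (B : Type) [AddCommGroup B] [DistribMulAction G B], IsSmooth G B →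
      (∀ x : B, ℓ • x = 0) → HVan G B n) (k : ℕ) :
    ∀ (B : Type) [AddCommGroup B] [DistribMulAction G B], IsSmooth G B →
      (∀ x : B, ℓ ^ k • x = 0) → HVan G B n := by
  induction k with
  | zero =>
    intro B _ _ hB hk
    refine h B hB fun x => ?_
    rw [← one_smul ℕ x, ← pow_zero ℓ, hk, smul_zero]
  | succ k ih =>
    intro B _ _ hB hk
    let A : AddSubgroup B := (nsmulAddMonoidHom ℓ : B →+ B).ker
    let C : AddSubgroup B := (nsmulAddMonoidHom ℓ : B →+ B).range
    have hA : ∀ (g : G), ∀ m ∈ A, g • m ∈ A := fun g m (hm : ℓ • m = 0) => by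
      show ℓ • (g • m) = 0
      rw [smul_comm, hm, smul_zero]
    have hC : ∀ (g : G), ∀ m ∈ C, g • m ∈ C := by
      rintro g _ ⟨m, rfl⟩
      exact ⟨g • m, smul_comm ℓ g m⟩
    let _ := stableAction A hA
    let _ := stableAction C hC
    refine HVan.middle (i := A.subtype) (p := (nsmulAddMonoidHom ℓ : B →+ B).rangeRestrict)
      (fun _ _ => rfl) (fun g b => Subtype.ext (by
        show ℓ • g • b = g • ℓ • b
        exact smul_comm ℓ g b)) Subtype.val_injective
      (AddMonoidHom.rangeRestrict_surjective _)
      (fun b hb => ⟨⟨b, congrArg Subtype.val hb⟩, rfl⟩) hB ?_ ?_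
    · exact h A (hB.of_injective (i := A.subtype) (fun _ _ => rfl) Subtype.val_injective)
        fun x => Subtype.ext x.2
    · refine ih C (hB.of_injective (i := C.subtype) (fun _ _ => rfl) Subtype.val_injective) ?_
      rintro ⟨_, x, rfl⟩
      refine Subtype.ext ?_
      show ℓ ^ k • ℓ • x = 0
      rw [smul_smul, ← pow_succ, hk]

theorem cdVan_of_killed [CompactSpace G] {ℓ n : ℕ}
    (h : ∀ (B : Type) [AddCommGroup B] [DistribMulAction G B], IsSmooth G B →
      (∀ x : B, ℓ • x = 0) → HVan G B n) : CdVan G ℓ n := by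
  intro B _ _ hB hℓ f hf hd
  choose k hk using hℓ
  obtain ⟨N, hN⟩ := (hf.range_finite.image k).bddAbove
  let A : AddSubgroup B := (nsmulAddMonoidHom (ℓ ^ N) : B →+ B).ker
  have hA : ∀ (g : G), ∀ m ∈ A, g • m ∈ A := fun g m (hm : ℓ ^ N • m = 0) => by
    show ℓ ^ N • (g • m) = 0
    rw [smul_comm, hm, smul_zero]
  let := stableAction A hA
  have hfA : ∀ x, f x ∈ A := fun x => by
    show ℓ ^ N • f x = 0
    obtain ⟨c, hc⟩ := Nat.exists_eq_add_of_le (hN ⟨f x, ⟨x, rfl⟩, rfl⟩)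
    rw [hc, add_comm, pow_add, mul_smul, hk, smul_zero]
  obtain ⟨g, hg, hdg⟩ := hVan_of_killed_pow h N A
    (hB.of_injective (i := A.subtype) (fun _ _ => rfl) Subtype.val_injective)
    (fun x => Subtype.ext x.2) (fun x => ⟨f x, hfA x⟩)
    (IsLocallyConstant.of_comp_injective Subtype.val_injective hf) (by
      funext x
      have := congrFun (cochainD_map (G := G) A.subtype (fun _ _ => rfl) (n + 1)
        (fun x => ⟨f x, hfA x⟩)) x
      exact Subtype.ext (this.symm.trans (congrFun hd x)))
  refine ⟨fun x => (g x).1, hg.comp Subtype.val, ?_⟩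
  have := cochainD_map (G := G) A.subtype (fun _ _ => rfl) n g
  refine this.trans ?_
  rw [hdg]
  rfl

end Devissage

section Twist

variable {G Q : Type} [Group G] [Group Q] [TopologicalSpace G] [TopologicalSpace Q]
  [IsTopologicalGroup G] [CompactSpace G] [TotallyDisconnectedSpace G]
  [IsTopologicalGroup Q] [CompactSpace Q] [TotallyDisconnectedSpace Q] [T1Space Q]
  {π : G →* Q} {ℓ : ℕ}

/-- The action of `G` on a `Q`-module killed by `ℓ`, twisted by a character. -/
abbrev twistAction (π : G →* Q) (χ : G →* (ZMod ℓ)ˣ) (B : Type) [AddCommGroup B]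
    [DistribMulAction Q B] [Module (ZMod ℓ) B] : DistribMulAction G B where
  smul g b := (χ g : ZMod ℓ) • (π g • b)
  one_smul b := by
    show ((χ 1 : (ZMod ℓ)ˣ) : ZMod ℓ) • (π 1 • b) = b
    simp
  mul_smul g h b := by
    show ((χ (g * h) : (ZMod ℓ)ˣ) : ZMod ℓ) • (π (g * h) • b) =
      (χ g : ZMod ℓ) • (π g • ((χ h : ZMod ℓ) • (π h • b)))
    have : π g • ((χ h : ZMod ℓ) • (π h • b)) = (χ h : ZMod ℓ) • (π g • (π h • b)) :=
      ZMod.map_smul (DistribSMul.toAddMonoidHom B (π g)) _ _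
    rw [this, map_mul, map_mul, mul_smul, Units.val_mul, mul_smul]
  smul_zero g := by
    show (χ g : ZMod ℓ) • (π g • (0 : B)) = 0
    simp
  smul_add g a b := by
    show (χ g : ZMod ℓ) • (π g • (a + b)) = (χ g : ZMod ℓ) • (π g • a) + (χ g : ZMod ℓ) • (π g • b)
    simp

theorem eq_of_forall_linearMap_eq [Fact ℓ.Prime] {B : Type} [AddCommGroup B] [Module (ZMod ℓ) B]
    {a b : B} (h : ∀ l : B →ₗ[ZMod ℓ] ZMod ℓ, l a = l b) : a = b := by
  rw [← sub_eq_zero]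
  exact (Module.forall_dual_apply_eq_zero_iff (ZMod ℓ) (a - b)).1 fun l => by
    rw [map_sub, h, sub_self]

theorem CdVan.hVan_of_retract (hℓ : ℓ.Prime) (hπ : Function.Surjective π)
    (hq : Topology.IsQuotientMap π)
    (hN : ∀ (M : Type) [AddCommGroup M] [DistribMulAction G M], IsSmooth G M →
      (∀ x : M, ∃ k : ℕ, ℓ ^ k • x = 0) → HVan π.ker M 1)
    (χ : G →* (ZMod ℓ)ˣ) (hχ : IsLocallyConstant χ) (hχN : ∀ g, π g = 1 → χ g = 1)
    (c : G → ZMod ℓ) (hc : IsLocallyConstant c) (hcc : ∀ x g, c (x * g) = c x + χ x * c g)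
    (τ : G) (hτ : π τ = 1) (hcτ : c τ = 1)
    (hτh : ∀ h : G → ZMod ℓ, IsLocallyConstant (fun n : π.ker => h n) →
      (∀ x y, π x = 1 → π y = 1 → h (x * y) = h x + h y) →
      ∀ g, χ g * h (g⁻¹ * τ * g) = h τ) {n : ℕ} (hG : CdVan G ℓ (n + 1))
    {B : Type} [AddCommGroup B] [DistribMulAction Q B] (hB : IsSmooth Q B)
    (hkill : ∀ x : B, ℓ • x = 0) [Module (ZMod ℓ) B] : HVan Q B n := by
  have : Fact ℓ.Prime := ⟨hℓ⟩
  let := twistAction π χ B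
  have hsm : ∀ (g : G) (b : B), g • b = (χ g : ZMod ℓ) • (π g • b) := fun _ _ => rfl
  have hQz : ∀ (q : Q) (z : ZMod ℓ) (b : B), q • (z • b) = z • (q • b) := fun q z b =>
    ZMod.map_smul (DistribSMul.toAddMonoidHom B q) _ _
  have hM : IsSmooth G B := fun b =>
    hχ.comp₂ ((hB b).comp_continuous hq.continuous) fun u b => (u : ZMod ℓ) • b
  have hNtriv : ∀ g : G, π g = 1 → ∀ b : B, g • b = b := fun g hg b => by
    rw [hsm, hg, hχN g hg, one_smul, Units.val_one, one_smul]
  have hcl : IsClosed (π.ker : Set G) := isClosed_singleton.preimage hq.continuous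
  have hprim : ∀ x : B, ∃ k : ℕ, ℓ ^ k • x = 0 := fun x => ⟨1, by rw [pow_one, hkill]⟩
  have hS : HVan Q (KerInv π hπ (Shift G B)) n := by
    refine (KerInv.hVan_iff hq n _ Shift.isSmooth fun i => ?_).1
      ((hVan_succ_iff hM n).1 (hG B hM hprim))
    rw [← hVan_subgroup_succ_iff hM hcl]
    have hN' : ∀ i (M : Type) [AddCommGroup M] [DistribMulAction G M], IsSmooth G M →
        (∀ x : M, ∃ k : ℕ, ℓ ^ k • x = 0) → HVan π.ker M (i + 1) := by
      intro i
      induction i with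
      | zero => exact hN
      | succ i ih =>
        exact fun _ _ _ hM hℓ => (hVan_subgroup_succ_iff hM hcl (i + 1)).2
          (ih _ Shift.isSmooth (Shift.exists_pow_smul_eq_zero hℓ))
    exact hN' i B hM hprim
  -- the section
  let φ : B →+ Coind G B :=
    { toFun := fun b => ⟨fun x => c x • (π x • b),
        hc.comp₂ ((hB b).comp_continuous hq.continuous) fun z b => z • b⟩
      map_zero' := Subtype.ext (funext fun x => by simp)
      map_add' := fun a b => Subtype.ext (funext fun x => by
        show c x • (π x • (a + b)) = c x • (π x • a) + c x • (π x • b)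
        simp) }
  have hφ : ∀ g b, g • φ b = φ (π g • b) + coindEmb hM (c g • (π g • b)) := by
    intro g b
    refine Subtype.ext (funext fun x => ?_)
    show c (x * g) • (π (x * g) • b) = c x • (π x • (π g • b)) + x • (c g • (π g • b))
    rw [hcc, map_mul, mul_smul, add_smul, mul_smul, hsm, hQz]
  have hmkφ : ∀ g b, g • Shift.mk G B (φ b) = Shift.mk G B (φ (π g • b)) := fun g b => by
    rw [← Shift.mk_smul, hφ, map_add, (Shift.mk_eq_zero_iff_exists hM _).2 ⟨_, rfl⟩, add_zero]
  let i : B →+ KerInv π hπ (Shift G B) :=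
    { toFun := fun b => ⟨Shift.mk G B (φ b), fun g hg => by rw [hmkφ, hg, one_smul]⟩
      map_zero' := Subtype.ext (by simp)
      map_add' := fun a b => Subtype.ext (by simp) }
  -- the retraction
  have hex : ∀ s : KerInv π hπ (Shift G B), ∃ φ : Coind G B, Shift.mk G B φ = s.1 := fun s =>
    Shift.mk_surjective s.1
  have hm : ∀ φ : Coind G B, Shift.mk G B φ ∈ KerInv π hπ (Shift G B) → ∀ g, π g = 1 →
      ∃ m, coindEmb hM m = g • φ - φ := by
    intro φ h g hg
    rw [← Shift.mk_eq_zero_iff_exists, map_sub, Shift.mk_smul, h g hg, sub_self]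
  let R : (s : KerInv π hπ (Shift G B)) → B → Prop := fun s b =>
    ∃ φ, Shift.mk G B φ = s.1 ∧ coindEmb hM b = τ • φ - φ
  have hR1 : ∀ s, ∃ b, R s b := fun s => by
    obtain ⟨φ, hφ⟩ := hex s
    obtain ⟨m, hm⟩ := hm φ (hφ ▸ s.2) τ hτ
    exact ⟨m, φ, hφ, hm⟩
  have hR2 : ∀ s b b', R s b → R s b' → b = b' := by
    rintro s b b' ⟨φ, h1, h2⟩ ⟨φ', h1', h2'⟩
    obtain ⟨m, hm⟩ := (Shift.mk_eq_zero_iff_exists hM (φ - φ')).1 (by rw [map_sub, h1, h1', sub_self])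
    apply coindEmb_injective hM
    have e : τ • coindEmb hM m = coindEmb hM m := by rw [← coindEmb_smul, hNtriv τ hτ]
    rw [hm, smul_sub] at e
    rw [h2, h2', ← sub_eq_zero, ← sub_eq_zero.2 e]
    abel
  have hRadd : ∀ s s' b b', R s b → R s' b' → R (s + s') (b + b') := by
    rintro s s' b b' ⟨φ, h1, h2⟩ ⟨φ', h1', h2'⟩
    exact ⟨φ + φ', by rw [map_add, h1, h1']; rfl, by rw [map_add, h2, h2', smul_add]; abel⟩
  have hRsmul : ∀ g s b, R s b → R (π g • s) (π g • b) := by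
    rintro g s b ⟨φ, h1, h2⟩
    have hs : Shift.mk G B φ ∈ KerInv π hπ (Shift G B) := h1 ▸ s.2
    choose! m hm' using hm φ hs
    refine ⟨g • φ, by rw [Shift.mk_smul, h1, KerInv.coe_smul], ?_⟩
    have hb : b = m τ := coindEmb_injective hM (by rw [h2, hm' τ hτ])
    have hmul : ∀ x y, π x = 1 → π y = 1 → m (x * y) = m x + m y := by
      intro x y hx hy
      apply coindEmb_injective hM
      rw [map_add, hm' _ (by rw [map_mul, hx, hy, one_mul]), hm' x hx]
      have : coindEmb hM (m y) = x • y • φ - x • φ := by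
        rw [← hNtriv x hx (m y), coindEmb_smul, hm' y hy, smul_sub]
      rw [this, mul_smul]
      abel
    have hmlc : IsLocallyConstant fun n : π.ker => m n := by
      refine IsLocallyConstant.of_comp_injective (coindEmb_injective hM) ?_
      have : (fun n : π.ker => coindEmb hM (m n)) = fun n : π.ker => n • φ - φ :=
        funext fun n => hm' n n.2
      rw [this]
      exact (Coind.isSmooth.subgroup π.ker φ).sub (IsLocallyConstant.const φ)
    have hconj : (χ g : ZMod ℓ) • m (g⁻¹ * τ * g) = m τ := by
      refine eq_of_forall_linearMap_eq (ℓ := ℓ) fun l => ?_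
      rw [map_smul]
      exact hτh (fun x => l (m x)) (hmlc.comp l) (fun x y hx hy => by
        rw [hmul x y hx hy, map_add]) g
    have h3 : π (g⁻¹ * τ * g) = 1 := by simp [hτ]
    have h4 : g • m (g⁻¹ * τ * g) = π g • b := by rw [hsm, ← hQz, hconj, hb]
    rw [← h4, coindEmb_smul, hm' _ h3, smul_sub, smul_smul, smul_smul]
    congr 2
    group
  choose r hr using hR1
  let r' : KerInv π hπ (Shift G B) →+ B := AddMonoidHom.mk' r fun s s' =>
    hR2 _ _ _ (hr _) (hRadd _ _ _ _ (hr s) (hr s'))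
  refine HVan.of_retract (i := i) (r := r') ?_ ?_ ?_ hS
  · intro q b
    obtain ⟨g, rfl⟩ := hπ q
    refine Subtype.ext ?_
    rw [KerInv.coe_smul]
    exact (hmkφ g b).symm
  · intro q s
    obtain ⟨g, rfl⟩ := hπ q
    exact hR2 _ _ _ (hr _) (hRsmul g s _ (hr s))
  · intro b
    refine hR2 _ _ _ (hr _) ⟨φ b, rfl, ?_⟩
    rw [hφ, hτ, one_smul, hcτ, one_smul]
    abel

theorem CdVan.of_retract (hℓ : ℓ.Prime) (hπ : Function.Surjective π)
    (hq : Topology.IsQuotientMap π)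
    (hN : ∀ (M : Type) [AddCommGroup M] [DistribMulAction G M], IsSmooth G M →
      (∀ x : M, ∃ k : ℕ, ℓ ^ k • x = 0) → HVan π.ker M 1)
    (χ : G →* (ZMod ℓ)ˣ) (hχ : IsLocallyConstant χ) (hχN : ∀ g, π g = 1 → χ g = 1)
    (c : G → ZMod ℓ) (hc : IsLocallyConstant c) (hcc : ∀ x g, c (x * g) = c x + χ x * c g)
    (τ : G) (hτ : π τ = 1) (hcτ : c τ = 1)
    (hτh : ∀ h : G → ZMod ℓ, IsLocallyConstant (fun n : π.ker => h n) →
      (∀ x y, π x = 1 → π y = 1 → h (x * y) = h x + h y) →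
      ∀ g, χ g * h (g⁻¹ * τ * g) = h τ) {n : ℕ} (hG : CdVan G ℓ (n + 1))
    : CdVan Q ℓ n :=
  cdVan_of_killed fun B _ _ hB hkill => by
    let _ : Module (ZMod ℓ) B := AddCommGroup.zmodModule hkill
    exact CdVan.hVan_of_retract hℓ hπ hq hN χ hχ hχN c hc hcc τ hτ hcτ hτh hG hB hkill

theorem not_cdVan_zero (hℓ : ℓ.Prime) (χ : G →* (ZMod ℓ)ˣ) (hχ : IsLocallyConstant χ)
    (c : G → ZMod ℓ) (hc : IsLocallyConstant c) (hcc : ∀ x g, c (x * g) = c x + χ x * c g)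
    (τ : G) (hχτ : χ τ = 1) (hcτ : c τ = 1) : ¬ CdVan G ℓ 0 := by
  have : Fact ℓ.Prime := ⟨hℓ⟩
  intro h
  let : DistribMulAction G (ZMod ℓ) := DistribMulAction.compHom (ZMod ℓ) χ
  have hsm : ∀ (g : G) (b : ZMod ℓ), g • b = (χ g : ZMod ℓ) * b := fun _ _ => rfl
  obtain ⟨a, ha⟩ := hVan_zero_iff.1 (h (ZMod ℓ) (fun b => hχ.comp fun u => (u : ZMod ℓ) * b)
    fun x => ⟨1, by simp⟩) c hc hcc
  have := ha τ
  rw [hcτ, hsm, hχτ, Units.val_one, one_mul, sub_self] at this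
  exact one_ne_zero this

end Twist

section Transfer

variable {G : Type} [Group G] {M : Type} [AddCommGroup M] [DistribMulAction G M]

theorem exists_index_smul_eq_of_eq_zero {f : G → M} (hd : ∀ x y, f (x * y) = f x + x • f y)
    (S : Subgroup G) [S.FiniteIndex] (hS : ∀ s ∈ S, f s = 0) :
    ∃ m, ∀ x, S.index • f x = x • m - m := by
  have := S.fintypeQuotientOfFiniteIndex
  have hout : ∀ x : G, f (QuotientGroup.mk (s := S) x).out = f x := by
    intro x
    obtain ⟨s, hs⟩ := QuotientGroup.mk_out_eq_mul S x
    rw [hs, hd, hS s s.2, smul_zero, add_zero]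
  refine ⟨-∑ γ : G ⧸ S, f γ.out, fun x => ?_⟩
  have h1 : ∑ γ : G ⧸ S, f (x • γ).out = ∑ γ : G ⧸ S, f γ.out :=
    Equiv.sum_comp (MulAction.toPerm x : Equiv.Perm (G ⧸ S)) fun γ : G ⧸ S => f γ.out
  have h2 : ∀ γ : G ⧸ S, f (x • γ).out = f x + x • f γ.out := by
    intro γ
    obtain ⟨y, rfl⟩ := QuotientGroup.mk_surjective γ
    show f (QuotientGroup.mk (s := S) (x * y)).out = _
    rw [hout, hout, hd]
  simp only [h2, Finset.sum_add_distrib, Finset.sum_const, Finset.card_univ] at h1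
  rw [← Nat.card_eq_fintype_card] at h1
  have h3 : S.index • f x + x • ∑ γ : G ⧸ S, f γ.out = ∑ γ : G ⧸ S, f γ.out := by
    rw [Finset.smul_sum]; exact h1
  rw [smul_neg, ← sub_eq_iff_eq_add.2 h3.symm]
  abel

theorem exists_index_smul_eq {f : G → M} (hd : ∀ x y, f (x * y) = f x + x • f y)
    (S : Subgroup G) [S.FiniteIndex] {m : M} (hS : ∀ s ∈ S, f s = s • m - m) :
    ∃ m, ∀ x, S.index • f x = x • m - m := by
  obtain ⟨a, ha⟩ := exists_index_smul_eq_of_eq_zero (f := fun x => f x - (x • m - m))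
    (fun x y => by simp only [hd, mul_smul, smul_sub]; abel) S (fun s hs => by simp [hS s hs])
  refine ⟨a + S.index • m, fun x => ?_⟩
  have := ha x
  rw [smul_sub, sub_eq_iff_eq_add] at this
  rw [this, smul_add, smul_sub, smul_comm S.index x m]
  abel

variable [TopologicalSpace G] [IsTopologicalGroup G] [CompactSpace G]

theorem HVan.zero_of_index {ℓ : ℕ} (hℓ : ℓ.Prime) (hprim : ∀ x : M, ∃ k : ℕ, ℓ ^ k • x = 0)
    {S : Subgroup G} [S.FiniteIndex] (hi : ¬ ℓ ∣ S.index) (h : HVan S M 0) : HVan G M 0 := by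
  rw [hVan_zero_iff] at h ⊢
  intro f hf hd
  obtain ⟨m, hm⟩ := h (fun s => f s) (hf.comp_continuous continuous_subtype_val)
    fun x y => hd x y
  obtain ⟨a, ha⟩ := exists_index_smul_eq hd S fun s hs => hm ⟨s, hs⟩
  choose k hk using hprim
  obtain ⟨N, hN⟩ := (hf.range_finite.image k).bddAbove
  have hfN : ∀ x, ℓ ^ N • f x = 0 := fun x => by
    obtain ⟨c, hc⟩ := Nat.exists_eq_add_of_le (hN ⟨f x, ⟨x, rfl⟩, rfl⟩)
    rw [hc, add_comm, pow_add, mul_smul, hk, smul_zero]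
  have hcop : IsCoprime ((ℓ ^ N : ℕ) : ℤ) (S.index : ℤ) :=
    Nat.isCoprime_iff_coprime.2 (Nat.Coprime.pow_left N ((Nat.Prime.coprime_iff_not_dvd hℓ).2 hi))
  obtain ⟨u, v, huv⟩ := hcop
  refine ⟨v • a, fun x => ?_⟩
  rw [smul_comm x v a, ← smul_sub, ← ha, ← natCast_zsmul (f x), smul_smul]
  calc f x = (u * (ℓ ^ N : ℕ) + v * S.index) • f x := by rw [huv, one_smul]
    _ = _ := by rw [add_smul, mul_smul, natCast_zsmul (f x), hfN, smul_zero, zero_add]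

end Transfer

section SylowReduction

/-- The vanishing of `H²` with trivial coefficients of order `ℓ`. -/
def TrivVan (G : Type) [Group G] [TopologicalSpace G] (ℓ : ℕ) : Prop :=
  ∀ (A : Type) [AddCommGroup A] [DistribMulAction G A], (∀ (g : G) (a : A), g • a = a) →
    Nat.card A = ℓ → HVan G A 1

variable {G : Type} [Group G] [TopologicalSpace G] [IsTopologicalGroup G] {ℓ : ℕ}

theorem HVan.of_subsingleton {M : Type} [AddCommGroup M] [DistribMulAction G M] [Subsingleton M]
    (n : ℕ) : HVan G M n := fun _ _ _ =>
  ⟨0, IsLocallyConstant.const 0, funext fun _ => Subsingleton.elim _ _⟩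

theorem HVan.one_of_pGroup (hℓ : ℓ.Prime) (h : TrivVan G ℓ) (N : ℕ) :
    ∀ (M : Type) [AddCommGroup M] [DistribMulAction G M] [Finite M], Nat.card M ≤ N →
      IsSmooth G M → (∀ x : M, ∃ k : ℕ, ℓ ^ k • x = 0) →
      (∀ g : G, ∃ k : ℕ, ∀ m : M, g ^ ℓ ^ k • m = m) → HVan G M 1 := by
  have : Fact ℓ.Prime := ⟨hℓ⟩
  induction N with
  | zero =>
    intro M _ _ _ hN
    exact absurd hN Nat.card_pos.not_ge
  | succ N ih =>
    intro M _ _ _ hN hM hprim hg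
    rcases subsingleton_or_nontrivial M with hs | hs
    · exact HVan.of_subsingleton 1
    -- a nonzero fixed vector of order `ℓ`
    have hP : IsPGroup ℓ (MulAction.toPermHom G M).range := by
      rintro ⟨_, g, rfl⟩
      obtain ⟨k, hk⟩ := hg g
      refine ⟨k, Subtype.ext (Equiv.ext fun m => ?_)⟩
      rw [SubgroupClass.coe_pow, ← map_pow]
      exact hk m
    have hcardM : ℓ ∣ Nat.card M := by
      obtain ⟨x, hx⟩ := exists_ne (0 : M)
      obtain ⟨k, hk⟩ := hprim x
      obtain ⟨j, -, hj⟩ := (Nat.dvd_prime_pow hℓ).1 (addOrderOf_dvd_of_nsmul_eq_zero hk)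
      refine dvd_trans ?_ (addOrderOf_dvd_natCard x)
      rw [hj]
      refine dvd_pow_self _ ?_
      rintro rfl
      exact hx (AddMonoid.addOrderOf_eq_one_iff.1 (by simpa using hj))
    obtain ⟨m, hm, hm0⟩ := hP.exists_fixed_point_of_prime_dvd_card_of_fixed_point M hcardM
      (a := (0 : M)) (by
        rintro ⟨_, g, rfl⟩
        exact smul_zero g)
    have hmG : ∀ g : G, g • m = m := fun g => hm ⟨_, g, rfl⟩
    obtain ⟨a, haG, hao⟩ : ∃ a : M, (∀ g : G, g • a = a) ∧ addOrderOf a = ℓ := by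
      obtain ⟨k, hk⟩ := hprim m
      obtain ⟨j, -, hj⟩ := (Nat.dvd_prime_pow hℓ).1 (addOrderOf_dvd_of_nsmul_eq_zero hk)
      obtain ⟨i, rfl⟩ : ∃ i, j = i + 1 := by
        refine Nat.exists_eq_add_one_of_ne_zero ?_
        rintro rfl
        exact hm0 (AddMonoid.addOrderOf_eq_one_iff.1 (by simpa using hj)).symm
      refine ⟨ℓ ^ i • m, fun g => by rw [smul_comm, hmG], ?_⟩
      rw [addOrderOf_nsmul_of_dvd (pow_ne_zero _ hℓ.ne_zero) (by rw [hj]; exact pow_dvd_pow _ (by omega)),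
        hj, pow_succ, Nat.mul_div_cancel_left _ (pow_pos hℓ.pos _)]
    let A : AddSubgroup M := AddSubgroup.zmultiples a
    have hAtriv : ∀ (g : G), ∀ x ∈ A, g • x = x := by
      rintro g _ ⟨n, rfl⟩
      show g • (n • a) = n • a
      rw [smul_comm, haG]
    have hA : ∀ (g : G), ∀ x ∈ A, g • x ∈ A := fun g x hx => by rwa [hAtriv g x hx]
    let _ := stableAction A hA
    let _ : DistribMulAction G (M ⧸ A) :=
      { smul := fun g => QuotientAddGroup.map A A (DistribSMul.toAddMonoidHom M g)
          fun x hx => hA g x hx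
        one_smul := fun x => by
          obtain ⟨x, rfl⟩ := QuotientAddGroup.mk_surjective x
          exact congrArg (QuotientAddGroup.mk (s := A)) (one_smul G x)
        mul_smul := fun g h x => by
          obtain ⟨x, rfl⟩ := QuotientAddGroup.mk_surjective x
          exact congrArg (QuotientAddGroup.mk (s := A)) (mul_smul g h x)
        smul_zero := fun g => map_zero (QuotientAddGroup.map A A _ _)
        smul_add := fun g => map_add (QuotientAddGroup.map A A _ _) }
    have hp : ∀ (g : G) (x : M), QuotientAddGroup.mk' A (g • x) = g • QuotientAddGroup.mk' A x :=
      fun _ _ => rfl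
    have hcA : Nat.card A = ℓ := by rw [Nat.card_zmultiples, hao]
    refine HVan.middle (i := A.subtype) (p := QuotientAddGroup.mk' A) (fun _ _ => rfl) hp
      Subtype.val_injective (QuotientAddGroup.mk'_surjective A)
      (fun b hb => ⟨⟨b, (QuotientAddGroup.eq_zero_iff b).1 hb⟩, rfl⟩) hM
      (h A (fun g x => Subtype.ext (hAtriv g x x.2)) hcA) (ih (M ⧸ A) ?_
        (hM.of_surjective hp (QuotientAddGroup.mk'_surjective A)) ?_ ?_)
    · have := AddSubgroup.card_eq_card_quotient_mul_card_addSubgroup A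
      rw [hcA] at this
      have h2 := hℓ.two_le
      have h3 : 0 < Nat.card (M ⧸ A) := Nat.card_pos
      nlinarith
    · intro x
      obtain ⟨x, rfl⟩ := QuotientAddGroup.mk'_surjective A x
      obtain ⟨k, hk⟩ := hprim x
      exact ⟨k, by rw [← map_nsmul, hk, map_zero]⟩
    · intro g
      obtain ⟨k, hk⟩ := hg g
      refine ⟨k, fun x => ?_⟩
      obtain ⟨x, rfl⟩ := QuotientAddGroup.mk'_surjective A x
      rw [← hp, hk]

variable [CompactSpace G] [TotallyDisconnectedSpace G]

theorem HVan.one_of_finite (hℓ : ℓ.Prime)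
    (h : ∀ S : Subgroup G, IsOpen (S : Set G) → TrivVan S ℓ)
    {M : Type} [AddCommGroup M] [DistribMulAction G M] [Finite M] (hM : IsSmooth G M)
    (hprim : ∀ x : M, ∃ k : ℕ, ℓ ^ k • x = 0) : HVan G M 1 := by
  have : Fact ℓ.Prime := ⟨hℓ⟩
  let ρ := (MulAction.toPermHom G M).rangeRestrict
  have hρ : Function.Surjective ρ := (MulAction.toPermHom G M).rangeRestrict_surjective
  obtain ⟨P⟩ : Nonempty (Sylow ℓ (MulAction.toPermHom G M).range) := inferInstance
  let S : Subgroup G := P.toSubgroup.comap ρ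
  have hSo : IsOpen (S : Set G) := by
    have h1 : IsOpen (⋂ m : M, {g : G | g • m = m}) :=
      isOpen_iInter_of_finite fun m => (hM m).isOpen_fiber m
    refine Subgroup.isOpen_of_mem_nhds S (g := 1) (Filter.mem_of_superset
      (h1.mem_nhds (by simp)) fun g hg => ?_)
    have : ρ g = 1 := Subtype.ext (Equiv.ext fun m => Set.mem_iInter.1 hg m)
    show ρ g ∈ P.toSubgroup
    rw [this]
    exact one_mem _
  have hSi : S.index = P.toSubgroup.index := Subgroup.index_comap_of_surjective _ hρ
  have hS0 : S.FiniteIndex := ⟨by rw [hSi]; exact Subgroup.FiniteIndex.index_ne_zero⟩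
  have hScl : IsClosed (S : Set G) := S.isClosed_of_isOpen hSo
  have hPS : ∀ s : S, ∃ k : ℕ, ∀ m : M, s ^ ℓ ^ k • m = m := by
    intro s
    obtain ⟨k, hk⟩ := P.2 ⟨ρ s, s.2⟩
    refine ⟨k, fun m => ?_⟩
    have h2 : (ρ s) ^ ℓ ^ k = 1 := congrArg Subtype.val hk
    rw [← map_pow] at h2
    exact congrArg (fun σ : (MulAction.toPermHom G M).range => (σ : Equiv.Perm M) m) h2
  have hSM := HVan.one_of_pGroup hℓ (h S hSo) _ M le_rfl (hM.subgroup S) hprim hPS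
  rw [hVan_subgroup_succ_iff hM hScl] at hSM
  rw [hVan_succ_iff hM]
  exact HVan.zero_of_index hℓ (Shift.exists_pow_smul_eq_zero hprim)
    (by rw [hSi]; exact P.not_dvd_index) hSM

theorem HVan.one_of_trivVan (hℓ : ℓ.Prime)
    (h : ∀ S : Subgroup G, IsOpen (S : Set G) → TrivVan S ℓ)
    {M : Type} [AddCommGroup M] [DistribMulAction G M] (hM : IsSmooth G M)
    (hprim : ∀ x : M, ∃ k : ℕ, ℓ ^ k • x = 0) : HVan G M 1 := by
  intro f hf hd
  let T : Set M := ⋃ x ∈ Set.range f, Set.range fun g : G => g • x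
  have hT : T.Finite := hf.range_finite.biUnion fun x _ => (hM x).range_finite
  have hTs : ∀ (g : G), ∀ x ∈ T, g • x ∈ T := by
    intro g x hx
    simp only [T, Set.mem_iUnion] at hx ⊢
    obtain ⟨y, hy, g', rfl⟩ := hx
    exact ⟨y, hy, g * g', mul_smul g g' y⟩
  let A : AddSubgroup M := AddSubgroup.closure T
  have hA : ∀ (g : G), ∀ m ∈ A, g • m ∈ A := by
    intro g m hm
    have h1 : A ≤ A.comap (DistribSMul.toAddMonoidHom M g) :=
      (AddSubgroup.closure_le _).2 fun x hx => AddSubgroup.subset_closure (hTs g x hx)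
    exact h1 hm
  let _ := stableAction A hA
  have hprimA : ∀ x : A, ∃ k : ℕ, ℓ ^ k • x = 0 := fun x => by
    obtain ⟨k, hk⟩ := hprim x.1
    exact ⟨k, Subtype.ext hk⟩
  have : Finite A := by
    have := hT.to_subtype
    have : AddGroup.FG A := AddGroup.closure_finite_fg T
    refine AddCommGroup.finite_of_fg_isAddTorsion A fun x => ?_
    obtain ⟨k, hk⟩ := hprimA x
    exact isOfFinAddOrder_iff_nsmul_eq_zero.2 ⟨ℓ ^ k, pow_pos hℓ.pos _, hk⟩
  have hfA : ∀ x, f x ∈ A := fun x => AddSubgroup.subset_closure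
    (Set.mem_biUnion ⟨x, rfl⟩ ⟨1, one_smul G _⟩)
  obtain ⟨g, hg, hdg⟩ := HVan.one_of_finite hℓ h
    (hM.of_injective (i := A.subtype) (fun _ _ => rfl) Subtype.val_injective) hprimA
    (fun x => ⟨f x, hfA x⟩) (IsLocallyConstant.of_comp_injective Subtype.val_injective hf) (by
      funext x
      have := congrFun (cochainD_map (G := G) A.subtype (fun _ _ => rfl) 2
        (fun x => ⟨f x, hfA x⟩)) x
      exact Subtype.ext (this.symm.trans (congrFun hd x)))
  refine ⟨fun x => (g x).1, hg.comp Subtype.val, ?_⟩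
  have := cochainD_map (G := G) A.subtype (fun _ _ => rfl) 1 g
  refine this.trans ?_
  rw [hdg]
  rfl

end SylowReduction

section HilbertNinety

variable {G : Type} [Group G] [TopologicalSpace G] [IsTopologicalGroup G] [CompactSpace G]
  {Ω : Type} [Field Ω] [MulSemiringAction G Ω]

theorem exists_normal_le_faithful [FaithfulSMul G Ω] (hΩ : ∀ x : Ω, IsLocallyConstant fun g : G => g • x)
    {T : Subgroup G} (hT : IsOpen (T : Set G)) :
    ∃ V : Subgroup G, V.Normal ∧ IsOpen (V : Set G) ∧ V ≤ T ∧
      ∀ g : G, (∀ x : Ω, (∀ v ∈ V, v • x = x) → g • x = x) → g ∈ V := by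
  have hopen : ∀ x : Ω, IsOpen {g : G | g • x = x} := fun x => (hΩ x).isOpen_fiber x
  obtain ⟨X₀, hX₀⟩ := (hT.isClosed_compl.isCompact).elim_finite_subcover
    (fun x : Ω => {g : G | g • x ≠ x}) (fun x => ((hΩ x).isClosed_fiber x).isOpen_compl) (by
      intro g hg
      by_contra hcon
      simp only [Set.mem_iUnion, Set.mem_ofPred_eq, not_exists, not_not] at hcon
      have : g = 1 := FaithfulSMul.eq_of_smul_eq_smul (α := Ω) fun x => by rw [hcon, one_smul]
      exact hg (this ▸ one_mem T))
  let X : Set Ω := ⋃ x ∈ X₀, Set.range fun g : G => g • x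
  have hX : X.Finite := X₀.finite_toSet.biUnion fun x _ => (hΩ x).range_finite
  have hXs : ∀ (g : G), ∀ x ∈ X, g • x ∈ X := by
    intro g x hx
    simp only [X, Set.mem_iUnion] at hx ⊢
    obtain ⟨y, hy, g', rfl⟩ := hx
    exact ⟨y, hy, g * g', mul_smul g g' y⟩
  let V : Subgroup G :=
    { carrier := {g | ∀ x ∈ X, g • x = x}
      one_mem' := fun x _ => one_smul G x
      mul_mem' := fun {a b} ha hb x hx => by rw [mul_smul, hb x hx, ha x hx]
      inv_mem' := fun {a} ha x hx => by rw [inv_smul_eq_iff, ha x hx] }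
  refine ⟨V, ⟨fun v hv g x hx => ?_⟩, ?_, fun g hg => ?_, fun g hg x hx => hg x fun v hv => hv x hx⟩
  · rw [mul_smul, mul_smul, hv _ (hXs _ _ hx), smul_inv_smul]
  · have : (V : Set G) = ⋂ x ∈ X, {g : G | g • x = x} := by
      ext g
      simp [V]
    rw [this]
    exact hX.isOpen_biInter fun x _ => hopen x
  · by_contra hgT
    obtain ⟨x, hx, hgx⟩ := Set.mem_iUnion₂.1 (hX₀ hgT)
    exact hgx (hg x (Set.mem_biUnion hx ⟨1, one_smul G x⟩))

theorem exists_sum_mul_smul_ne_zero {V : Subgroup G} [V.Normal] [Fintype (G ⧸ V)]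
    (hV : ∀ g : G, (∀ x : Ω, (∀ v ∈ V, v • x = x) → g • x = x) → g ∈ V)
    {c : G ⧸ V → Ω} (hc : c ≠ 0) :
    ∃ x : Ω, (∀ v ∈ V, v • x = x) ∧ ∑ γ : G ⧸ V, c γ * γ.out • x ≠ 0 := by
  let M : Submonoid Ω := FixedPoints.submonoid V Ω
  let χ : G ⧸ V → M →* Ω := fun γ => (MulDistribMulAction.toMonoidHom Ω γ.out).comp M.subtype
  have hχ : Function.Injective χ := by
    intro γ δ h
    rw [← QuotientGroup.out_eq' γ, ← QuotientGroup.out_eq' δ, QuotientGroup.eq]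
    refine hV _ fun x hx => ?_
    have : γ.out • x = δ.out • x := DFunLike.congr_fun h (⟨x, fun v => hx v v.2⟩ : M)
    rw [mul_smul, ← this, inv_smul_smul]
  have hli := (linearIndependent_monoidHom M Ω).comp χ hχ
  rw [Fintype.linearIndependent_iff] at hli
  by_contra! hcon
  refine hc (funext (hli c (funext fun x => ?_)))
  have := hcon x fun v hv => x.2 ⟨v, hv⟩
  simpa [χ] using this

theorem exists_fixed_smul_ne [FaithfulSMul G Ω] (hΩ : ∀ x : Ω, IsLocallyConstant fun g : G => g • x)
    {U : Subgroup G} (hU : IsOpen (U : Set G)) {s : G} (hs : s ∉ U) :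
    ∃ x : Ω, (∀ u ∈ U, u • x = x) ∧ s • x ≠ x := by
  classical
  obtain ⟨V, hVn, hVo, hVU, hV⟩ := exists_normal_le_faithful hΩ hU
  have := Subgroup.quotient_finite_of_isOpen V hVo
  let _ := Fintype.ofFinite (G ⧸ V)
  have hmem : ∀ x y : G, (QuotientGroup.mk (s := V) x = QuotientGroup.mk y) → (x ∈ U ↔ y ∈ U) := by
    intro x y h
    have h1 := hVU (QuotientGroup.eq.1 h)
    refine ⟨fun hx => ?_, fun hy => ?_⟩
    · simpa using mul_mem hx h1
    · simpa using mul_mem hy (inv_mem h1)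
  let c : G ⧸ V → Ω := fun γ => if γ.out ∈ U then 1 else 0
  have hcmk : ∀ x : G, c (QuotientGroup.mk x) = if x ∈ U then 1 else 0 := fun x => by
    simp only [c, hmem _ x (QuotientGroup.out_eq' _)]
  have hact : ∀ {x : Ω}, (∀ v ∈ V, v • x = x) → ∀ y : G,
      (QuotientGroup.mk (s := V) y).out • x = y • x := by
    intro x hx y
    obtain ⟨v, hv⟩ := QuotientGroup.mk_out_eq_mul V y
    rw [hv, mul_smul, hx v v.2]
  have htr : ∀ {x : Ω}, (∀ v ∈ V, v • x = x) → ∀ g : G,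
      g • ∑ γ : G ⧸ V, c γ * γ.out • x = ∑ γ : G ⧸ V, c (g⁻¹ • γ) * γ.out • x := by
    intro x hx g
    conv_rhs => rw [← Equiv.sum_comp (MulAction.toPerm g : Equiv.Perm (G ⧸ V))]
    rw [Finset.smul_sum]
    refine Finset.sum_congr rfl fun γ _ => ?_
    obtain ⟨y, rfl⟩ := QuotientGroup.mk_surjective γ
    simp only [MulAction.toPerm_apply, inv_smul_smul]
    rw [hact hx y, show g • (QuotientGroup.mk (s := V) y) = QuotientGroup.mk (g * y) from rfl,
      hact hx, hcmk, mul_smul]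
    split_ifs <;> simp
  obtain ⟨x, hx, hne⟩ := exists_sum_mul_smul_ne_zero (Ω := Ω) hV
    (c := fun γ => c (s⁻¹ • γ) - c γ) (fun h => by
      have := congrFun h (QuotientGroup.mk 1)
      rw [show s⁻¹ • (QuotientGroup.mk (s := V) 1) = QuotientGroup.mk (s⁻¹ * 1) from rfl, hcmk,
        hcmk] at this
      simp [hs, U.one_mem] at this)
  refine ⟨∑ γ : G ⧸ V, c γ * γ.out • x, fun u hu => ?_, fun h => hne ?_⟩
  · rw [htr hx]
    refine Finset.sum_congr rfl fun γ _ => ?_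
    obtain ⟨y, rfl⟩ := QuotientGroup.mk_surjective γ
    rw [show u⁻¹ • (QuotientGroup.mk (s := V) y) = QuotientGroup.mk (u⁻¹ * y) from rfl, hcmk,
      hcmk, U.mul_mem_cancel_left (inv_mem hu)]
  · rw [htr hx] at h
    simp only [sub_mul, Finset.sum_sub_distrib, h, sub_self]

variable [TotallyDisconnectedSpace G]

theorem exists_eq_smul_div [FaithfulSMul G Ω] (hΩ : ∀ x : Ω, IsLocallyConstant fun g : G => g • x)
    {f : G → Ω} (hf : IsLocallyConstant f) (hf0 : ∀ x, f x ≠ 0)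
    (hd : ∀ x y, f (x * y) = f x * x • f y) :
    ∃ b : Ω, b ≠ 0 ∧ ∀ x, f x = x • b / b := by
  obtain ⟨T, hTn, hTo, hT⟩ := hf.exists_normal
  obtain ⟨V, hVn, hVo, hVT, hV⟩ := exists_normal_le_faithful hΩ hTo
  have := Subgroup.quotient_finite_of_isOpen V hVo
  let _ := Fintype.ofFinite (G ⧸ V)
  obtain ⟨x, hx, hne⟩ := exists_sum_mul_smul_ne_zero (Ω := Ω) hV (c := fun γ => f γ.out)
    (fun h => hf0 _ (congrFun h (QuotientGroup.mk 1)))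
  have hact : ∀ y : G, f (QuotientGroup.mk (s := V) y).out * (QuotientGroup.mk (s := V) y).out • x
      = f y * y • x := by
    intro y
    obtain ⟨v, hv⟩ := QuotientGroup.mk_out_eq_mul V y
    rw [hv, mul_smul, hx v v.2, hT y v (hVT v.2)]
  set c := ∑ γ : G ⧸ V, f γ.out * γ.out • x with hcdef
  have hσ : ∀ g : G, f g * g • c = c := by
    intro g
    conv_rhs => rw [hcdef, ← Equiv.sum_comp (MulAction.toPerm g : Equiv.Perm (G ⧸ V))]
    rw [hcdef, Finset.smul_sum, Finset.mul_sum]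
    refine Finset.sum_congr rfl fun γ _ => ?_
    obtain ⟨y, rfl⟩ := QuotientGroup.mk_surjective γ
    rw [hact, MulAction.toPerm_apply,
      show g • (QuotientGroup.mk (s := V) y) = QuotientGroup.mk (g * y) from rfl, hact, hd,
      smul_mul', mul_smul, mul_assoc]
  refine ⟨c⁻¹, inv_ne_zero hne, fun g => ?_⟩
  have h1 : g • c ≠ 0 := fun h => hne (by rw [← hσ g, h, mul_zero])
  rw [smul_inv'', div_inv_eq_mul, eq_inv_mul_iff_mul_eq₀ h1, mul_comm, hσ]

end HilbertNinety

section Tsen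

open MvPolynomial

theorem exists_ne_zero_of_isHomogeneous {C τ ι : Type} [Field C] [IsAlgClosed C] [Finite τ]
    [Finite ι] (h : Nat.card ι < Nat.card τ) (P : ι → MvPolynomial τ C) {d : ℕ} (hd : d ≠ 0)
    (hP : ∀ i, (P i).IsHomogeneous d) :
    ∃ x : τ → C, x ≠ 0 ∧ ∀ i, eval x (P i) = 0 := by
  classical
  have := Fintype.ofFinite τ
  by_contra! hcon
  -- the ideals generated by sets of variables form long chains of primes
  let φ : Finset τ → MvPolynomial τ C →ₐ[C] MvPolynomial τ C :=
    fun s => aeval fun i => if i ∈ s then 0 else X i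
  have hprime : ∀ s, (RingHom.ker (φ s)).IsPrime := fun s => RingHom.ker_isPrime _
  have hφ : ∀ s t, s ⊆ t → ∀ p, φ t p = φ t (φ s p) := by
    intro s t hst p
    have : φ t = (φ t).comp (φ s) := by
      refine algHom_ext fun i => ?_
      by_cases hi : i ∈ s
      · simp [φ, hi, hst hi]
      · simp [φ, hi]
    conv_lhs => rw [this]
    rfl
  have hheight : ∀ s : Finset τ, (s.card : ℕ∞) ≤ (RingHom.ker (φ s)).height := by
    intro s
    induction s using Finset.induction_on with
    | empty => simp
    | insert i s hi ih =>
      rw [Finset.card_insert_of_notMem hi, Nat.cast_add, Nat.cast_one]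
      refine (add_le_add_left ih 1).trans (Ideal.height_add_one_le_of_lt_of_isPrime ?_)
      refine lt_of_le_of_ne (fun p hp => ?_) fun heq => ?_
      · rw [RingHom.mem_ker] at hp ⊢
        rw [hφ s _ (Finset.subset_insert i s), hp, map_zero]
      · have h1 : (X i : MvPolynomial τ C) ∈ RingHom.ker (φ (insert i s)) := by
          rw [RingHom.mem_ker]; simp [φ]
        rw [← heq, RingHom.mem_ker] at h1
        simp [φ, hi] at h1
  set p := RingHom.ker (φ Finset.univ) with hp
  have hmem : ∀ q, q ∈ p ↔ eval (0 : τ → C) q = 0 := by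
    intro q
    have : φ Finset.univ = (Algebra.ofId C (MvPolynomial τ C)).comp (aeval (0 : τ → C)) :=
      algHom_ext fun i => by simp [φ]
    rw [hp, RingHom.mem_ker, this, AlgHom.comp_apply, Algebra.ofId_apply,
      map_eq_zero_iff _ (algebraMap C (MvPolynomial τ C)).injective, aeval_eq_eval]
  have hI : Ideal.span (Set.range P) ≤ p := by
    rw [Ideal.span_le]
    rintro _ ⟨i, rfl⟩
    rw [SetLike.mem_coe, hmem]
    rw [eval_zero, constantCoeff_eq]
    refine (hP i).coeff_eq_zero ?_
    simpa using hd.symm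
  have hmin : p ∈ (Ideal.span (Set.range P)).minimalPrimes := by
    refine ⟨⟨hprime _, hI⟩, fun J hJ _ => ?_⟩
    refine le_trans ?_ ((Ideal.IsPrime.radical_le_iff hJ.1).2 hJ.2)
    rw [← vanishingIdeal_zeroLocus_eq_radical (K := C)]
    intro q hq x hx
    have hx0 : x = 0 := by
      by_contra hx0
      obtain ⟨i, hi⟩ := hcon x hx0
      exact hi (by simpa [coe_aeval_eq_eval] using hx (P i) (Ideal.subset_span ⟨i, rfl⟩))
    rw [hx0]
    simpa [coe_aeval_eq_eval] using (hmem q).1 hq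
  have h1 := (hheight Finset.univ).trans
    (Ideal.height_le_card_of_mem_minimalPrimes_span (Set.finite_range P) hmin)
  have h2 : (Set.range P).ncard ≤ Nat.card ι := by
    rw [← Set.image_univ, ← Set.ncard_univ]
    exact Set.ncard_image_le
  rw [Finset.card_univ, ← Nat.card_eq_fintype_card] at h1
  have h3 : Nat.card τ ≤ (Set.range P).ncard := by exact_mod_cast h1
  omega

/-- If the coefficients of a form over `E` span a `C`-subspace whose dimension is less than the
number of variables, then the form has a nontrivial zero over the algebraically closed
field `C`. -/
theorem exists_eval_algebraMap_eq_zero {C E τ : Type} [Field C] [IsAlgClosed C] [CommRing E]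
    [Algebra C E] [Finite τ] {P : MvPolynomial τ E} {d : ℕ} (hd : d ≠ 0) (hP : P.IsHomogeneous d)
    (W : Submodule C E) [Module.Finite C W] (hW : ∀ m, P.coeff m ∈ W)
    (hcard : Module.finrank C W < Nat.card τ) :
    ∃ y : τ → C, y ≠ 0 ∧ eval (fun i => algebraMap C E (y i)) P = 0 := by
  classical
  let b := Module.finBasis C W
  let Q : Fin (Module.finrank C W) → MvPolynomial τ C := fun l =>
    ∑ m ∈ P.support, monomial m (b.repr ⟨P.coeff m, hW m⟩ l)
  obtain ⟨y, hy0, hy⟩ := exists_ne_zero_of_isHomogeneous (by simpa using hcard) Q hd (fun l =>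
    IsHomogeneous.sum _ _ _ fun m hm => isHomogeneous_monomial _ (by
      have := hP (mem_support_iff.1 hm)
      rw [Finsupp.degree_eq_weight_one]
      exact this))
  refine ⟨y, hy0, ?_⟩
  have h1 : (∑ m ∈ P.support, (m.prod fun i k => y i ^ k) • (⟨P.coeff m, hW m⟩ : W)) = 0 := by
    refine b.ext_elem fun l => ?_
    have := hy l
    simp only [Q, map_sum, eval_monomial] at this
    rw [map_zero, Finsupp.zero_apply, ← this, map_sum, Finsupp.finsetSum_apply]
    exact Finset.sum_congr rfl fun m _ => by
      rw [map_smul, Finsupp.smul_apply, smul_eq_mul, mul_comm]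
  have h2 := congrArg Subtype.val h1
  rw [eval_eq]
  rw [AddSubmonoidClass.coe_finsetSum] at h2
  refine Eq.trans (Finset.sum_congr rfl fun m _ => ?_) h2
  simp only [Submodule.coe_smul, Algebra.smul_def, Finsupp.prod, map_prod, map_pow]
  rw [mul_comm]

end Tsen

section Tsen

open MvPolynomial

section Coefficients

variable {C E τ : Type} [Field C] [CommRing E] [Algebra C E]

theorem coeff_mul_mem_mul {M₁ M₂ : Submodule C E} {p q : MvPolynomial τ E}
    (hp : ∀ m, p.coeff m ∈ M₁) (hq : ∀ m, q.coeff m ∈ M₂) (m : τ →₀ ℕ) :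
    (p * q).coeff m ∈ M₁ * M₂ := by
  classical
  rw [coeff_mul]
  exact sum_mem fun x _ => Submodule.mul_mem_mul (hp _) (hq _)

theorem coeff_pow_mem_pow {M : Submodule C E} {p : MvPolynomial τ E}
    (hp : ∀ m, p.coeff m ∈ M) (n : ℕ) : ∀ m, (p ^ n).coeff m ∈ M ^ n := by
  classical
  induction n with
  | zero =>
    intro m
    rw [pow_zero, pow_zero, coeff_one]
    split_ifs
    · exact Submodule.one_le.1 le_rfl
    · exact zero_mem _
  | succ n ih =>
    intro m
    rw [pow_succ, pow_succ]
    exact coeff_mul_mem_mul ih hp m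

theorem coeff_prod_pow_mem_pow {σ : Type} {M : Submodule C E} {Q : σ → MvPolynomial τ E}
    (hQ : ∀ i m, (Q i).coeff m ∈ M) (k : σ → ℕ) (s : Finset σ) :
    ∀ m, (∏ i ∈ s, Q i ^ k i).coeff m ∈ M ^ ∑ i ∈ s, k i := by
  classical
  induction s using Finset.induction_on with
  | empty => simpa using coeff_pow_mem_pow (M := M) (p := (0 : MvPolynomial τ E)) (by simp) 0
  | insert i s hi ih =>
    intro m
    rw [Finset.prod_insert hi, Finset.sum_insert hi, pow_add]
    exact coeff_mul_mem_mul (coeff_pow_mem_pow (hQ i) _) ih m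

end Coefficients

section Span

variable {C E : Type} [Field C] [Field E] [Algebra C E]

/-- The span of the powers `1, x, …, x ^ s`. -/
def powSpan (C : Type) {E : Type} [Field C] [Field E] [Algebra C E] (x : E) (s : ℕ) :
    Submodule C E :=
  Submodule.span C (Set.range fun k : Fin (s + 1) => x ^ (k : ℕ))

theorem pow_mem_powSpan (x : E) {s k : ℕ} (h : k ≤ s) : x ^ k ∈ powSpan C x s :=
  Submodule.subset_span ⟨⟨k, by omega⟩, rfl⟩

theorem powSpan_mul_le (x : E) (s t : ℕ) :
    powSpan C x s * powSpan C x t ≤ powSpan C x (s + t) := by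
  rw [powSpan, powSpan, Submodule.span_mul_span, Submodule.span_le]
  rintro _ ⟨_, ⟨a, rfl⟩, _, ⟨b, rfl⟩, rfl⟩
  simp only [← pow_add]
  exact pow_mem_powSpan x (by omega)

theorem powSpan_pow_le (x : E) (s d : ℕ) : powSpan C x s ^ d ≤ powSpan C x (d * s) := by
  induction d with
  | zero =>
    rw [pow_zero, Submodule.one_le]
    simpa using pow_mem_powSpan (C := C) x (Nat.zero_le (0 * s))
  | succ d ih =>
    rw [pow_succ, Nat.succ_mul]
    exact (mul_le_mul' ih le_rfl).trans (powSpan_mul_le x _ _)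

theorem powSpan_mul_span (x : E) (s : ℕ) {m : ℕ} (e : Fin m → E) :
    powSpan C x s * Submodule.span C (Set.range e) =
      Submodule.span C (Set.range fun p : Fin (s + 1) × Fin m => x ^ (p.1 : ℕ) * e p.2) := by
  rw [powSpan, Submodule.span_mul_span]
  congr 1
  ext y
  simp [Set.mem_mul]

theorem finrank_powSpan_mul_span_le (x : E) (s : ℕ) {m : ℕ} (e : Fin m → E) :
    Module.finrank C ↥(powSpan C x s * Submodule.span C (Set.range e)) ≤ (s + 1) * m := by
  rw [powSpan_mul_span]
  refine (finrank_range_le_card _).trans ?_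
  simp

end Span

variable {C E : Type} [Field C] [Field E] [Algebra C E] [Algebra (RatFunc C) E]
  [IsScalarTower C (RatFunc C) E]

theorem aeval_algebraMap_X (a : Polynomial C) :
    Polynomial.aeval (algebraMap (RatFunc C) E RatFunc.X) a =
      algebraMap (RatFunc C) E (algebraMap (Polynomial C) (RatFunc C) a) := by
  rw [Polynomial.aeval_algebraMap_apply, ← RatFunc.algebraMap_X, Polynomial.aeval_algebraMap_apply,
    Polynomial.aeval_X_left_apply]

theorem exists_mul_mem_powSpan_mul {m : ℕ} (e : Module.Basis (Fin m) (RatFunc C) E)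
    {K : Submodule C E} (hK : K.FG) :
    ∃ h : E, h ≠ 0 ∧ ∃ D : ℕ, ∀ x ∈ K, h * x ∈
      powSpan C (algebraMap (RatFunc C) E RatFunc.X) D * Submodule.span C (Set.range e) := by
  obtain ⟨s, rfl⟩ := hK
  obtain ⟨b, hb⟩ := IsLocalization.exist_integer_multiples_of_finite
    (nonZeroDivisors (Polynomial C)) fun p : s × Fin m => e.repr p.1 p.2
  choose a ha using hb
  refine ⟨algebraMap (RatFunc C) E (algebraMap (Polynomial C) (RatFunc C) b), ?_,
    Finset.univ.sup fun p => (a p).natDegree, ?_⟩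
  · rw [Ne, map_eq_zero_iff _ (algebraMap (RatFunc C) E).injective,
      map_eq_zero_iff _ (IsFractionRing.injective (Polynomial C) (RatFunc C))]
    exact nonZeroDivisors.coe_ne_zero b
  · set h := algebraMap (RatFunc C) E (algebraMap (Polynomial C) (RatFunc C) b)
    intro x hx
    refine Submodule.span_induction (p := fun x _ => h * x ∈ _) (fun x hx => ?_)
      (by simp) (fun x y _ _ hx hy => by rw [mul_add]; exact add_mem hx hy)
      (fun c x _ hx => by rw [mul_smul_comm]; exact Submodule.smul_mem _ c hx) hx
    rw [← e.sum_repr x, Finset.mul_sum]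
    refine sum_mem fun j _ => ?_
    have h1 : h * e.repr x j • e j = Polynomial.aeval (algebraMap (RatFunc C) E RatFunc.X)
        (a (⟨x, hx⟩, j)) * e j := by
      rw [aeval_algebraMap_X, ha, Algebra.smul_def (R := Polynomial C), Algebra.smul_def, map_mul,
        mul_assoc]
    rw [h1]
    refine Submodule.mul_mem_mul ?_ (Submodule.subset_span ⟨j, rfl⟩)
    rw [Polynomial.aeval_eq_sum_range]
    refine sum_mem fun k hk => Submodule.smul_mem _ _ (pow_mem_powSpan _ ?_)
    rw [Finset.mem_range] at hk
    exact (Nat.lt_succ_iff.1 hk).trans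
      (Finset.le_sup (f := fun p => (a p).natDegree) (Finset.mem_univ _))

theorem exists_sum_ne_zero {m s : ℕ} (e : Module.Basis (Fin m) (RatFunc C) E)
    {y : Fin (s + 1) × Fin m → C} (hy : y ≠ 0) :
    ∑ p, algebraMap C E (y p) * (algebraMap (RatFunc C) E RatFunc.X ^ (p.1 : ℕ) * e p.2) ≠ 0 := by
  intro h0
  let a : Fin m → Polynomial C := fun j => ∑ k : Fin (s + 1), Polynomial.monomial k (y (k, j))
  have h1 : ∑ j, algebraMap (Polynomial C) (RatFunc C) (a j) • e j = 0 := by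
    rw [← h0, Fintype.sum_prod_type_right]
    refine Finset.sum_congr rfl fun j _ => ?_
    rw [Algebra.smul_def, ← aeval_algebraMap_X, map_sum, Finset.sum_mul]
    refine Finset.sum_congr rfl fun k _ => ?_
    rw [Polynomial.aeval_monomial, mul_assoc]
  have h2 := Fintype.linearIndependent_iff.1 e.linearIndependent _ h1
  refine hy (funext fun p => ?_)
  have h3 := h2 p.2
  rw [map_eq_zero_iff _ (IsFractionRing.injective (Polynomial C) (RatFunc C))] at h3
  have h4 := congrArg (fun q => Polynomial.coeff q p.1) h3
  simpa [a, Polynomial.finsetSum_coeff, Polynomial.coeff_monomial, Fin.val_inj] using h4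

/-- **Tsen's theorem** for finite extensions of `C(t)`. -/
theorem exists_eval_eq_zero_of_finite [IsAlgClosed C] [Module.Finite (RatFunc C) E]
    {σ : Type} [Fintype σ] {d : ℕ} (hd : d ≠ 0) (hdσ : d < Fintype.card σ)
    {p : MvPolynomial σ E} (hp : p.IsHomogeneous d) :
    ∃ x : σ → E, x ≠ 0 ∧ eval x p = 0 := by
  classical
  let e := Module.finBasis (RatFunc C) E
  set m := Module.finrank (RatFunc C) E
  have hm : 0 < m := Module.finrank_pos
  set T := algebraMap (RatFunc C) E RatFunc.X
  let K : Submodule C E := Submodule.span C (p.coeff '' p.support)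
  let B : Submodule C E := Submodule.span C (Set.range e)
  obtain ⟨h, hh, D, hD⟩ := exists_mul_mem_powSpan_mul e (K := K * B ^ d)
    (((Submodule.fg_span (p.support.finite_toSet.image _)).mul
      ((Submodule.fg_span (Set.finite_range _)).pow d)))
  let τ := σ × Fin (D + 1) × Fin m
  let Q : σ → MvPolynomial τ E := fun i =>
    ∑ q : Fin (D + 1) × Fin m, MvPolynomial.C (T ^ (q.1 : ℕ) * e q.2) * X (i, q)
  have hQ : ∀ i u, (Q i).coeff u ∈ powSpan C T D * B := by
    intro i u
    rw [coeff_sum]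
    refine sum_mem fun q _ => ?_
    rw [coeff_C_mul, coeff_X]
    split_ifs
    · rw [mul_one]
      exact Submodule.mul_mem_mul (pow_mem_powSpan T (by omega)) (Submodule.subset_span ⟨_, rfl⟩)
    · rw [mul_zero]
      exact zero_mem _
  let P : MvPolynomial τ E := aeval Q p
  have hP : P.IsHomogeneous d := by
    have := hp.aeval Q (n := 1) fun i => IsHomogeneous.sum _ _ _ fun q _ => by
      simpa using (isHomogeneous_C τ (T ^ (q.1 : ℕ) * e q.2)).mul (isHomogeneous_X E (i, q))
    rwa [one_mul] at this
  let W : Submodule C E := (powSpan C T (d * D + D) * B).map (LinearMap.mulLeft C h⁻¹)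
  have hfin : Module.Finite C ↥(powSpan C T (d * D + D) * B) := by
    refine Module.Finite.iff_fg.2 ((Submodule.fg_span (Set.finite_range _)).mul
      (Submodule.fg_span (Set.finite_range _)))
  have hPc : ∀ u, P.coeff u ∈ K * (powSpan C T D * B) ^ d := by
    intro u
    rw [show P = aeval Q p from rfl, aeval_def, eval₂_eq, coeff_sum]
    refine sum_mem fun v hv => ?_
    have hvd : ∑ i ∈ v.support, v i = d := by
      have := hp (mem_support_iff.1 hv)
      rw [← this, ← Finsupp.degree_apply, Finsupp.degree_eq_weight_one]
      rfl
    rw [algebraMap_eq, coeff_C_mul]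
    have := coeff_prod_pow_mem_pow hQ v v.support u
    rw [hvd] at this
    exact Submodule.mul_mem_mul (Submodule.subset_span ⟨v, hv, rfl⟩) this
  have hPW : ∀ u, P.coeff u ∈ W := by
    intro u
    refine ⟨h * P.coeff u, ?_, by simp [hh]⟩
    have h1 : K * (powSpan C T D * B) ^ d ≤ (K * B ^ d) * powSpan C T (d * D) := by
      rw [mul_pow, mul_comm (powSpan C T D ^ d), ← mul_assoc]
      exact mul_le_mul' le_rfl (powSpan_pow_le T D d)
    refine Submodule.mul_induction_on (C := fun z => h * z ∈ powSpan C T (d * D + D) * B)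
      (h1 (hPc u)) (fun a ha b hb => ?_)
      fun a b ha hb => by rw [mul_add]; exact add_mem ha hb
    have h2 := Submodule.mul_mem_mul hb (hD a ha)
    rw [← mul_assoc (powSpan C T (d * D))] at h2
    have h3 := mul_le_mul' (powSpan_mul_le (C := C) T (d * D) D) (le_refl B) h2
    convert h3 using 1
    ring
  obtain ⟨y, hy0, hy⟩ := exists_eval_algebraMap_eq_zero hd hP W hPW (by
    refine (Submodule.finrank_map_le _ _).trans_lt
      ((finrank_powSpan_mul_span_le T _ _).trans_lt ?_)
    simp only [τ, Nat.card_eq_fintype_card, Fintype.card_prod, Fintype.card_fin]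
    rw [← mul_assoc]
    refine Nat.mul_lt_mul_of_pos_right ?_ hm
    nlinarith [Nat.pos_of_ne_zero hd])
  refine ⟨fun i => ∑ q : Fin (D + 1) × Fin m, algebraMap C E (y (i, q)) * (T ^ (q.1 : ℕ) * e q.2),
    fun hx => ?_, ?_⟩
  · obtain ⟨⟨i, q⟩, hiq⟩ := Function.ne_iff.1 hy0
    exact exists_sum_ne_zero e (y := fun q => y (i, q)) (fun h => hiq (congrFun h q))
      (congrFun hx i)
  · rw [← hy, show P = bind₁ Q p from rfl]
    refine Eq.trans ?_ (eval₂Hom_bind₁ (RingHom.id E) (fun i => algebraMap C E (y i)) Q p).symm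
    congr 1
    refine congrArg _ (funext fun i => ?_)
    simp [Q, mul_comm]

theorem exists_eval_eq_zero_of_isAlgebraic {C E : Type} [Field C] [IsAlgClosed C] [Field E]
    [Algebra (RatFunc C) E] [Algebra.IsAlgebraic (RatFunc C) E]
    {σ : Type} [Fintype σ] {d : ℕ} (hd : d ≠ 0) (hdσ : d < Fintype.card σ)
    {p : MvPolynomial σ E} (hp : p.IsHomogeneous d) :
    ∃ x : σ → E, x ≠ 0 ∧ eval x p = 0 := by
  classical
  let E₀ := IntermediateField.adjoin (RatFunc C) (p.coeff '' p.support)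
  have hfin : Module.Finite (RatFunc C) E₀ := by
    have := (p.support.finite_toSet.image p.coeff).to_subtype
    exact IntermediateField.finiteDimensional_adjoin fun x _ =>
      (Algebra.IsAlgebraic.isAlgebraic x).isIntegral
  obtain ⟨p₀, hp₀⟩ : ∃ p₀ : MvPolynomial σ E₀, map (algebraMap E₀ E) p₀ = p := by
    rw [← Set.mem_range, mem_range_map_iff_coeffs_subset]
    intro c hc
    rw [Finset.mem_coe, mem_coeffs_iff] at hc
    obtain ⟨m, hm, rfl⟩ := hc
    exact ⟨⟨p.coeff m, IntermediateField.subset_adjoin _ _ ⟨m, hm, rfl⟩⟩, rfl⟩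
  rw [← hp₀] at hp
  let _ : Algebra C E₀ := Algebra.compHom E₀ (algebraMap C (RatFunc C))
  have : IsScalarTower C (RatFunc C) E₀ := IsScalarTower.of_algebraMap_eq fun _ => rfl
  obtain ⟨x, hx0, hx⟩ := exists_eval_eq_zero_of_finite (C := C) hd hdσ
    (hp.of_map (algebraMap E₀ E).injective)
  refine ⟨fun i => x i, fun h => hx0 (funext fun i => Subtype.ext (congrFun h i)), ?_⟩
  rw [← hp₀, eval_map]
  exact (eval₂_comp_left (algebraMap E₀ E) (RingHom.id _) x p₀).symm.trans
    ((congrArg (algebraMap E₀ E) hx).trans (map_zero _))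

end Tsen

section CyclicLayer

variable {G : Type} [Group G]

/-- `S / U` is cyclic of order `q`, generated by `σ`. -/
structure IsCyclicLayer (U S : Subgroup G) (σ : G) (q : ℕ) : Prop where
  le : U ≤ S
  mem : σ ∈ S
  pow_mem : σ ^ q ∈ U
  conj_mem : ∀ s ∈ S, ∀ u ∈ U, s⁻¹ * u * s ∈ U
  exists_eq : ∀ s ∈ S, ∃ i < q, ∃ u ∈ U, s = σ ^ i * u
  pow_notMem : ∀ i, 0 < i → i < q → σ ^ i ∉ U

namespace IsCyclicLayer

variable {U S : Subgroup G} {σ : G} {q : ℕ}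

theorem smul_pow_smul (h : IsCyclicLayer U S σ q) {X : Type} [MulAction G X] {x : X}
    (hx : ∀ u ∈ U, u • x = x) (i : ℕ) {u : G} (hu : u ∈ U) : u • σ ^ i • x = σ ^ i • x := by
  have h1 := hx _ (h.conj_mem (σ ^ i) (_root_.pow_mem h.mem i) u hu)
  conv_rhs => rw [← h1]
  simp only [mul_smul, smul_inv_smul]

theorem pow_smul_self (h : IsCyclicLayer U S σ q) {X : Type} [MulAction G X] {x : X}
    (hx : ∀ u ∈ U, u • x = x) : σ ^ q • x = x := hx _ h.pow_mem

open Classical in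
theorem sum_ite_mem (h : IsCyclicLayer U S σ q) {s : G} (hs : s ∈ S) :
    ∑ i ∈ Finset.range q, (if s * σ ^ i ∈ U then (1 : ℤ) else 0) = 1 := by
  obtain ⟨i, hi, u, hu, hsu⟩ := h.exists_eq _ (inv_mem hs)
  have hs' : s = u⁻¹ * (σ ^ i)⁻¹ := by rw [← mul_inv_rev, ← hsu, inv_inv]
  have hmem : s * σ ^ i ∈ U := by rw [hs', inv_mul_cancel_right]; exact inv_mem hu
  rw [Finset.sum_eq_single i, if_pos hmem]
  · intro j hj hji
    rw [Finset.mem_range] at hj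
    refine if_neg fun hmem' => ?_
    have h1 := mul_mem (inv_mem hmem) hmem'
    rw [mul_inv_rev, mul_assoc, inv_mul_cancel_left] at h1
    rcases lt_or_gt_of_ne hji with hlt | hlt
    · refine h.pow_notMem (i - j) (by omega) (by omega) ?_
      obtain ⟨k, rfl⟩ := Nat.exists_eq_add_of_lt hlt
      have h2 := inv_mem h1
      rw [mul_inv_rev, inv_inv, show j + k + 1 = j + (k + 1) by ring, pow_add,
        inv_mul_cancel_left] at h2
      rwa [show j + k + 1 - j = k + 1 by omega]
    · refine h.pow_notMem (j - i) (by omega) (by omega) ?_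
      obtain ⟨k, rfl⟩ := Nat.exists_eq_add_of_lt hlt
      rw [show i + k + 1 = i + (k + 1) by ring, pow_add, inv_mul_cancel_left] at h1
      rwa [show i + k + 1 - i = k + 1 by omega]
  · intro hi'
    exact absurd (Finset.mem_range.2 hi) hi'

variable [TopologicalSpace G] [IsTopologicalGroup G] {M : Type} [AddCommGroup M]

theorem _root_.IsLocallyConstant.of_mul_right_invariant {X : Type} {f : G → X} (hU : IsOpen (U : Set G))
    (hf : ∀ x, ∀ u ∈ U, f (x * u) = f x) : IsLocallyConstant f := by
  rw [IsLocallyConstant.iff_eventually_eq]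
  intro x
  have : (fun y => x⁻¹ * y) ⁻¹' (U : Set G) ∈ nhds x :=
    (hU.preimage (by fun_prop)).mem_nhds (by simp [U.one_mem])
  filter_upwards [this] with y hy
  have := hf x _ hy
  rwa [mul_inv_cancel_left] at this

/-- Elements of norm zero in a coinduced module are of the form `σ • y - y`. -/
theorem exists_smul_sub_eq (h : IsCyclicLayer U S σ q) (hU : IsOpen (U : Set G)) {β : Coind G M}
    (hβ : ∀ u ∈ U, u • β = β) (hN : ∑ i ∈ Finset.range q, σ ^ i • β = 0) :
    ∃ y : Coind G M, (∀ u ∈ U, u • y = y) ∧ σ • y - y = β := by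
  classical
  let e : G → ℤ := fun x => if (QuotientGroup.mk (s := S) x).out⁻¹ * x ∈ U then 1 else 0
  have hmk : ∀ x, ∀ s ∈ S, (QuotientGroup.mk (s := S) (x * s)) = QuotientGroup.mk x := by
    intro x s hs
    rw [eq_comm, QuotientGroup.eq]
    simpa using hs
  have heU : ∀ x, ∀ u ∈ U, e (x * u) = e x := by
    intro x u hu
    simp only [e]
    rw [hmk x u (h.le hu), ← mul_assoc, U.mul_mem_cancel_right hu]
  have hesum : ∀ x, ∑ i ∈ Finset.range q, e (x * σ ^ i) = 1 := by
    intro x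
    rw [← h.sum_ite_mem (s := (QuotientGroup.mk (s := S) x).out⁻¹ * x)
      (QuotientGroup.eq.1 (QuotientGroup.out_eq' _))]
    refine Finset.sum_congr rfl fun i _ => ?_
    simp only [e]
    rw [hmk x _ (_root_.pow_mem h.mem i), mul_assoc]
  have hconj : ∀ x u, u ∈ U → ∀ i : ℕ, ∃ u' ∈ U, x * u * σ ^ i = x * σ ^ i * u' := by
    intro x u hu i
    exact ⟨_, h.conj_mem _ (_root_.pow_mem h.mem i) u hu, by group⟩
  have hβU : ∀ x, ∀ u ∈ U, β.1 (x * u) = β.1 x := fun x u hu =>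
    congrFun (congrArg Subtype.val (hβ u hu)) x
  let B : ℕ → G → M := fun i x => ∑ j ∈ Finset.range i, β.1 (x * σ ^ j)
  have hBU : ∀ i x, ∀ u ∈ U, B i (x * u) = B i x := by
    intro i x u hu
    refine Finset.sum_congr rfl fun j _ => ?_
    obtain ⟨u', hu', h1⟩ := hconj x u hu j
    rw [h1, hβU _ _ hu']
  have hBq : ∀ x, B q x = 0 := by
    intro x
    have := congrFun (congrArg Subtype.val hN) x
    rw [AddSubgroup.val_finsetSum, Finset.sum_apply] at this
    exact this
  have hBs : ∀ i x, B i (x * σ) = B (i + 1) x - β.1 x := by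
    intro i x
    simp only [B]
    rw [Finset.sum_range_succ', pow_zero, mul_one, add_sub_cancel_right]
    exact Finset.sum_congr rfl fun j _ => by rw [pow_succ', mul_assoc]
  let y : G → M := fun x => -∑ i ∈ Finset.range q, e (x * σ ^ i) • B i x
  have hyU : ∀ x, ∀ u ∈ U, y (x * u) = y x := by
    intro x u hu
    simp only [y]
    congr 1
    refine Finset.sum_congr rfl fun i _ => ?_
    obtain ⟨u', hu', h1⟩ := hconj x u hu i
    rw [hBU i x u hu, h1, heU _ _ hu']
  refine ⟨⟨y, IsLocallyConstant.of_mul_right_invariant hU hyU⟩,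
    fun u hu => Subtype.ext (funext fun x => hyU x u hu), Subtype.ext (funext fun x => ?_)⟩
  show y (x * σ) - y x = β.1 x
  have h1 : y (x * σ) = -∑ i ∈ Finset.range q, e (x * σ ^ (i + 1)) • B (i + 1) x + β.1 x := by
    have h2 : ∑ i ∈ Finset.range q, e (x * σ ^ (i + 1)) • β.1 x = β.1 x := by
      rw [← Finset.sum_smul]
      have := hesum (x * σ)
      simp only [mul_assoc, ← pow_succ'] at this
      rw [this, one_smul]
    simp only [y, hBs, mul_assoc, ← pow_succ', smul_sub, Finset.sum_sub_distrib, h2]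
    abel
  have h3 : ∑ i ∈ Finset.range q, e (x * σ ^ (i + 1)) • B (i + 1) x =
      ∑ i ∈ Finset.range q, e (x * σ ^ i) • B i x := by
    have := Finset.sum_range_succ' (fun i => e (x * σ ^ i) • B i x) q
    rw [Finset.sum_range_succ, hBq, smul_zero, add_zero] at this
    rw [this]
    simp [B]
  rw [h1, h3]
  simp only [y]
  abel

variable [DistribMulAction G M] [CompactSpace G] [TotallyDisconnectedSpace G]

/-- If norms from `U`-invariants to `S`-invariants are surjective and `H¹(U, M)` vanishes, then
classes in `H²(S, M)` which vanish on `U` are trivial. -/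
theorem exists_shift_eq (h : IsCyclicLayer U S σ q) (hU : IsOpen (U : Set G)) (hM : IsSmooth G M)
    (hH : HVan U M 0)
    (hnorm : ∀ a : M, (∀ s ∈ S, s • a = a) →
      ∃ c : M, (∀ u ∈ U, u • c = c) ∧ ∑ i ∈ Finset.range q, σ ^ i • c = a)
    {f : G → Shift G M} (hd : ∀ x y, f (x * y) = f x + x • f y)
    (hf : ∃ m, ∀ u ∈ U, f u = u • m - m) : ∃ m, ∀ s ∈ S, f s = s • m - m := by
  obtain ⟨m, hm⟩ := hf
  wlog hm0 : m = 0 generalizing f m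
  · obtain ⟨m', hm'⟩ := this (f := fun x => f x - (x • m - m))
      (fun x y => by simp only [hd, mul_smul, smul_sub]; abel) 0
      (fun u hu => by simp [hm u hu]) rfl
    refine ⟨m' + m, fun s hs => ?_⟩
    have := hm' s hs
    rw [sub_eq_iff_eq_add] at this
    rw [this, smul_add]
    abel
  subst hm0
  replace hm : ∀ u ∈ U, f u = 0 := fun u hu => by rw [hm u hu]; simp
  have hbU : ∀ u ∈ U, u • f σ = f σ := by
    intro u hu
    have h1 := hd u σ
    have h2 := hd σ (σ⁻¹ * u * σ)
    rw [hm _ (h.conj_mem σ h.mem u hu), smul_zero, add_zero] at h2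
    rw [hm u hu, zero_add] at h1
    rw [← h1, ← h2]
    congr 1
    group
  have hpow : ∀ i : ℕ, f (σ ^ i) = ∑ j ∈ Finset.range i, σ ^ j • f σ := by
    intro i
    induction i with
    | zero => simpa using hm 1 U.one_mem
    | succ i ih => rw [pow_succ, hd, ih, Finset.sum_range_succ]
  obtain ⟨β₀, hβ₀⟩ := Shift.mk_surjective (f σ)
  have hz : ∀ u : U, ∃ z : M, coindEmb hM z = (u : G) • β₀ - β₀ := fun u => by
    rw [← Shift.mk_eq_zero_iff_exists, map_sub, Shift.mk_smul, hβ₀, hbU u u.2, sub_self]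
  choose z hz using hz
  rw [hVan_zero_iff] at hH
  obtain ⟨m₁, hm₁⟩ := hH z
    (IsLocallyConstant.of_comp_injective (coindEmb_injective hM) (by
      simp only [hz]
      exact ((Coind.isSmooth β₀).comp (fun b => b - β₀)).comp_continuous continuous_subtype_val))
    (fun x y => coindEmb_injective hM (by
      rw [map_add, Subgroup.smul_def, coindEmb_smul, hz, hz, hz, Subgroup.coe_mul, mul_smul,
        smul_sub]
      abel))
  let β₁ := β₀ - coindEmb hM m₁
  have hβ₁U : ∀ u ∈ U, u • β₁ = β₁ := by
    intro u hu
    have h1 := hz ⟨u, hu⟩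
    rw [hm₁, Subgroup.smul_def, map_sub, coindEmb_smul] at h1
    simp only [β₁, smul_sub]
    rw [sub_eq_sub_iff_sub_eq_sub, ← h1]
  have hβ₁ : Shift.mk G M β₁ = f σ := by
    have : Shift.mk G M (coindEmb hM m₁) = 0 := (Shift.mk_eq_zero_iff_exists hM _).2 ⟨m₁, rfl⟩
    rw [map_sub, this, sub_zero, hβ₀]
  obtain ⟨a, ha⟩ : ∃ a, coindEmb hM a = ∑ i ∈ Finset.range q, σ ^ i • β₁ := by
    rw [← Shift.mk_eq_zero_iff_exists, map_sum]
    simp only [Shift.mk_smul, hβ₁]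
    rw [← hpow, hm _ h.pow_mem]
  have haU : ∀ u ∈ U, u • a = a := fun u hu => coindEmb_injective hM (by
    rw [coindEmb_smul, ha, Finset.smul_sum]
    exact Finset.sum_congr rfl fun i _ => h.smul_pow_smul hβ₁U i hu)
  have haσ : σ • a = a := coindEmb_injective hM (by
    rw [coindEmb_smul, ha, Finset.smul_sum]
    have := Finset.sum_range_succ' (fun i => σ ^ i • β₁) q
    rw [Finset.sum_range_succ, h.pow_smul_self hβ₁U, pow_zero, one_smul, add_left_inj] at this
    rw [this]
    exact Finset.sum_congr rfl fun i _ => by rw [pow_succ', mul_smul])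
  have haS : ∀ s ∈ S, s • a = a := by
    intro s hs
    obtain ⟨i, -, u, hu, rfl⟩ := h.exists_eq s hs
    rw [mul_smul, haU u hu]
    clear hs
    induction i with
    | zero => simp
    | succ i ih => rw [pow_succ, mul_smul, haσ, ih]
  obtain ⟨c, hcU, hc⟩ := hnorm a haS
  have hcE : Shift.mk G M (coindEmb hM c) = 0 := (Shift.mk_eq_zero_iff_exists hM _).2 ⟨c, rfl⟩
  obtain ⟨y, hyU, hy⟩ := h.exists_smul_sub_eq hU (β := β₁ - coindEmb hM c)
    (fun u hu => by rw [smul_sub, hβ₁U u hu, ← coindEmb_smul, hcU u hu]) (by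
      simp only [smul_sub, Finset.sum_sub_distrib, ← ha, ← hc, map_sum, coindEmb_smul, sub_self])
  have hfσ : f σ = σ • Shift.mk G M y - Shift.mk G M y := by
    rw [← Shift.mk_smul, ← map_sub, hy, map_sub, hcE, sub_zero, hβ₁]
  refine ⟨Shift.mk G M y, fun s hs => ?_⟩
  obtain ⟨i, -, u, hu, rfl⟩ := h.exists_eq s hs
  rw [hd, hm u hu, smul_zero, add_zero, mul_smul, ← Shift.mk_smul u, hyU u hu]
  clear hs
  induction i with
  | zero => simpa using hm 1 U.one_mem
  | succ i ih =>
    rw [pow_succ, hd, ih, hfσ, mul_smul, smul_sub]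
    abel

end IsCyclicLayer

end CyclicLayer

section Degree2

variable {G : Type} [Group G]

theorem IsCyclicLayer.exists_of_index {U S : Subgroup G} {q : ℕ} (hq : q.Prime) (hle : U ≤ S)
    (hn : (U.subgroupOf S).Normal) (hi : (U.subgroupOf S).index = q) :
    ∃ σ, IsCyclicLayer U S σ q := by
  have : Fact q.Prime := ⟨hq⟩
  have hcard : Nat.card (S ⧸ U.subgroupOf S) = q := hi
  have : Finite (S ⧸ U.subgroupOf S) := Nat.finite_of_card_ne_zero (by rw [hcard]; exact hq.ne_zero)
  have : Nontrivial (S ⧸ U.subgroupOf S) :=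
    Finite.one_lt_card_iff_nontrivial.1 (by rw [hcard]; exact hq.one_lt)
  obtain ⟨g, hg⟩ := exists_ne (1 : S ⧸ U.subgroupOf S)
  obtain ⟨σ, rfl⟩ := QuotientGroup.mk_surjective g
  have hord : orderOf (σ : S ⧸ U.subgroupOf S) = q := by
    refine orderOf_eq_prime ?_ hg
    rw [← hcard, pow_card_eq_one']
  refine ⟨σ, hle, σ.2, ?_, ?_, ?_, ?_⟩
  · have h1 : ((σ ^ q : S) : S ⧸ U.subgroupOf S) = 1 := by
      rw [QuotientGroup.mk_pow, ← hord, pow_orderOf_eq_one]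
    rwa [QuotientGroup.eq_one_iff, Subgroup.mem_subgroupOf] at h1
  · intro s hs u hu
    have := hn.conj_mem ⟨u, hle hu⟩ (Subgroup.mem_subgroupOf.2 hu) ⟨s, hs⟩⁻¹
    simpa [Subgroup.mem_subgroupOf] using this
  · intro s hs
    obtain ⟨k, hk⟩ := mem_powers_of_prime_card (g' := ((⟨s, hs⟩ : S) : S ⧸ U.subgroupOf S)) hcard hg
    refine ⟨k % q, Nat.mod_lt _ hq.pos, (σ ^ (k % q) : G)⁻¹ * s, ?_, by group⟩
    have hk' : ((σ ^ (k % q) : S) : S ⧸ U.subgroupOf S) = (⟨s, hs⟩ : S) := by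
      rw [QuotientGroup.mk_pow, ← hord, pow_mod_orderOf]
      exact hk
    rw [QuotientGroup.eq, Subgroup.mem_subgroupOf] at hk'
    simpa using hk'
  · intro i hi hiq hmem
    have h1 : ((σ ^ i : S) : S ⧸ U.subgroupOf S) = 1 := by
      rw [QuotientGroup.eq_one_iff, Subgroup.mem_subgroupOf]
      simpa using hmem
    rw [QuotientGroup.mk_pow] at h1
    have := Nat.le_of_dvd hi (orderOf_dvd_of_pow_eq_one h1)
    omega

variable [TopologicalSpace G] [IsTopologicalGroup G] [CompactSpace G] [TotallyDisconnectedSpace G]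
  {M : Type} [AddCommGroup M] [DistribMulAction G M]

/-- Vanishing of `H²` from the vanishing of `H¹` and the surjectivity of norms in cyclic layers of
prime order. -/
theorem HVan.one_of_norm (hM : IsSmooth G M)
    (hH : ∀ U : Subgroup G, IsOpen (U : Set G) → HVan U M 0)
    (hnorm : ∀ (q : ℕ) (U S : Subgroup G) (σ : G), q.Prime → IsOpen (U : Set G) →
      IsOpen (S : Set G) → IsCyclicLayer U S σ q → ∀ a : M, (∀ s ∈ S, s • a = a) →
      ∃ c : M, (∀ u ∈ U, u • c = c) ∧ ∑ i ∈ Finset.range q, σ ^ i • c = a) : HVan G M 1 := by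
  rw [hVan_succ_iff hM 0, hVan_zero_iff]
  intro f hf hd
  obtain ⟨V, hV, hVo, hfV⟩ := hf.exists_normal
  have hf1 : f 1 = 0 := by simpa using hd 1 1
  have hfV' : ∀ v ∈ V, f v = 0 := fun v hv => by rw [← one_mul v, hfV 1 v hv, hf1]
  have : Finite (G ⧸ V) := V.quotient_finite_of_isOpen hVo
  let mk := QuotientGroup.mk' V
  have hmk : Function.Surjective mk := QuotientGroup.mk'_surjective V
  have hopen : ∀ H : Subgroup (G ⧸ V), IsOpen (H.comap mk : Set G) := fun H =>
    Subgroup.isOpen_mono (H₁ := V) (fun v hv => by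
      rw [Subgroup.mem_comap, show mk v = 1 from (QuotientGroup.eq_one_iff v).2 hv]
      exact H.one_mem) hVo
  have tower : ∀ q : ℕ, q.Prime → ∀ n, ∀ H : Subgroup (G ⧸ V), Nat.card H = q ^ n →
      ∃ m, ∀ x ∈ H.comap mk, f x = x • m - m := by
    intro q hq n
    have : Fact q.Prime := ⟨hq⟩
    induction n with
    | zero =>
      intro H hH'
      refine ⟨0, fun x hx => ?_⟩
      rw [pow_zero, Subgroup.card_eq_one] at hH'
      subst hH'
      rw [Subgroup.mem_comap, Subgroup.mem_bot] at hx
      rw [hfV' x ((QuotientGroup.eq_one_iff x).1 hx), smul_zero, sub_zero]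
    | succ n ih =>
      intro H hH'
      obtain ⟨K, hK⟩ := Sylow.exists_subgroup_card_pow_prime (G := H) q (n := n)
        (by rw [hH']; exact pow_dvd_pow _ n.le_succ)
      have hKi : K.index = q := by
        have h1 := K.card_mul_index
        rw [hH', hK, pow_succ] at h1
        exact Nat.eq_of_mul_eq_mul_left (pow_pos hq.pos n) h1
      have hKn : K.Normal := Subgroup.normal_of_index_eq_minFac_card (by
        rw [hKi, hH', Nat.Prime.pow_minFac hq n.succ_ne_zero])
      let ρ := mk.subgroupComap H
      have hρ : Function.Surjective ρ := fun ⟨y, hy⟩ => by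
        obtain ⟨x, rfl⟩ := hmk y
        exact ⟨⟨x, hy⟩, rfl⟩
      have hsub : ((K.map H.subtype).comap mk).subgroupOf (H.comap mk) = K.comap ρ := by
        ext x
        rw [Subgroup.mem_subgroupOf, Subgroup.mem_comap, Subgroup.mem_comap]
        constructor
        · rintro ⟨y, hy, hyx⟩
          rwa [show ρ x = y from Subtype.ext hyx.symm]
        · intro hx
          exact ⟨_, hx, rfl⟩
      obtain ⟨σ, hσ⟩ := IsCyclicLayer.exists_of_index hq
        (U := (K.map H.subtype).comap mk) (S := H.comap mk)
        (Subgroup.comap_mono (Subgroup.map_subtype_le K))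
        (by rw [hsub]; infer_instance)
        (by rw [hsub, Subgroup.index_comap_of_surjective K hρ, hKi])
      refine hσ.exists_shift_eq (hopen _) hM (hH _ (hopen _))
        (hnorm q _ _ σ hq (hopen _) (hopen _) hσ) hd (ih _ ?_)
      rw [Subgroup.card_map_of_injective H.subtype_injective, hK]
  let I : AddSubgroup ℤ :=
    { carrier := {k | ∃ m, ∀ x, k • f x = x • m - m}
      zero_mem' := ⟨0, by simp⟩
      add_mem' := by
        rintro a b ⟨m, hm⟩ ⟨m', hm'⟩
        exact ⟨m + m', fun x => by rw [add_smul, hm, hm', smul_add]; abel⟩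
      neg_mem' := by
        rintro a ⟨m, hm⟩
        exact ⟨-m, fun x => by rw [neg_smul, hm, smul_neg]; abel⟩ }
  have hI : ∀ q : ℕ, q.Prime → ∃ k : ℕ, (k : ℤ) ∈ I ∧ ¬q ∣ k := by
    intro q hq
    have : Fact q.Prime := ⟨hq⟩
    obtain ⟨P⟩ : Nonempty (Sylow q (G ⧸ V)) := inferInstance
    obtain ⟨n, hn⟩ := IsPGroup.iff_card.1 P.2
    obtain ⟨m, hm⟩ := tower q hq n P hn
    have hidx := Subgroup.index_comap_of_surjective (P : Subgroup (G ⧸ V)) hmk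
    have : ((P : Subgroup (G ⧸ V)).comap mk).FiniteIndex :=
      ⟨by rw [hidx]; exact Subgroup.FiniteIndex.index_ne_zero⟩
    obtain ⟨m', hm'⟩ := exists_index_smul_eq hd _ hm
    refine ⟨((P : Subgroup (G ⧸ V)).comap mk).index, ⟨m', fun x => ?_⟩,
      by rw [hidx]; exact P.not_dvd_index⟩
    rw [natCast_zsmul, hm']
  obtain ⟨a, ha⟩ := Int.subgroup_cyclic I
  rw [← AddSubgroup.zmultiples_eq_closure] at ha
  have ha1 : a.natAbs = 1 := by
    by_contra hne
    obtain ⟨q, hq, hqa⟩ := Nat.exists_prime_and_dvd hne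
    obtain ⟨k, hk, hqk⟩ := hI q hq
    rw [ha, Int.mem_zmultiples_iff] at hk
    exact hqk (hqa.trans (Int.natAbs_dvd_natAbs.2 hk))
  have h1 : (1 : ℤ) ∈ I := by
    rw [ha, Int.mem_zmultiples_iff]
    exact Int.natAbs_dvd_natAbs.1 (by rw [ha1]; exact one_dvd _)
  obtain ⟨m, hm⟩ := h1
  exact ⟨m, fun x => by rw [← hm, one_smul]⟩

end Degree2

section UnitsModule

/-- The multiplicative group of a field, written additively. -/
def UnitsMod (Ω : Type) [Field Ω] : Type := Additive Ωˣ

namespace UnitsMod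

variable {Ω : Type} [Field Ω] {G : Type} [Group G] [MulSemiringAction G Ω]

instance : AddCommGroup (UnitsMod Ω) := inferInstanceAs (AddCommGroup (Additive Ωˣ))

/-- The underlying element of the field. -/
def val (a : UnitsMod Ω) : Ω := ((Additive.toMul (a : Additive Ωˣ) : Ωˣ) : Ω)

/-- The element given by a nonzero element of the field. -/
def mk (x : Ω) (hx : x ≠ 0) : UnitsMod Ω := Additive.ofMul (Units.mk0 x hx)

@[simp] theorem val_mk (x : Ω) (hx : x ≠ 0) : (mk x hx).val = x := rfl

theorem val_injective : Function.Injective (val (Ω := Ω)) := fun _ _ h => Units.ext h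

theorem val_ne_zero (a : UnitsMod Ω) : a.val ≠ 0 := Units.ne_zero _

@[simp] theorem val_add (a b : UnitsMod Ω) : (a + b).val = a.val * b.val := rfl

@[simp] theorem val_zero : (0 : UnitsMod Ω).val = 1 := rfl

@[simp] theorem val_nsmul (n : ℕ) (a : UnitsMod Ω) : (n • a).val = a.val ^ n := by
  induction n with
  | zero => simp
  | succ n ih => rw [succ_nsmul, val_add, ih, pow_succ]

@[simp] theorem val_sub (a b : UnitsMod Ω) : (a - b).val = a.val / b.val := by
  rw [eq_div_iff b.val_ne_zero, ← val_add, sub_add_cancel]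

@[simp] theorem val_sum {ι : Type} (s : Finset ι) (f : ι → UnitsMod Ω) :
    (∑ i ∈ s, f i).val = ∏ i ∈ s, (f i).val := by
  classical
  induction s using Finset.induction_on with
  | empty => simp
  | insert i s hi ih => rw [Finset.sum_insert hi, Finset.prod_insert hi, val_add, ih]

instance : DistribMulAction G (UnitsMod Ω) where
  smul g a := mk (g • a.val) ((smul_ne_zero_iff_ne g).2 a.val_ne_zero)
  one_smul a := val_injective (one_smul G a.val)
  mul_smul g h a := val_injective (mul_smul g h a.val)
  smul_zero g := val_injective (smul_one g)
  smul_add g a b := val_injective (smul_mul' g a.val b.val)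

@[simp] theorem val_smul (g : G) (a : UnitsMod Ω) : (g • a).val = g • a.val := rfl

theorem isSmooth [TopologicalSpace G] (hΩ : ∀ x : Ω, IsLocallyConstant fun g : G => g • x) :
    IsSmooth G (UnitsMod Ω) := fun a =>
  IsLocallyConstant.of_comp_injective val_injective (hΩ a.val)

theorem hVan_zero [TopologicalSpace G] [IsTopologicalGroup G] [CompactSpace G]
    [TotallyDisconnectedSpace G] [FaithfulSMul G Ω]
    (hΩ : ∀ x : Ω, IsLocallyConstant fun g : G => g • x) : HVan G (UnitsMod Ω) 0 := by
  rw [hVan_zero_iff]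
  intro f hf hd
  obtain ⟨b, hb, hfb⟩ := exists_eq_smul_div hΩ (hf.comp val) (fun x => (f x).val_ne_zero)
    (fun x y => by simp only [Function.comp_apply]; rw [hd, val_add, val_smul])
  exact ⟨mk b hb, fun x => val_injective (by rw [val_sub, val_smul, val_mk, ← hfb]; rfl)⟩

end UnitsMod

end UnitsModule

section Norm

variable {G : Type} [Group G]

theorem IsCyclicLayer.prod_comp_smul {U S : Subgroup G} {σ : G} {q : ℕ}
    (h : IsCyclicLayer U S σ q) {X N : Type} [MulAction G X] [CommMonoid N] {θ : X}
    (hθ : ∀ u ∈ U, u • θ = θ) (g : X → N) {s : G} (hs : s ∈ S) :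
    ∏ i ∈ Finset.range q, g (s • σ ^ i • θ) = ∏ i ∈ Finset.range q, g (σ ^ i • θ) := by
  have hσ : ∀ g : X → N, ∏ i ∈ Finset.range q, g (σ • σ ^ i • θ) =
      ∏ i ∈ Finset.range q, g (σ ^ i • θ) := by
    intro g
    obtain ⟨k, rfl⟩ := Nat.exists_eq_succ_of_ne_zero (n := q) (by
      rintro rfl
      obtain ⟨i, hi, -⟩ := h.exists_eq 1 S.one_mem
      omega)
    rw [Finset.prod_range_succ, Finset.prod_range_succ', ← mul_smul σ, ← pow_succ',
      h.pow_smul_self hθ, pow_zero, one_smul]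
    simp only [← mul_smul, ← pow_succ']
  obtain ⟨i, -, u, hu, rfl⟩ := h.exists_eq s hs
  have : ∀ j, (σ ^ i * u) • σ ^ j • θ = σ ^ i • σ ^ j • θ := fun j => by
    rw [mul_smul, h.smul_pow_smul hθ j hu]
  simp only [this]
  clear this hs
  induction i with
  | zero => simp
  | succ i ih =>
    rw [← ih, ← hσ fun x => g (σ ^ i • x)]
    simp only [← mul_smul, pow_succ, mul_assoc]

variable {Ω : Type} [Field Ω] [MulSemiringAction G Ω]

/-- Every homogeneous form of positive degree `d` in `d + 1` variables over the field of
`S`-invariants has a nontrivial zero. -/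
def HasInvariantZeros (S : Subgroup G) (Ω : Type) [Field Ω] [MulSemiringAction G Ω] : Prop :=
  ∀ d : ℕ, d ≠ 0 → ∀ p : MvPolynomial (Fin (d + 1)) Ω, p.IsHomogeneous d →
    (∀ s ∈ S, MvPolynomial.map (MulSemiringAction.toRingHom G Ω s) p = p) →
    ∃ x : Fin (d + 1) → Ω, x ≠ 0 ∧ (∀ s ∈ S, ∀ i, s • x i = x i) ∧ MvPolynomial.eval x p = 0

theorem IsCyclicLayer.exists_prod_smul_eq {U S : Subgroup G} {σ : G} {q : ℕ}
    (h : IsCyclicLayer U S σ q) (hq : q.Prime) (hS : HasInvariantZeros S Ω) {θ : Ω}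
    (hθ : ∀ u ∈ U, u • θ = θ) (hσθ : σ • θ ≠ θ) {a : Ω} (ha : ∀ s ∈ S, s • a = a) :
    ∃ c : Ω, (∀ u ∈ U, u • c = c) ∧ ∏ i ∈ Finset.range q, σ ^ i • c = a := by
  let F : Ω → MvPolynomial (Fin (q + 1)) Ω := fun y =>
    ∑ j : Fin q, MvPolynomial.C (y ^ (j : ℕ)) * MvPolynomial.X j.castSucc
  let Φ := ∏ i ∈ Finset.range q, F (σ ^ i • θ) -
    MvPolynomial.C a * MvPolynomial.X (Fin.last q) ^ q
  have hFhom : ∀ y, (F y).IsHomogeneous 1 := fun y =>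
    MvPolynomial.IsHomogeneous.sum _ _ _ fun j _ => MvPolynomial.isHomogeneous_C_mul_X _ _
  have hFmap : ∀ (s : G) y, MvPolynomial.map (MulSemiringAction.toRingHom G Ω s) (F y) =
      F (s • y) := by
    intro s y
    simp [F]
  have hΦhom : Φ.IsHomogeneous q := by
    refine MvPolynomial.IsHomogeneous.sub ?_ ?_
    · have := MvPolynomial.IsHomogeneous.prod (Finset.range q) (fun i => F (σ ^ i • θ))
        (fun _ => 1) fun i _ => hFhom _
      simpa using this
    · have := (MvPolynomial.isHomogeneous_C (Fin (q + 1)) a).mul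
        (MvPolynomial.isHomogeneous_X_pow (R := Ω) (Fin.last q) q)
      simpa using this
  have hΦmap : ∀ s ∈ S, MvPolynomial.map (MulSemiringAction.toRingHom G Ω s) Φ = Φ := by
    intro s hs
    simp only [Φ, map_sub, map_prod, hFmap, map_mul, map_pow, MvPolynomial.map_C,
      MvPolynomial.map_X]
    rw [h.prod_comp_smul hθ F hs]
    congr 3
    exact ha s hs
  obtain ⟨x, hx0, hxS, hx⟩ := hS q hq.ne_zero Φ hΦhom hΦmap
  have hFeval : ∀ y, MvPolynomial.eval x (F y) = ∑ j : Fin q, y ^ (j : ℕ) * x j.castSucc := by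
    intro y
    simp [F]
  have hFsmul : ∀ s ∈ S, ∀ y, s • MvPolynomial.eval x (F y) = MvPolynomial.eval x (F (s • y)) := by
    intro s hs y
    simp only [hFeval, Finset.smul_sum, smul_mul', smul_pow', hxS s hs]
  have hx' : ∏ i ∈ Finset.range q, MvPolynomial.eval x (F (σ ^ i • θ)) =
      a * x (Fin.last q) ^ q := by
    rw [← sub_eq_zero, ← hx]
    simp [Φ]
  have hxl : x (Fin.last q) ≠ 0 := by
    intro hxl
    rw [hxl, zero_pow hq.ne_zero, mul_zero, Finset.prod_eq_zero_iff] at hx'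
    obtain ⟨i, -, hi⟩ := hx'
    have hall : ∀ j : ℕ, MvPolynomial.eval x (F (σ ^ j • θ)) = 0 := by
      intro j
      have := hFsmul (σ ^ j * (σ ^ i)⁻¹)
        (S.mul_mem (S.pow_mem h.mem j) (S.inv_mem (S.pow_mem h.mem i))) (σ ^ i • θ)
      rwa [hi, smul_zero, mul_smul, inv_smul_smul, eq_comm] at this
    have hne : ∀ i j : ℕ, i < j → j < q → σ ^ i • θ ≠ σ ^ j • θ := by
      intro i j hij hjq heq
      obtain ⟨k, rfl⟩ := Nat.exists_eq_add_of_lt hij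
      have h1 : σ ^ (k + 1) • θ = θ := by
        rw [add_assoc, pow_add, mul_smul] at heq
        exact (smul_left_cancel _ heq).symm
      have hp1 : Function.IsPeriodicPt (fun y => σ • y) (k + 1) θ := by
        rw [Function.IsPeriodicPt, smul_iterate]; exact h1
      have hp2 : Function.IsPeriodicPt (fun y => σ • y) q θ := by
        rw [Function.IsPeriodicPt, smul_iterate]; exact h.pow_smul_self hθ
      have h3 := hp1.gcd hp2
      rw [Nat.Coprime.gcd_eq_one ((Nat.coprime_of_lt_prime (by omega) (by omega) hq).symm)] at h3
      exact hσθ h3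
    have hinj : Function.Injective fun k : Fin q => σ ^ (k : ℕ) • θ := by
      intro i j hij
      by_contra hne'
      rcases lt_or_gt_of_ne hne' with hlt | hlt
      · exact hne _ _ hlt j.2 hij
      · exact hne _ _ hlt i.2 hij.symm
    have hz := Matrix.eq_zero_of_forall_index_sum_pow_mul_eq_zero (v := fun j => x j.castSucc) hinj
      (fun j => by rw [← hFeval]; exact hall j)
    refine hx0 (funext fun j => ?_)
    rcases Fin.eq_castSucc_or_eq_last j with ⟨j, rfl⟩ | rfl
    · exact congrFun hz j
    · exact hxl
  have hσS : ∀ i : ℕ, σ ^ i ∈ S := fun i => S.pow_mem h.mem i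
  refine ⟨MvPolynomial.eval x (F θ) / x (Fin.last q), fun u hu => ?_, ?_⟩
  · rw [smul_div₀', hFsmul u (h.le hu), hθ u hu, hxS u (h.le hu)]
  · simp only [smul_div₀', hFsmul _ (hσS _), hxS _ (hσS _)]
    rw [Finset.prod_div_distrib, hx', Finset.prod_const, Finset.card_range,
      mul_div_cancel_right₀ _ (pow_ne_zero _ hxl)]

variable [TopologicalSpace G] [IsTopologicalGroup G] [CompactSpace G] [TotallyDisconnectedSpace G]
  [FaithfulSMul G Ω]

theorem UnitsMod.hVan_one (hΩ : ∀ x : Ω, IsLocallyConstant fun g : G => g • x)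
    (hC : ∀ S : Subgroup G, IsOpen (S : Set G) → HasInvariantZeros S Ω) :
    HVan G (UnitsMod Ω) 1 := by
  refine HVan.one_of_norm (UnitsMod.isSmooth hΩ) (fun U hU => ?_) ?_
  · have : CompactSpace U := isCompact_iff_compactSpace.1
      (Subgroup.isClosed_of_isOpen U hU).isCompact
    exact UnitsMod.hVan_zero (G := U) fun x => (hΩ x).comp_continuous continuous_subtype_val
  · intro q U S σ hq hU hS h a ha
    obtain ⟨θ, hθ, hσθ⟩ := exists_fixed_smul_ne hΩ hU (s := σ) (by
      simpa using h.pow_notMem 1 one_pos hq.one_lt)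
    obtain ⟨c, hc, hca⟩ := h.exists_prod_smul_eq hq (hC S hS) hθ hσθ (a := a.val)
      (fun s hs => by rw [← UnitsMod.val_smul, ha s hs])
    have hc0 : c ≠ 0 := by
      rintro rfl
      refine a.val_ne_zero ?_
      rw [← hca]
      exact Finset.prod_eq_zero (Finset.mem_range.2 hq.pos) (smul_zero _)
    exact ⟨UnitsMod.mk c hc0, fun u hu => UnitsMod.val_injective (hc u hu),
      UnitsMod.val_injective (by simpa using hca)⟩

theorem HasInvariantZeros.trivVan [IsAlgClosed Ω] {ℓ : ℕ} (hℓ : ℓ.Prime)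
    (hΩ : ∀ x : Ω, IsLocallyConstant fun g : G => g • x)
    (hC : ∀ S : Subgroup G, IsOpen (S : Set G) → HasInvariantZeros S Ω) {ζ : Ω}
    (hζ : IsPrimitiveRoot ζ ℓ) (hGζ : ∀ g : G, g • ζ = ζ) : TrivVan G ℓ := by
  intro A _ _ hA hcard
  have : Fact ℓ.Prime := ⟨hℓ⟩
  have hcyc : IsAddCyclic A := isAddCyclic_of_prime_card hcard
  have hζ' : IsPrimitiveRoot (Units.mk0 ζ (hζ.ne_zero hℓ.ne_zero)) ℓ :=
    IsPrimitiveRoot.coe_units_iff.1 hζ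
  let e₁ : A ≃+ ZMod ℓ := (hcard ▸ zmodAddCyclicAddEquiv hcyc).symm
  let e := e₁.trans hζ'.zmodEquivZPowers
  let i : A →+ UnitsMod Ω :=
    (MonoidHom.toAdditive (Subgroup.zpowers (Units.mk0 ζ (hζ.ne_zero hℓ.ne_zero))).subtype).comp
      e.toAddMonoidHom
  have hi : Function.Injective i := fun a b hab => e.injective (Subtype.ext hab)
  have hirange : ∀ b : UnitsMod Ω, (∃ a, i a = b) ↔ ∃ k : ℕ, b.val = ζ ^ k := by
    intro b
    constructor
    · rintro ⟨a, rfl⟩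
      obtain ⟨k, hk⟩ := hζ'.isOfFinOrder hℓ.ne_zero |>.mem_powers_iff_mem_zpowers.2
        (Additive.toMul (e a)).2
      exact ⟨k, (congrArg Units.val hk).symm⟩
    · rintro ⟨k, hk⟩
      refine ⟨e.symm (Additive.ofMul ⟨Units.mk0 ζ (hζ.ne_zero hℓ.ne_zero) ^ k,
        Subgroup.pow_mem _ (Subgroup.mem_zpowers _) k⟩), UnitsMod.val_injective ?_⟩
      rw [hk]
      show ((Additive.toMul (e (e.symm _)) : Subgroup.zpowers _) : Ωˣ).val = _
      rw [e.apply_symm_apply]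
      rfl
  let p : UnitsMod Ω →+ UnitsMod Ω := nsmulAddMonoidHom ℓ
  have hp : ∀ b, (p b).val = b.val ^ ℓ := fun b => UnitsMod.val_nsmul ℓ b
  refine HVan.left (i := i) (p := p) (fun g a => ?_) (fun g b => ?_) hi ?_ (fun b => ?_)
    (UnitsMod.isSmooth hΩ) (UnitsMod.hVan_zero hΩ) (UnitsMod.hVan_one hΩ hC)
  · obtain ⟨k, hk⟩ := (hirange (i a)).1 ⟨a, rfl⟩
    rw [hA]
    exact UnitsMod.val_injective (by rw [UnitsMod.val_smul, hk, smul_pow', hGζ])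
  · exact UnitsMod.val_injective (by simp [hp, smul_pow'])
  · intro b
    obtain ⟨z, hz⟩ := IsAlgClosed.exists_pow_nat_eq b.val hℓ.pos
    have hz0 : z ≠ 0 := by
      rintro rfl
      rw [zero_pow hℓ.ne_zero] at hz
      exact b.val_ne_zero hz.symm
    exact ⟨UnitsMod.mk z hz0, UnitsMod.val_injective (by rw [hp, UnitsMod.val_mk, hz])⟩
  · rw [hirange]
    constructor
    · intro hb
      have : NeZero ℓ := ⟨hℓ.ne_zero⟩
      have h1 : b.val ^ ℓ = 1 := by rw [← hp, hb, UnitsMod.val_zero]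
      obtain ⟨k, -, hk⟩ := hζ.eq_pow_of_pow_eq_one h1
      exact ⟨k, hk.symm⟩
    · rintro ⟨k, hk⟩
      refine UnitsMod.val_injective ?_
      rw [hp, hk, UnitsMod.val_zero, ← pow_mul, mul_comm, pow_mul, hζ.pow_eq_one, one_pow]

/-- Vanishing of `H²` with `ℓ`-primary coefficients. -/
theorem HVan.one_of_hasInvariantZeros [IsAlgClosed Ω] {ℓ : ℕ} (hℓ : ℓ.Prime)
    (hΩ : ∀ x : Ω, IsLocallyConstant fun g : G => g • x)
    (hC : ∀ S : Subgroup G, IsOpen (S : Set G) → HasInvariantZeros S Ω) {ζ : Ω}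
    (hζ : IsPrimitiveRoot ζ ℓ) (hGζ : ∀ g : G, g • ζ = ζ) {M : Type} [AddCommGroup M]
    [DistribMulAction G M] (hM : IsSmooth G M) (hprim : ∀ x : M, ∃ k : ℕ, ℓ ^ k • x = 0) :
    HVan G M 1 := by
  refine HVan.one_of_trivVan hℓ (fun S hS => ?_) hM hprim
  have : CompactSpace S := isCompact_iff_compactSpace.1 (Subgroup.isClosed_of_isOpen S hS).isCompact
  refine HasInvariantZeros.trivVan (Ω := Ω) hℓ
    (fun x => (hΩ x).comp_continuous continuous_subtype_val) (fun T hT d hd p hp hpT => ?_) hζ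
    fun g => hGζ g
  have hT' : IsOpen (T.map S.subtype : Set G) := by
    rw [Subgroup.coe_map]
    exact hS.isOpenMap_subtype_val _ hT
  obtain ⟨x, hx0, hx, hxp⟩ := hC _ hT' d hd p hp (by
    rintro _ ⟨s, hs, rfl⟩
    exact hpT s hs)
  exact ⟨x, hx0, fun s hs => hx s ⟨s, hs, rfl⟩, hxp⟩

end Norm

section Kummer

open Polynomial

variable {C Ω : Type} [Field C] [Field Ω] [Algebra C Ω]

theorem aeval_X_sub_C (t : Ω) (a : C) : aeval t (X - Polynomial.C a : C[X]) = t - algebraMap C Ω a := by simp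

/-- If a product of powers of distinct `t - a i` is an `ℓ`-th power of an element which is rational
up to prime-to-`ℓ` powers, then the exponents are divisible by `ℓ`. -/
theorem dvd_exponent_of_pow_eq_prod {t : Ω} (ht : Transcendental C t) {ι : Type} [Fintype ι]
    {a : ι → C} (ha : Function.Injective a) (φ : ι → ℕ) {ℓ r : ℕ} (hr : r.Coprime ℓ) {y : Ω}
    (hy : y ^ ℓ = ∏ i, (t - algebraMap C Ω (a i)) ^ φ i) {f g : C[X]} (hg : aeval t g ≠ 0)
    (hfg : y ^ r * aeval t g = aeval t f) (i : ι) : ℓ ∣ φ i := by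
  classical
  have hinj : Function.Injective (aeval (R := C) t) := transcendental_iff_injective.1 ht
  have hpoly : f ^ ℓ = (∏ i, (X - Polynomial.C (a i)) ^ φ i) ^ r * g ^ ℓ := by
    refine hinj ?_
    rw [map_pow, ← hfg, mul_pow, ← pow_mul, mul_comm r, pow_mul, hy]
    simp only [map_mul, map_pow, map_prod, aeval_X_sub_C]
  rw [← Finset.mul_prod_erase _ _ (Finset.mem_univ i), mul_pow, ← pow_mul] at hpoly
  have h0 : ∏ j ∈ Finset.univ.erase i, (X - Polynomial.C (a j)) ^ φ j ≠ 0 :=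
    Finset.prod_ne_zero_iff.2 fun j _ => pow_ne_zero _ (X_sub_C_ne_zero _)
  have hroot : (∏ j ∈ Finset.univ.erase i, (X - Polynomial.C (a j)) ^ φ j).roots.count (a i) = 0 := by
    rw [count_roots, rootMultiplicity_eq_zero]
    rw [IsRoot.def, eval_prod, Finset.prod_eq_zero_iff]
    rintro ⟨j, hj, h⟩
    rw [eval_pow, eval_sub, eval_X, eval_C] at h
    exact (Finset.ne_of_mem_erase hj) (ha (sub_eq_zero.1 (eq_zero_of_pow_eq_zero h))).symm
  have hg0 : g ≠ 0 := by
    rintro rfl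
    simp at hg
  have h1 : ((X - Polynomial.C (a i)) ^ (φ i * r) * (∏ j ∈ Finset.univ.erase i, (X - Polynomial.C (a j)) ^ φ j) ^ r) ≠ 0 :=
    mul_ne_zero (pow_ne_zero _ (X_sub_C_ne_zero _)) (pow_ne_zero _ h0)
  have := congrArg (fun p : C[X] => p.roots.count (a i)) hpoly
  simp only [roots_pow, Multiset.count_nsmul, roots_mul (mul_ne_zero h1 (pow_ne_zero ℓ hg0)),
    roots_mul h1, Multiset.count_add, hroot, roots_X_sub_C, Multiset.count_singleton_self] at this
  have h2 : ℓ ∣ φ i * r := by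
    refine (Nat.dvd_add_left (Dvd.intro (g.roots.count (a i)) rfl)).1 ?_
    exact Dvd.intro _ (by simpa using this)
  exact hr.symm.dvd_of_dvd_mul_right h2

variable {G Q : Type} [Group G] [Group Q] [TopologicalSpace G] [IsTopologicalGroup G]
  [MulSemiringAction G Ω] [MulSemiringAction Q C]

/-- `G` acts on `Ω` compatibly with the action of `Q` on `C` and fixing `t`, and the invariants of
the kernel of `G → Q` are rational functions in `t` up to prime-to-`ℓ` powers. -/
structure IsRationalTower (π : G →* Q) (t : Ω) (ℓ : ℕ) (C : Type) [Field C] [Algebra C Ω]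
    [MulSemiringAction Q C] : Prop where
  isLocallyConstant : ∀ x : Ω, IsLocallyConstant fun g : G => g • x
  smul_algebraMap : ∀ (g : G) (x : C), g • algebraMap C Ω x = algebraMap C Ω (π g • x)
  smul_eq : ∀ g : G, g • t = t
  transcendental : Transcendental C t
  isClosed_ker : IsClosed (π.ker : Set G)
  exists_pow : ∀ y : Ω, (∀ n, π n = 1 → n • y = y) →
    ∃ r : ℕ, r.Coprime ℓ ∧ ∃ f g : C[X], aeval t g ≠ 0 ∧ y ^ r * aeval t g = aeval t f

namespace IsRationalTower

variable {π : G →* Q} {t : Ω} {ℓ : ℕ} [Fact ℓ.Prime]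

theorem smul_eq_of_ker (h : IsRationalTower π t ℓ C) {n : G} (hn : π n = 1) (x : C) :
    n • algebraMap C Ω x = algebraMap C Ω x := by
  rw [h.smul_algebraMap, hn, one_smul]

theorem sub_ne_zero (h : IsRationalTower π t ℓ C) (a : C) : t - algebraMap C Ω a ≠ 0 := by
  intro h0
  rw [sub_eq_zero] at h0
  exact h.transcendental (h0 ▸ isAlgebraic_algebraMap a)

/-- The additive character of `ℤ/ℓ` attached to a root of unity. -/
noncomputable abbrev chr {z : C} (hz : IsPrimitiveRoot z ℓ) : AddChar (ZMod ℓ) C :=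
  AddChar.zmodChar ℓ hz.pow_eq_one

theorem chr_injective {z : C} (hz : IsPrimitiveRoot z ℓ) : Function.Injective (chr hz) := by
  intro x y hxy
  rw [AddChar.zmodChar_apply, AddChar.zmodChar_apply] at hxy
  exact ZMod.val_injective ℓ (hz.pow_inj (ZMod.val_lt x) (ZMod.val_lt y) hxy)

theorem chr_mul {z : C} (hz : IsPrimitiveRoot z ℓ) (x y : ZMod ℓ) :
    chr hz (x * y) = chr hz x ^ y.val := by
  rw [← AddChar.map_nsmul_eq_pow, nsmul_eq_mul, ZMod.natCast_zmod_val, mul_comm]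

theorem chr_sum {z : C} (hz : IsPrimitiveRoot z ℓ) {ι : Type} (s : Finset ι) (f : ι → ZMod ℓ) :
    chr hz (∑ i ∈ s, f i) = ∏ i ∈ s, chr hz (f i) := by
  classical
  induction s using Finset.induction_on with
  | empty => simp
  | insert i s hi ih =>
    rw [Finset.sum_insert hi, Finset.prod_insert hi, AddChar.map_add_eq_mul, ih]

theorem exists_chr_mul_eq {z : C} (hz : IsPrimitiveRoot z ℓ) {x y : Ω} (hy : y ≠ 0)
    (hxy : x ^ ℓ = y ^ ℓ) : ∃ k, x = algebraMap C Ω (chr hz k) * y := by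
  have hz' : IsPrimitiveRoot (algebraMap C Ω z) ℓ := hz.map_of_injective (algebraMap C Ω).injective
  have h1 : (x / y) ^ ℓ = 1 := by rw [div_pow, hxy, div_self (pow_ne_zero _ hy)]
  have : NeZero ℓ := ⟨(Fact.out : ℓ.Prime).ne_zero⟩
  obtain ⟨i, -, hi⟩ := hz'.eq_pow_of_pow_eq_one h1
  exact ⟨i, by rw [AddChar.zmodChar_apply', map_pow, hi, div_mul_cancel₀ _ hy]⟩

theorem chr_ne_zero {z : C} (hz : IsPrimitiveRoot z ℓ) (k : ZMod ℓ) :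
    algebraMap C Ω (chr hz k) ≠ 0 := by
  rw [Ne, map_eq_zero, AddChar.zmodChar_apply]
  exact pow_ne_zero _ (hz.ne_zero (Fact.out : ℓ.Prime).ne_zero)

open Classical in
theorem exists_smul_root_finset (h : IsRationalTower π t ℓ C) {z : C} (hz : IsPrimitiveRoot z ℓ)
    {α : C → Ω} (hα : ∀ a, α a ^ ℓ = t - algebraMap C Ω a) (s : Finset C) (b : s) :
    ∃ n, π n = 1 ∧ ∀ a : s, n • α a = algebraMap C Ω (chr hz ((Pi.single b 1 : s → ZMod ℓ) a)) * α a := by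
  have hℓ : ℓ.Prime := Fact.out
  have hα0 : ∀ a, α a ≠ 0 := fun a h0 => by
    have := hα a
    rw [h0, zero_pow hℓ.ne_zero] at this
    exact h.sub_ne_zero a this.symm
  let W : AddSubgroup (s → ZMod ℓ) :=
    { carrier := {v | ∃ n, π n = 1 ∧ ∀ a : s, n • α a = algebraMap C Ω (chr hz (v a)) * α a}
      zero_mem' := ⟨1, map_one π, fun a => by simp⟩
      add_mem' := by
        rintro v w ⟨n, hn, hv⟩ ⟨m, hm, hw⟩
        refine ⟨n * m, by rw [map_mul, hn, hm, one_mul], fun a => ?_⟩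
        rw [mul_smul, hw, smul_mul', hv, h.smul_eq_of_ker hn, Pi.add_apply, AddChar.map_add_eq_mul,
          map_mul]
        ring
      neg_mem' := by
        rintro v ⟨n, hn, hv⟩
        have hn' : π n⁻¹ = 1 := by rw [map_inv, hn, inv_one]
        refine ⟨n⁻¹, hn', fun a => ?_⟩
        rw [inv_smul_eq_iff, smul_mul', hv, h.smul_eq_of_ker hn, ← mul_assoc, ← map_mul,
          ← AddChar.map_add_eq_mul, Pi.neg_apply, neg_add_cancel, AddChar.map_zero_eq_one,
          map_one, one_mul] }
  by_contra hcon
  have hnot : (Pi.single b 1 : s → ZMod ℓ) ∉ AddSubgroup.toZModSubmodule ℓ W := hcon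
  obtain ⟨f, hfb, hfW⟩ := Submodule.exists_le_ker_of_notMem hnot
  let φ : s → ZMod ℓ := fun a => f (Pi.single a 1)
  have hf : ∀ v, f v = ∑ a, v a * φ a := fun v => by
    rw [LinearMap.pi_apply_eq_sum_univ]
    refine Finset.sum_congr rfl fun a _ => ?_
    rw [smul_eq_mul]
    congr 2
    funext j
    simp [Pi.single_apply, eq_comm]
  let y : Ω := ∏ a : s, α a ^ (φ a).val
  have hy : ∀ n, π n = 1 → n • y = y := by
    intro n hn
    have : ∀ a : s, ∃ k, n • α a = algebraMap C Ω (chr hz k) * α a := fun a =>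
      exists_chr_mul_eq hz (hα0 a) (by
        rw [← smul_pow', hα, smul_sub, h.smul_eq, h.smul_eq_of_ker hn])
    choose v hv using this
    have hfv : f v = 0 := hfW (show v ∈ W from ⟨n, hn, hv⟩)
    simp only [y, Finset.smul_prod', smul_pow', hv, mul_pow, Finset.prod_mul_distrib,
      ← map_pow, ← chr_mul]
    rw [← map_prod, ← chr_sum, ← hf, hfv, AddChar.map_zero_eq_one, map_one, one_mul]
  obtain ⟨r, hr, p, g, hg, hpg⟩ := h.exists_pow y hy
  have hd := dvd_exponent_of_pow_eq_prod h.transcendental (a := fun a : s => (a : C))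
    Subtype.val_injective (fun a => (φ a).val) hr (y := y) (by
      simp only [y, ← Finset.prod_pow, ← hα, ← pow_mul, mul_comm ℓ]) hg hpg b
  refine hfb ?_
  rw [← ZMod.natCast_zmod_val (f (Pi.single b 1)), ZMod.natCast_eq_zero_iff]
  exact hd

variable [CompactSpace G]

theorem exists_smul_root (h : IsRationalTower π t ℓ C) {z : C} (hz : IsPrimitiveRoot z ℓ)
    {α : C → Ω} (hα : ∀ a, α a ^ ℓ = t - algebraMap C Ω a) :
    ∃ n, π n = 1 ∧ n • α 0 = algebraMap C Ω z * α 0 ∧ ∀ a, a ≠ 0 → n • α a = α a := by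
  classical
  have hℓ : ℓ.Prime := Fact.out
  let Z : C → Set G := fun a => (π.ker : Set G) ∩
    {g | g • α a = algebraMap C Ω (chr hz (if a = 0 then 1 else 0)) * α a}
  have hne : (⋂ a, Z a).Nonempty := by
    refine CompactSpace.iInter_nonempty (fun a => h.isClosed_ker.inter
      ((h.isLocallyConstant (α a)).isClosed_fiber _)) fun s => ?_
    obtain ⟨n, hn, hna⟩ := h.exists_smul_root_finset hz hα (insert 0 s)
      ⟨0, Finset.mem_insert_self _ _⟩
    refine ⟨n, Set.mem_iInter₂.2 fun a ha => ⟨hn, ?_⟩⟩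
    have := hna ⟨a, Finset.mem_insert_of_mem ha⟩
    simp only [Pi.single_apply, Subtype.mk.injEq] at this
    exact this
  obtain ⟨n, hn⟩ := hne
  rw [Set.mem_iInter] at hn
  refine ⟨n, (hn 0).1, ?_, fun a ha => ?_⟩
  · have := (hn 0).2
    rw [Set.mem_ofPred_eq, if_pos rfl, AddChar.zmodChar_apply, ZMod.val_one, pow_one] at this
    exact this
  · have := (hn a).2
    rw [Set.mem_ofPred_eq, if_neg ha, AddChar.map_zero_eq_one, map_one, one_mul] at this
    exact this

/-- The elements of `Ω` on which the elements of the kernel fixing all `α a`, `a ≠ 0`, act through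
their action on `α 0`. -/
def IsRamifiedAtZero (π : G →* Q) (α : C → Ω) (A : Ω) : Prop :=
  A ≠ 0 ∧ ∃ m : ℤ, ∀ n, π n = 1 → (∀ a, a ≠ 0 → n • α a = α a) →
    n • A = (n • α 0 / α 0) ^ m * A

theorem IsRamifiedAtZero.mul {α : C → Ω} (hα0 : ∀ a, α a ≠ 0) {A B : Ω}
    (hA : IsRamifiedAtZero π α A) (hB : IsRamifiedAtZero π α B) :
    IsRamifiedAtZero π α (A * B) := by
  obtain ⟨hA0, m, hm⟩ := hA
  obtain ⟨hB0, k, hk⟩ := hB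
  refine ⟨mul_ne_zero hA0 hB0, m + k, fun n hn hna => ?_⟩
  rw [smul_mul', hm n hn hna, hk n hn hna,
    zpow_add₀ (div_ne_zero ((smul_ne_zero_iff_ne n).2 (hα0 0)) (hα0 0))]
  ring

theorem IsRamifiedAtZero.inv {α : C → Ω} {A : Ω} (hA : IsRamifiedAtZero π α A) :
    IsRamifiedAtZero π α A⁻¹ := by
  obtain ⟨hA0, m, hm⟩ := hA
  refine ⟨inv_ne_zero hA0, -m, fun n hn hna => ?_⟩
  rw [smul_inv₀', hm n hn hna, mul_inv, zpow_neg]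

theorem isRamifiedAtZero_algebraMap (h : IsRationalTower π t ℓ C) {α : C → Ω} {x : C}
    (hx : x ≠ 0) : IsRamifiedAtZero π α (algebraMap C Ω x) :=
  ⟨by rwa [Ne, map_eq_zero], 0, fun n hn _ => by rw [h.smul_eq_of_ker hn, zpow_zero, one_mul]⟩

theorem isRamifiedAtZero_root {α : C → Ω} (hα0 : ∀ a, α a ≠ 0) (a : C) :
    IsRamifiedAtZero π α (α a) := by
  by_cases ha : a = 0
  · subst ha
    exact ⟨hα0 0, 1, fun n _ _ => by rw [zpow_one, div_mul_cancel₀ _ (hα0 0)]⟩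
  · exact ⟨hα0 a, 0, fun n _ hna => by rw [hna a ha, zpow_zero, one_mul]⟩

theorem exists_isRamifiedAtZero_pow_eq [IsAlgClosed C] (h : IsRationalTower π t ℓ C) {α : C → Ω}
    (hα : ∀ a, α a ^ ℓ = t - algebraMap C Ω a) (hα0 : ∀ a, α a ≠ 0) {f : C[X]} (hf : f ≠ 0) :
    ∃ A, IsRamifiedAtZero π α A ∧ A ^ ℓ = aeval t f := by
  have hℓ : ℓ.Prime := Fact.out
  have hroots : ∀ s : Multiset C, ∃ A, IsRamifiedAtZero π α A ∧
      A ^ ℓ = aeval t ((s.map fun x => X - Polynomial.C x).prod) := by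
    intro s
    induction s using Multiset.induction_on with
    | empty => exact ⟨algebraMap C Ω 1, h.isRamifiedAtZero_algebraMap one_ne_zero, by simp⟩
    | cons a s ih =>
      obtain ⟨A, hA, hAs⟩ := ih
      refine ⟨α a * A, (isRamifiedAtZero_root hα0 a).mul hα0 hA, ?_⟩
      rw [Multiset.map_cons, Multiset.prod_cons, map_mul, mul_pow, hAs, hα, aeval_X_sub_C]
  obtain ⟨A, hA, hAf⟩ := hroots f.roots
  obtain ⟨c, hc⟩ := IsAlgClosed.exists_pow_nat_eq f.leadingCoeff hℓ.pos
  have hc0 : c ≠ 0 := by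
    rintro rfl
    rw [zero_pow hℓ.ne_zero] at hc
    exact hf (leadingCoeff_eq_zero.1 hc.symm)
  refine ⟨algebraMap C Ω c * A, (h.isRamifiedAtZero_algebraMap hc0).mul hα0 hA, ?_⟩
  rw [mul_pow, hAf, ← map_pow, hc]
  conv_rhs => rw [(IsAlgClosed.splits f).eq_prod_roots]
  rw [map_mul, aeval_C]

theorem isRamifiedAtZero_of_pow [IsAlgClosed C] (h : IsRationalTower π t ℓ C) {z : C}
    (hz : IsPrimitiveRoot z ℓ) {α : C → Ω} (hα : ∀ a, α a ^ ℓ = t - algebraMap C Ω a)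
    (hα0 : ∀ a, α a ≠ 0) {b : Ω} (hb : b ≠ 0) {f g : C[X]} (hg : aeval t g ≠ 0)
    (hfg : b ^ ℓ * aeval t g = aeval t f) : IsRamifiedAtZero π α b := by
  have hg0 : g ≠ 0 := by rintro rfl; simp at hg
  have hf0 : f ≠ 0 := by
    rintro rfl
    rw [map_zero] at hfg
    exact mul_ne_zero (pow_ne_zero _ hb) hg hfg
  obtain ⟨A, hA, hAf⟩ := h.exists_isRamifiedAtZero_pow_eq hα hα0 hf0
  obtain ⟨B, hB, hBg⟩ := h.exists_isRamifiedAtZero_pow_eq hα hα0 hg0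
  obtain ⟨k, hk⟩ := exists_chr_mul_eq hz (x := b) (y := A * B⁻¹)
    (mul_ne_zero hA.1 (inv_ne_zero hB.1)) (by
      rw [mul_pow, inv_pow, hAf, hBg, ← hfg, mul_inv_cancel_right₀ hg])
  rw [hk]
  refine (h.isRamifiedAtZero_algebraMap ?_).mul hα0 (hA.mul hα0 hB.inv)
  exact fun h0 => chr_ne_zero (Ω := Ω) hz k (by rw [h0, map_zero])

end IsRationalTower

end Kummer

section Dimension

open Polynomial

namespace IsRationalTower

variable {C Ω : Type} [Field C] [Field Ω] [Algebra C Ω]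
  {G Q : Type} [Group G] [Group Q] [TopologicalSpace G] [IsTopologicalGroup G]
  [MulSemiringAction G Ω] [MulSemiringAction Q C] [CompactSpace G] [TotallyDisconnectedSpace G]
  [FaithfulSMul G Ω] [IsAlgClosed C] [IsAlgClosed Ω] [TopologicalSpace Q] [IsTopologicalGroup Q]
  [CompactSpace Q] [TotallyDisconnectedSpace Q] [T1Space Q]
  {π : G →* Q} {t : Ω} {ℓ : ℕ} [Fact ℓ.Prime]

/-- A continuous homomorphism from the kernel to `ℤ/ℓ` is determined on elements fixing all
`α a`, `a ≠ 0`, by their action on `α 0`. -/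
theorem exists_pow_eq_zpow (h : IsRationalTower π t ℓ C) {z : C} (hz : IsPrimitiveRoot z ℓ)
    {α : C → Ω} (hα : ∀ a, α a ^ ℓ = t - algebraMap C Ω a) (hα0 : ∀ a, α a ≠ 0) {f : G → ZMod ℓ}
    (hf : IsLocallyConstant fun n : π.ker => f n)
    (hfm : ∀ x y, π x = 1 → π y = 1 → f (x * y) = f x + f y) :
    ∃ r : ℕ, r.Coprime ℓ ∧ ∃ m : ℤ, ∀ n, π n = 1 → (∀ a, a ≠ 0 → n • α a = α a) →
      algebraMap C Ω (chr hz (r * f n)) = (n • α 0 / α 0) ^ m := by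
  have : CompactSpace π.ker := isCompact_iff_compactSpace.1 h.isClosed_ker.isCompact
  obtain ⟨b, hb0, hb⟩ := exists_eq_smul_div (G := π.ker) (Ω := Ω)
    (f := fun n => algebraMap C Ω (chr hz (f n)))
    (fun x => (h.isLocallyConstant x).comp_continuous continuous_subtype_val)
    (hf.comp fun x => algebraMap C Ω (chr hz x)) (fun n => chr_ne_zero hz _) (fun x y => by
      rw [Subgroup.coe_mul, hfm _ _ x.2 y.2, AddChar.map_add_eq_mul, map_mul]
      congr 1
      exact (h.smul_eq_of_ker x.2 _).symm)
  have hb' : ∀ n, π n = 1 → n • b = algebraMap C Ω (chr hz (f n)) * b := fun n hn => by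
    rw [hb ⟨n, hn⟩, div_mul_cancel₀ _ hb0]
    rfl
  obtain ⟨r, hr, p, g, hg, hpg⟩ := h.exists_pow (b ^ ℓ) (fun n hn => by
    rw [smul_pow', hb' n hn, mul_pow, ← map_pow, ← AddChar.map_nsmul_eq_pow,
      nsmul_eq_mul, CharP.cast_eq_zero, zero_mul, AddChar.map_zero_eq_one, map_one, one_mul])
  obtain ⟨-, m, hm⟩ := h.isRamifiedAtZero_of_pow hz hα hα0 (pow_ne_zero r hb0) hg
    (f := p) (by rw [← hpg, ← pow_mul, ← pow_mul, mul_comm r])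
  refine ⟨r, hr, m, fun n hn hna => ?_⟩
  have h1 := hm n hn hna
  rw [smul_pow', hb' n hn, mul_pow] at h1
  rw [← nsmul_eq_mul, AddChar.map_nsmul_eq_pow, map_pow]
  exact mul_right_cancel₀ (pow_ne_zero r hb0) h1

theorem contCohomDim_eq (h : IsRationalTower π t ℓ C) {z : C} (hz : IsPrimitiveRoot z ℓ)
    (hπ : Function.Surjective π) (hq : Topology.IsQuotientMap π)
    (hC : ∀ S : Subgroup π.ker, IsOpen (S : Set π.ker) → HasInvariantZeros S Ω) :
    contCohomDim G ℓ = contCohomDim Q ℓ + 1 := by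
  have hℓ : ℓ.Prime := Fact.out
  have hinj := (algebraMap C Ω).injective
  have hz' : IsPrimitiveRoot (algebraMap C Ω z) ℓ := hz.map_of_injective hinj
  have : CompactSpace π.ker := isCompact_iff_compactSpace.1 h.isClosed_ker.isCompact
  have hN : ∀ (M : Type) [AddCommGroup M] [DistribMulAction G M], IsSmooth G M →
      (∀ x : M, ∃ k, ℓ ^ k • x = 0) → HVan π.ker M 1 := fun M _ _ hM hprim =>
    HVan.one_of_hasInvariantZeros (G := π.ker) (Ω := Ω) hℓ
      (fun x => (h.isLocallyConstant x).comp_continuous continuous_subtype_val) hC hz'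
      (fun n => h.smul_eq_of_ker n.2 z) (hM.subgroup _) hprim
  choose α hα using fun a => IsAlgClosed.exists_pow_nat_eq (t - algebraMap C Ω a) hℓ.pos
  have hα0 : ∀ a, α a ≠ 0 := fun a h0 => by
    have := hα a
    rw [h0, zero_pow hℓ.ne_zero] at this
    exact h.sub_ne_zero a this.symm
  have hX : ∀ g : G, ∃ k, g • algebraMap C Ω z = algebraMap C Ω (chr hz k) := fun g => by
    obtain ⟨k, hk⟩ := exists_chr_mul_eq hz (x := g • algebraMap C Ω z) (y := 1) one_ne_zero
      (by rw [← smul_pow', hz'.pow_eq_one, smul_one, one_pow])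
    exact ⟨k, by rw [hk, mul_one]⟩
  choose X hX using hX
  have hXs : ∀ g k, g • algebraMap C Ω (chr hz k) = algebraMap C Ω (chr hz (X g * k)) := by
    intro g k
    rw [chr_mul, map_pow, ← hX, ← smul_pow', ← map_pow, AddChar.zmodChar_apply]
  have hchr1 : chr hz 1 = z := by rw [AddChar.zmodChar_apply, ZMod.val_one, pow_one]
  have hchr : ∀ x y, algebraMap C Ω (chr hz x) = algebraMap C Ω (chr hz y) → x = y := fun x y hxy =>
    chr_injective hz (hinj hxy)
  let X' : G →* ZMod ℓ :=
    { toFun := X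
      map_one' := hchr _ _ (by rw [← hX, one_smul, hchr1])
      map_mul' := fun g g' => hchr _ _ (by rw [← hX, mul_smul, hX g', hXs]) }
  let χ : G →* (ZMod ℓ)ˣ := X'.toHomUnits
  have hχ : ∀ g, (χ g : ZMod ℓ) = X g := fun g => rfl
  have hc : ∀ g : G, ∃ k, g • α 0 = algebraMap C Ω (chr hz k) * α 0 := fun g =>
    exists_chr_mul_eq hz (hα0 0) (by
      rw [← smul_pow', hα, smul_sub, h.smul_eq, map_zero, smul_zero])
  choose c hc using hc
  have hXl : IsLocallyConstant X := IsLocallyConstant.of_comp_injective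
    (i := fun x => algebraMap C Ω (chr hz x)) (fun x y hxy => hchr x y hxy) (by
      simp only [← hX]
      exact h.isLocallyConstant _)
  have hχl : IsLocallyConstant χ := IsLocallyConstant.of_comp_injective Units.val_injective hXl
  have hcl : IsLocallyConstant c := IsLocallyConstant.of_comp_injective
    (i := fun x => algebraMap C Ω (chr hz x) * α 0)
    (fun x y hxy => hchr x y (mul_right_cancel₀ (hα0 0) hxy)) (by
      simp only [← hc]
      exact h.isLocallyConstant _)
  have hcc : ∀ x g, c (x * g) = c x + χ x * c g := fun x g => hchr _ _
    (mul_right_cancel₀ (hα0 0) (by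
      rw [← hc, mul_smul, hc g, smul_mul', hXs, hc x, hχ, AddChar.map_add_eq_mul,
        map_mul (algebraMap C Ω)]
      ring))
  have hX1 : ∀ g, π g = 1 → X g = 1 := fun g hg => hchr _ _ (by
    rw [← hX, h.smul_eq_of_ker hg, hchr1])
  have hχ1 : ∀ g, π g = 1 → χ g = 1 := fun g hg => Units.ext (hX1 g hg)
  obtain ⟨τ, hτ, hτ0, hτa⟩ := h.exists_smul_root hz hα
  have hcτ : c τ = 1 := hchr _ _ (mul_right_cancel₀ (hα0 0) (by rw [← hc, hτ0, hchr1]))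
  refine contCohomDim_eq_add_one (not_cdVan_zero hℓ χ hχl c hcl hcc τ (hχ1 τ hτ) hcτ) fun n =>
    ⟨fun hG => CdVan.of_retract hℓ hπ hq hN χ hχl hχ1 c hcl hcc τ hτ hcτ (fun f hf hfm g => ?_) hG,
      fun hQ => CdVan.of_ker hπ hq hN hQ⟩
  obtain ⟨r, hr, m, hm⟩ := h.exists_pow_eq_zpow hz hα hα0 hf hfm
  have hconj : π (g⁻¹ * τ * g) = 1 := by
    rw [map_mul, map_mul, hτ, mul_one, map_inv, inv_mul_cancel]
  have hroot : ∀ a, ∃ k, g • α a = algebraMap C Ω (chr hz k) * α (π g • a) := fun a =>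
    exists_chr_mul_eq hz (hα0 _) (by
      rw [← smul_pow', hα, hα, smul_sub, h.smul_eq, h.smul_algebraMap])
  have h1 := hm τ hτ hτa
  have h2 := hm (g⁻¹ * τ * g) hconj (fun a ha => by
    obtain ⟨k, hk⟩ := hroot a
    rw [mul_smul, mul_smul, inv_smul_eq_iff, hk, smul_mul', h.smul_eq_of_ker hτ,
      hτa _ ((smul_ne_zero_iff_ne _).2 ha)])
  have h3 : g • ((g⁻¹ * τ * g) • α 0 / α 0) = τ • α 0 / α 0 := by
    rw [smul_div₀', ← mul_smul, mul_assoc, mul_inv_cancel_left, mul_smul, hc g, smul_mul',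
      h.smul_eq_of_ker hτ, mul_div_mul_left _ _ (chr_ne_zero hz _)]
  have h4 := congrArg (fun y => g • y) h2
  simp only [hXs] at h4
  rw [show g • ((g⁻¹ * τ * g) • α 0 / α 0) ^ m = (g • ((g⁻¹ * τ * g) • α 0 / α 0)) ^ m from
    map_zpow₀ (MulSemiringAction.toRingHom G Ω g) _ _, h3, ← h1] at h4
  have h5 := hchr _ _ h4
  have hr0 : (r : ZMod ℓ) ≠ 0 := by
    rw [Ne, ZMod.natCast_eq_zero_iff]
    intro hd
    have := Nat.Coprime.eq_one_of_dvd hr.symm hd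
    exact hℓ.one_lt.ne' this
  refine mul_left_cancel₀ hr0 ?_
  rw [hχ, ← h5]
  ring

end IsRationalTower

end Dimension

section Krull

variable {F L : Type} [Field F] [Field L] [Algebra F L]

theorem exists_finset_of_mem_nhds {σ : L ≃ₐ[F] L} {A : Set (L ≃ₐ[F] L)} (hA : A ∈ nhds σ) :
    ∃ s : Finset L, ∀ τ : L ≃ₐ[F] L, (∀ x ∈ s, τ x = σ x) → τ ∈ A := by
  have h1 : (fun τ => σ * τ) ⁻¹' A ∈ nhds (1 : L ≃ₐ[F] L) :=
    (continuous_const_mul σ).continuousAt.preimage_mem_nhds (by rwa [mul_one])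
  obtain ⟨E, hE, hEA⟩ := (krullTopology_mem_nhds_one_iff F L _).1 h1
  obtain ⟨s, hs⟩ := IntermediateField.essFiniteType_iff.1 (inferInstance : Algebra.EssFiniteType F E)
  refine ⟨s, fun τ hτ => ?_⟩
  have h2 : σ⁻¹ * τ ∈ E.fixingSubgroup := by
    rw [← Subgroup.zpowers_le, ← IntermediateField.le_iff_le, ← hs,
      IntermediateField.adjoin_le_iff]
    intro x hx
    have h4 : σ⁻¹ * τ ∈ MulAction.stabilizer (L ≃ₐ[F] L) x := by
      rw [MulAction.mem_stabilizer_iff, AlgEquiv.smul_def, AlgEquiv.mul_apply, hτ x hx]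
      exact σ.symm_apply_apply x
    rw [SetLike.mem_coe, IntermediateField.mem_fixedField_iff]
    exact fun g hg => Subgroup.zpowers_le.2 h4 hg
  have h3 := hEA h2
  rwa [Set.mem_preimage, mul_inv_cancel_left] at h3

theorem isLocallyConstant_algEquiv_apply [Algebra.IsAlgebraic F L] (x : L) :
    IsLocallyConstant fun g : L ≃ₐ[F] L => g x := by
  refine (IsLocallyConstant.iff_eventually_eq _).2 fun σ => ?_
  have h1 : (MulAction.stabilizer (L ≃ₐ[F] L) x : Set (L ≃ₐ[F] L)) ∈ nhds (1 : L ≃ₐ[F] L) :=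
    (stabilizer_isOpen_of_isIntegral x).mem_nhds (one_mem _)
  have h2 : Filter.Tendsto (fun τ => σ⁻¹ * τ) (nhds σ) (nhds (1 : L ≃ₐ[F] L)) := by
    have := (continuous_const_mul σ⁻¹).tendsto σ
    rwa [inv_mul_cancel] at this
  filter_upwards [h2 h1] with τ hτ
  have hτ' : (σ⁻¹ * τ) x = x := hτ
  rw [AlgEquiv.mul_apply] at hτ'
  exact (AlgEquiv.symm_apply_eq σ).1 hτ'

theorem compactSpace_algEquiv [Algebra.IsAlgebraic F L] : CompactSpace (L ≃ₐ[F] L) := by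
  refine ⟨isCompact_iff_ultrafilter_le_nhds.2 fun u _ => ?_⟩
  have hu : ∀ x : L, ∃ y : L, ∀ᶠ g in (u : Filter (L ≃ₐ[F] L)), g x = y := by
    intro x
    have hx : IsIntegral F x := (Algebra.IsAlgebraic.isAlgebraic x).isIntegral
    have := (Ultrafilter.eventually_exists_mem_iff (((minpoly F x).rootSet_finite L))
      (f := u) (P := fun y g => g x = y)).1 (Filter.Eventually.of_forall fun g => ⟨g x, ?_, rfl⟩)
    · obtain ⟨y, -, hy⟩ := this
      exact ⟨y, hy⟩
    · rw [Polynomial.mem_rootSet]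
      exact ⟨minpoly.ne_zero hx, by rw [Polynomial.aeval_algHom_apply g, minpoly.aeval, map_zero]⟩
  choose φ hφ using hu
  let Φ : L →ₐ[F] L :=
    { toFun := φ
      map_one' := by
        obtain ⟨g, hg⟩ := (hφ 1).exists
        rw [← hg, map_one]
      map_mul' := fun x y => by
        obtain ⟨g, h1, h2, h3⟩ := ((hφ (x * y)).and ((hφ x).and (hφ y))).exists
        rw [← h1, ← h2, ← h3, map_mul]
      map_zero' := by
        obtain ⟨g, hg⟩ := (hφ 0).exists
        rw [← hg, map_zero]
      map_add' := fun x y => by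
        obtain ⟨g, h1, h2, h3⟩ := ((hφ (x + y)).and ((hφ x).and (hφ y))).exists
        rw [← h1, ← h2, ← h3, map_add]
      commutes' := fun r => by
        obtain ⟨g, hg⟩ := (hφ (algebraMap F L r)).exists
        rw [← hg, AlgEquiv.commutes] }
  refine ⟨AlgEquiv.ofBijective Φ (Algebra.IsAlgebraic.algHom_bijective Φ), Set.mem_univ _,
    fun A hA => ?_⟩
  obtain ⟨s, hs⟩ := exists_finset_of_mem_nhds hA
  have : ∀ᶠ g in (u : Filter (L ≃ₐ[F] L)), ∀ x ∈ s, g x = φ x :=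
    (Filter.eventually_all_finset s).2 fun x _ => hφ x
  exact this.mono fun g hg => hs g hg

theorem continuous_of_isLocallyConstant_apply {X : Type} [TopologicalSpace X] {f : X → L ≃ₐ[F] L}
    (hf : ∀ x, IsLocallyConstant fun g => f g x) : Continuous f := by
  refine continuous_iff_continuousAt.2 fun g A hA => ?_
  obtain ⟨s, hs⟩ := exists_finset_of_mem_nhds hA
  have : ∀ᶠ h in nhds g, ∀ x ∈ s, f h x = f g x :=
    (Filter.eventually_all_finset s).2 fun x _ => (IsLocallyConstant.iff_eventually_eq _).1 (hf x) g
  exact this.mono fun h hh => hs _ hh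

end Krull

section RationalFunctions

open Polynomial

/-- The homomorphism from `C(X)` evaluating rational functions at an element `t` which is
transcendental over the image of `C`. -/
noncomputable def evalHom {C Ω : Type} [Field C] [Field Ω] (θ : C →+* Ω) (t : Ω)
    (ht : Function.Injective (eval₂RingHom θ t)) : RatFunc C →+* Ω :=
  RatFunc.liftRingHom (eval₂RingHom θ t) (nonZeroDivisors_le_comap_nonZeroDivisors_of_injective _ ht)

section EvalHom

variable {C Ω : Type} [Field C] [Field Ω] {θ : C →+* Ω} {t : Ω}
  (ht : Function.Injective (eval₂RingHom θ t))

theorem evalHom_div (p q : C[X]) :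
    evalHom θ t ht (algebraMap _ _ p / algebraMap _ _ q) = p.eval₂ θ t / q.eval₂ θ t :=
  RatFunc.liftRingHom_apply_div _ _ _ _

theorem evalHom_algebraMap (p : C[X]) : evalHom θ t ht (algebraMap _ _ p) = p.eval₂ θ t := by
  have := evalHom_div ht p 1
  rwa [map_one, div_one, eval₂_one, div_one] at this

theorem evalHom_C (a : C) : evalHom θ t ht (algebraMap C[X] _ (Polynomial.C a)) = θ a := by
  rw [evalHom_algebraMap, eval₂_C]

theorem evalHom_X : evalHom θ t ht (algebraMap C[X] _ X) = t := by
  rw [evalHom_algebraMap, eval₂_X]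

theorem exists_evalHom_eq (x : RatFunc C) : ∃ f g : C[X], g.eval₂ θ t ≠ 0 ∧
    evalHom θ t ht x * g.eval₂ θ t = f.eval₂ θ t := by
  have h : x.denom.eval₂ θ t ≠ 0 := fun h0 => x.denom_ne_zero
    (ht (by rw [map_zero]; exact h0))
  refine ⟨x.num, x.denom, h, ?_⟩
  have := evalHom_div ht x.num x.denom
  rw [x.num_div_denom] at this
  rw [this]
  exact div_mul_cancel₀ _ h

theorem injective_eval₂RingHom_of_transcendental [Algebra C Ω] (ht : Transcendental C t) :
    Function.Injective (eval₂RingHom (algebraMap C Ω) t) :=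
  transcendental_iff_injective.1 ht

theorem injective_eval₂RingHom_comp (ht : Function.Injective (eval₂RingHom θ t)) (q : C →+* C) :
    Function.Injective (eval₂RingHom (θ.comp q) t) := by
  intro f g hfg
  refine Polynomial.map_injective q q.injective (ht ?_)
  simpa only [coe_eval₂RingHom, eval₂_map] using hfg

end EvalHom

variable {F k C Ω : Type} [Field F] [Field k] [Field Ω] [Field C] [Algebra F k] [Algebra k Ω]
  [Algebra F Ω] [IsScalarTower F k Ω] {t : k}

theorem mem_of_adjoin_eq_top (hadj : IntermediateField.adjoin F {t} = ⊤) (S : Subfield Ω)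
    (hF : ∀ a : F, algebraMap F Ω a ∈ S) (ht : algebraMap k Ω t ∈ S) (y : k) :
    algebraMap k Ω y ∈ S := by
  let M : IntermediateField F k := (S.comap (algebraMap k Ω)).toIntermediateField fun a => by
    rw [Subfield.mem_comap, ← IsScalarTower.algebraMap_apply]
    exact hF a
  have hM : IntermediateField.adjoin F {t} ≤ M :=
    IntermediateField.adjoin_le_iff.2 (Set.singleton_subset_iff.2 ht)
  rw [hadj] at hM
  exact hM (IntermediateField.mem_top (x := y))

theorem isAlgebraic_of_adjoin_eq_top [Algebra.IsAlgebraic k Ω]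
    (hadj : IntermediateField.adjoin F {t} = ⊤) {R : Type} [Field R] [Algebra R Ω]
    (hF : ∀ a : F, algebraMap F Ω a ∈ (algebraMap R Ω).fieldRange)
    (ht : algebraMap k Ω t ∈ (algebraMap R Ω).fieldRange) : Algebra.IsAlgebraic R Ω := by
  have h := mem_of_adjoin_eq_top hadj _ hF ht
  choose θ hθ using h
  have hinj := (algebraMap R Ω).injective
  let θ' : k →+* R :=
    { toFun := θ
      map_one' := hinj (by rw [hθ, map_one, map_one])
      map_mul' := fun x y => hinj (by rw [hθ, map_mul, map_mul, hθ, hθ])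
      map_zero' := hinj (by rw [hθ, map_zero, map_zero])
      map_add' := fun x y => hinj (by rw [hθ, map_add, map_add, hθ, hθ]) }
  let _ : Algebra k R := θ'.toAlgebra
  have : IsScalarTower k R Ω := IsScalarTower.of_algebraMap_eq fun x => (hθ x).symm
  exact Algebra.IsAlgebraic.tower_top (K := k) R

theorem exists_algEquiv_of_ringEquiv (hadj : IntermediateField.adjoin F {t} = ⊤) (σ : Ω ≃+* Ω)
    (hF : ∀ a : F, σ (algebraMap F Ω a) = algebraMap F Ω a)
    (ht : σ (algebraMap k Ω t) = algebraMap k Ω t) : ∃ g : Ω ≃ₐ[k] Ω, ∀ x, g x = σ x := by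
  have h := mem_of_adjoin_eq_top hadj (RingHom.eqLocusField (σ : Ω →+* Ω) (RingHom.id Ω)) hF ht
  exact ⟨AlgEquiv.ofRingEquiv (f := σ) h, fun x => rfl⟩

theorem exists_ringEquiv_of_isAlgebraic {R Ω Ω' : Type} [Field R] [Field Ω] [Field Ω'] [Algebra R Ω]
    [Algebra R Ω'] [IsAlgClosed Ω] [IsAlgClosed Ω'] [Algebra.IsAlgebraic R Ω]
    [Algebra.IsAlgebraic R Ω'] :
    ∃ σ : Ω ≃+* Ω', ∀ x, σ (algebraMap R Ω x) = algebraMap R Ω' x := by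
  have h : IsAlgClosure R Ω := ⟨inferInstance, inferInstance⟩
  have h' : IsAlgClosure R Ω' := ⟨inferInstance, inferInstance⟩
  exact ⟨(IsAlgClosure.equiv R Ω Ω').toRingEquiv, (IsAlgClosure.equiv R Ω Ω').commutes⟩

/-- An element of an algebraic closure invariant under all automorphisms is purely inseparable. -/
theorem exists_pow_mem_range_of_forall_eq {R : Type} [Field R] [Algebra R Ω] [IsAlgClosed Ω]
    [Algebra.IsAlgebraic R Ω] (q : ℕ) [ExpChar R q] {y : Ω} (hy : ∀ σ : Ω ≃ₐ[R] Ω, σ y = y) :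
    ∃ n : ℕ, y ^ q ^ n ∈ (algebraMap R Ω).range := by
  classical
  have halg : IsAlgebraic R y := Algebra.IsAlgebraic.isAlgebraic y
  have : IsAlgClosure R Ω := ⟨inferInstance, inferInstance⟩
  have : Normal R Ω := IsAlgClosure.normal R Ω
  rw [← minpoly.natSepDegree_eq_one_iff_pow_mem, Polynomial.natSepDegree_eq_of_isAlgClosed (E := Ω),
    Finset.card_eq_one]
  refine ⟨y, Finset.eq_singleton_iff_unique_mem.2 ⟨?_, fun x hx => ?_⟩⟩
  · rw [Multiset.mem_toFinset, mem_aroots]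
    exact ⟨minpoly.ne_zero halg.isIntegral, minpoly.aeval _ _⟩
  · rw [Multiset.mem_toFinset, mem_aroots] at hx
    obtain ⟨σ, hσ⟩ := minpoly.exists_algEquiv_of_root' halg hx.2
    rw [← hσ, hy]

end RationalFunctions

section GeometricTower

open Polynomial

variable {F k C Ω : Type} [Field F] [Field k] [Field Ω] [Field C] [Algebra F k] [Algebra k Ω]
  [Algebra F Ω] [IsScalarTower F k Ω] [Algebra F C] [Algebra C Ω] [IsScalarTower F C Ω] {t : k}

variable (F k C Ω) in
/-- Restriction of automorphisms of `Ω` over `k` to the normal subextension `C` of `F`. -/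
noncomputable def restrictHom [Normal F C] : (Ω ≃ₐ[k] Ω) →* (C ≃ₐ[F] C) :=
  (AlgEquiv.restrictNormalHom C).comp (AlgEquiv.restrictScalarsHom F)

theorem algebraMap_restrictHom [Normal F C] (g : Ω ≃ₐ[k] Ω) (x : C) :
    algebraMap C Ω (restrictHom F k C Ω g x) = g (algebraMap C Ω x) :=
  AlgEquiv.restrictNormal_commutes (g.restrictScalars F) C x

theorem restrictHom_eq [Normal F C] {g : Ω ≃ₐ[k] Ω} {q : C ≃ₐ[F] C}
    (h : ∀ x, g (algebraMap C Ω x) = algebraMap C Ω (q x)) : restrictHom F k C Ω g = q :=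
  AlgEquiv.ext fun x => (algebraMap C Ω).injective (by rw [algebraMap_restrictHom, h])

theorem restrictHom_eq_one_iff [Normal F C] {g : Ω ≃ₐ[k] Ω} :
    restrictHom F k C Ω g = 1 ↔ ∀ x, g (algebraMap C Ω x) = algebraMap C Ω x :=
  ⟨fun h x => by rw [← algebraMap_restrictHom (F := F), h, AlgEquiv.one_apply],
    fun h => restrictHom_eq h⟩

variable [Algebra.IsAlgebraic k Ω]

theorem continuous_restrictHom [Normal F C] : Continuous (restrictHom F k C Ω) :=
  continuous_of_isLocallyConstant_apply fun x =>
    IsLocallyConstant.of_comp_injective (algebraMap C Ω).injective (by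
      simp only [algebraMap_restrictHom]
      exact isLocallyConstant_algEquiv_apply _)

theorem transcendental_algebraMap [Algebra.IsAlgebraic F C] (ht : Transcendental F t) :
    Transcendental C (algebraMap k Ω t) := by
  have h : Transcendental F (algebraMap k Ω t) :=
    (transcendental_algebraMap_iff (algebraMap k Ω).injective).2 ht
  exact h.extendScalars C

variable (hadj : IntermediateField.adjoin F {t} = ⊤)
include hadj

theorem isAlgebraic_evalHom {θ : C →+* Ω} (hθ : Function.Injective (eval₂RingHom θ (algebraMap k Ω t)))
    (hθF : ∀ a : F, algebraMap F Ω a ∈ θ.range) :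
    @Algebra.IsAlgebraic (RatFunc C) Ω _ _ (evalHom θ _ hθ).toAlgebra := by
  let _ : Algebra (RatFunc C) Ω := (evalHom θ _ hθ).toAlgebra
  refine isAlgebraic_of_adjoin_eq_top hadj (fun a => ?_) ⟨_, evalHom_X hθ⟩
  obtain ⟨c, hc⟩ := hθF a
  exact ⟨_, (evalHom_C hθ c).trans hc⟩

theorem surjective_restrictHom [Normal F C] [IsAlgClosed Ω]
    (ht : Transcendental F t) : Function.Surjective (restrictHom F k C Ω) := by
  intro q
  have h1 := injective_eval₂RingHom_of_transcendental
    (transcendental_algebraMap (C := C) (Ω := Ω) ht)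
  have h2 := injective_eval₂RingHom_comp h1 (q : C →+* C)
  have a1 := isAlgebraic_evalHom hadj h1
    fun a => ⟨algebraMap F C a, (IsScalarTower.algebraMap_apply F C Ω a).symm⟩
  have a2 := isAlgebraic_evalHom hadj h2 fun a => ⟨algebraMap F C a, by
    rw [RingHom.comp_apply, RingHom.coe_coe, AlgEquiv.commutes, ← IsScalarTower.algebraMap_apply]⟩
  obtain ⟨σ, hσ⟩ := @exists_ringEquiv_of_isAlgebraic (RatFunc C) Ω Ω _ _ _ (evalHom _ _ h1).toAlgebra
    (evalHom _ _ h2).toAlgebra _ _ a1 a2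
  replace hσ : ∀ x, σ (evalHom _ _ h1 x) = evalHom _ _ h2 x := hσ
  have hσC : ∀ x, σ (algebraMap C Ω x) = algebraMap C Ω (q x) := fun x => by
    have := hσ (algebraMap C[X] _ (Polynomial.C x))
    rwa [evalHom_C, evalHom_C] at this
  obtain ⟨g, hg⟩ := exists_algEquiv_of_ringEquiv hadj σ
    (fun a => by rw [IsScalarTower.algebraMap_apply F C Ω, hσC, AlgEquiv.commutes]) (by
      have := hσ (algebraMap C[X] _ X)
      rwa [evalHom_X, evalHom_X] at this)
  exact ⟨g, restrictHom_eq fun x => by rw [hg, hσC]⟩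

theorem exists_pow_mul_eq_of_forall_ker [Normal F C] [IsAlgClosed Ω]
    (ht : Transcendental F t) (q : ℕ) [ExpChar C q] {y : Ω}
    (hy : ∀ g, restrictHom F k C Ω g = 1 → g y = y) :
    ∃ n : ℕ, ∃ f g : C[X], aeval (algebraMap k Ω t) g ≠ 0 ∧
      y ^ q ^ n * aeval (algebraMap k Ω t) g = aeval (algebraMap k Ω t) f := by
  have h1 := injective_eval₂RingHom_of_transcendental
    (transcendental_algebraMap (C := C) (Ω := Ω) ht)
  let _ : Algebra (RatFunc C) Ω := (evalHom _ _ h1).toAlgebra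
  have a1 : Algebra.IsAlgebraic (RatFunc C) Ω := isAlgebraic_evalHom hadj h1
    fun a => ⟨algebraMap F C a, (IsScalarTower.algebraMap_apply F C Ω a).symm⟩
  have : ExpChar (RatFunc C) q :=
    expChar_of_injective_algebraMap (algebraMap C (RatFunc C)).injective q
  obtain ⟨n, x, hx⟩ := exists_pow_mem_range_of_forall_eq (R := RatFunc C) q (y := y) fun σ => by
    have hσ : ∀ x, σ (evalHom _ _ h1 x) = evalHom _ _ h1 x := σ.commutes
    have hσC : ∀ x, σ (algebraMap C Ω x) = algebraMap C Ω x := fun x => by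
      have := hσ (algebraMap C[X] _ (Polynomial.C x))
      rwa [evalHom_C] at this
    obtain ⟨g, hg⟩ := exists_algEquiv_of_ringEquiv hadj σ.toRingEquiv
      (fun a => by
        rw [IsScalarTower.algebraMap_apply F C Ω]
        exact hσC _) (by
        have := hσ (algebraMap C[X] _ X)
        rwa [evalHom_X] at this)
    have := hy g (restrictHom_eq_one_iff.2 fun x => (hg _).trans (hσC x))
    exact (hg y).symm.trans this
  obtain ⟨f, g, hg, hfg⟩ := exists_evalHom_eq h1 x
  refine ⟨n, f, g, hg, ?_⟩
  rw [← hx]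
  exact hfg

theorem hasInvariantZeros_ker [Normal F C] [IsAlgClosed C]
    (ht : Transcendental F t) (S : Subgroup (restrictHom F k C Ω).ker) : HasInvariantZeros S Ω := by
  intro d hd p hp hpS
  have h1 := injective_eval₂RingHom_of_transcendental
    (transcendental_algebraMap (C := C) (Ω := Ω) ht)
  let _ : Algebra (RatFunc C) Ω := (evalHom _ _ h1).toAlgebra
  have a1 : Algebra.IsAlgebraic (RatFunc C) Ω := isAlgebraic_evalHom hadj h1
    fun a => ⟨algebraMap F C a, (IsScalarTower.algebraMap_apply F C Ω a).symm⟩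
  have hfix : ∀ (s : (restrictHom F k C Ω).ker) (x : RatFunc C),
      s.1 (evalHom _ _ h1 x) = evalHom _ _ h1 x := by
    intro s x
    have hpoly : ∀ f : C[X], s.1 (f.eval₂ (algebraMap C Ω) (algebraMap k Ω t)) =
        f.eval₂ (algebraMap C Ω) (algebraMap k Ω t) := fun f => by
      have hcomp : ((s.1 : Ω →+* Ω).comp (algebraMap C Ω)) = algebraMap C Ω :=
        RingHom.ext (restrictHom_eq_one_iff.1 s.2)
      have := Polynomial.hom_eval₂ f (algebraMap C Ω) (s.1 : Ω →+* Ω) (algebraMap k Ω t)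
      rw [hcomp] at this
      refine this.trans ?_
      rw [RingHom.coe_coe, AlgEquiv.commutes]
    obtain ⟨f, g, hg, hfg⟩ := exists_evalHom_eq h1 x
    refine mul_right_cancel₀ hg ?_
    rw [hfg]
    conv_lhs => rw [← hpoly g]
    rw [← map_mul, hfg, hpoly]
  let E₀ : Subfield Ω :=
    { carrier := {x | ∀ s ∈ S, s • x = x}
      one_mem' := fun s _ => smul_one s
      zero_mem' := fun s _ => smul_zero s
      mul_mem' := fun hx hy s hs => by rw [smul_mul', hx s hs, hy s hs]
      add_mem' := fun hx hy s hs => by rw [smul_add, hx s hs, hy s hs]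
      neg_mem' := fun hx s hs => by rw [smul_neg, hx s hs]
      inv_mem' := fun x hx s hs => by rw [smul_inv'', hx s hs] }
  let E : IntermediateField (RatFunc C) Ω := E₀.toIntermediateField fun x s _ => hfix s x
  have hE : ∀ x : Ω, x ∈ E ↔ ∀ s ∈ S, s • x = x := fun x => Iff.rfl
  obtain ⟨p', rfl⟩ := (MvPolynomial.mem_range_map_iff_coeffs_subset (f := algebraMap E Ω) (x := p)).2
    (fun a ha => by
      obtain ⟨m, -, rfl⟩ := MvPolynomial.mem_coeffs_iff.1 ha
      refine ⟨⟨p.coeff m, (hE _).2 fun s hs => ?_⟩, rfl⟩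
      conv_rhs => rw [← hpS s hs, MvPolynomial.coeff_map]
      rfl)
  obtain ⟨x, hx0, hx⟩ := exists_eval_eq_zero_of_isAlgebraic (C := C) (E := E) hd
    (by rw [Fintype.card_fin]; exact d.lt_succ_self)
    (MvPolynomial.IsHomogeneous.of_map (algebraMap E Ω).injective hp)
  refine ⟨fun i => x i, fun h => hx0 (funext fun i => Subtype.ext (congrFun h i)),
    fun s hs i => (hE _).1 (x i).2 s hs, ?_⟩
  rw [MvPolynomial.eval_map]
  have := MvPolynomial.eval₂_comp (algebraMap E Ω) x p'
  rw [hx, map_zero] at this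
  exact this.symm

/-- The abstract tower attached to the algebraic closures of `F` and of `k = F(t)`. -/
theorem isRationalTower [Normal F C] [IsAlgClosed Ω] (ht : Transcendental F t) {ℓ : ℕ}
    (hℓ : ℓ.Prime) (hchar : (ℓ : F) ≠ 0) :
    IsRationalTower (restrictHom F k C Ω) (algebraMap k Ω t) ℓ C where
  isLocallyConstant x := isLocallyConstant_algEquiv_apply x
  smul_algebraMap g x := (algebraMap_restrictHom g x).symm
  smul_eq g := g.commutes t
  transcendental := transcendental_algebraMap ht
  isClosed_ker := by
    have : (restrictHom F k C Ω).ker = (restrictHom F k C Ω) ⁻¹' {1} := rfl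
    rw [this]
    exact isClosed_singleton.preimage continuous_restrictHom
  exists_pow y hy := by
    obtain ⟨q, hq⟩ := ExpChar.exists C
    obtain ⟨n, h⟩ := exists_pow_mul_eq_of_forall_ker (C := C) hadj ht q hy
    refine ⟨q ^ n, Nat.Coprime.pow_left n ?_, h⟩
    cases hq with
    | zero => exact Nat.coprime_one_left ℓ
    | prime hp =>
      refine (Nat.coprime_primes hp hℓ).2 fun h2 => hchar ((algebraMap F C).injective ?_)
      rw [map_natCast, map_zero, ← h2, CharP.cast_eq_zero]

theorem contCohomDim_algEquiv [IsAlgClosed C] [Algebra.IsAlgebraic F C] [IsAlgClosed Ω]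
    (ht : Transcendental F t) {ℓ : ℕ} (hℓ : ℓ.Prime) (hchar : (ℓ : F) ≠ 0) :
    contCohomDim (Ω ≃ₐ[k] Ω) ℓ = contCohomDim (C ≃ₐ[F] C) ℓ + 1 := by
  have : Fact ℓ.Prime := ⟨hℓ⟩
  have : IsAlgClosure F C := ⟨inferInstance, inferInstance⟩
  have : Normal F C := IsAlgClosure.normal F C
  have : CompactSpace (Ω ≃ₐ[k] Ω) := compactSpace_algEquiv
  have : CompactSpace (C ≃ₐ[F] C) := compactSpace_algEquiv
  have hℓC : (ℓ : C) ≠ 0 := fun h => hchar ((algebraMap F C).injective (by rwa [map_natCast, map_zero]))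
  have : NeZero (ℓ : C) := ⟨hℓC⟩
  obtain ⟨z, hz⟩ := HasEnoughRootsOfUnity.exists_primitiveRoot C ℓ
  have hsurj := surjective_restrictHom (C := C) (Ω := Ω) hadj ht
  exact (isRationalTower hadj ht hℓ hchar).contCohomDim_eq hz hsurj
    (continuous_restrictHom.isClosedMap.isQuotientMap continuous_restrictHom hsurj)
    fun S _ => hasInvariantZeros_ker hadj ht S

end GeometricTower

section Main

open Polynomial

theorem contCohomDim_algEquiv_of_ringHom {F k C Ω : Type} [Field F] [Field k] [Field Ω] [Field C]
    [Algebra k Ω] [Algebra F C] [IsAlgClosed C] [Algebra.IsAlgebraic F C] [IsAlgClosed Ω]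
    [Algebra.IsAlgebraic k Ω] (a : F →+* k) (j : C →+* Ω)
    (haj : ∀ x, j (algebraMap F C x) = algebraMap k Ω (a x)) {t : k}
    (ht : Function.Injective (eval₂RingHom j (algebraMap k Ω t)))
    (hadj : ∀ S : Subfield k, (∀ x, a x ∈ S) → t ∈ S → ∀ y, y ∈ S) {ℓ : ℕ} (hℓ : ℓ.Prime)
    (hchar : (ℓ : F) ≠ 0) :
    contCohomDim (Ω ≃ₐ[k] Ω) ℓ = contCohomDim (C ≃ₐ[F] C) ℓ + 1 := by
  let _ : Algebra F k := a.toAlgebra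
  let _ : Algebra C Ω := j.toAlgebra
  let _ : Algebra F Ω := ((algebraMap k Ω).comp a).toAlgebra
  have : IsScalarTower F k Ω := IsScalarTower.of_algebraMap_eq fun x => rfl
  have : IsScalarTower F C Ω := IsScalarTower.of_algebraMap_eq fun x => (haj x).symm
  have htC : Transcendental C (algebraMap k Ω t) := transcendental_iff_injective.2 ht
  refine contCohomDim_algEquiv (t := t) (top_unique fun y _ => ?_)
    ((transcendental_algebraMap_iff (algebraMap k Ω).injective).1 (htC.restrictScalars (algebraMap F C).injective)) hℓ hchar
  exact hadj (IntermediateField.adjoin F {t}).toSubfield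
    (fun x => (IntermediateField.adjoin F {t}).algebraMap_mem x)
    (IntermediateField.mem_adjoin_simple_self F t) y

theorem sqrtNegOne_sq (F : Type) [Field F] : sqrtNegOne F ^ 2 = -1 :=
  Classical.choose_spec (IsAlgClosed.exists_pow_nat_eq (-1 : AlgebraicClosure F) (n := 2) (by norm_num))

theorem map_sqrtNegOne {κ K : Type} [Field κ] [Field K]
    (j : AlgebraicClosure κ →+* AlgebraicClosure K) :
    j (sqrtNegOne κ) = sqrtNegOne K ∨ j (sqrtNegOne κ) = -sqrtNegOne K :=
  sq_eq_sq_iff_eq_or_eq_neg.1 (by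
    rw [← map_pow, sqrtNegOne_sq, sqrtNegOne_sq, map_neg, map_one])

theorem injective_eval₂RingHom_algebraMap_X {κ C Ω : Type} [Field κ] [Field C] [Field Ω] [Algebra κ C]
    [Algebra.IsAlgebraic κ C] [Algebra (RatFunc κ) Ω] [Algebra.IsAlgebraic (RatFunc κ) Ω]
    [Algebra κ Ω] [IsScalarTower κ (RatFunc κ) Ω] (j : C →ₐ[κ] Ω) :
    Function.Injective (eval₂RingHom j.toRingHom (algebraMap (RatFunc κ) Ω RatFunc.X)) := by
  let _ : Algebra C Ω := j.toRingHom.toAlgebra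
  have : IsScalarTower κ C Ω := IsScalarTower.of_algebraMap_eq fun x => (j.commutes x).symm
  exact injective_eval₂RingHom_of_transcendental (transcendental_algebraMap RatFunc.transcendental_X)

theorem mem_of_ratFunc_le {κ Ω : Type} [Field κ] [Field Ω] [Algebra (RatFunc κ) Ω] [Algebra κ Ω]
    [IsScalarTower κ (RatFunc κ) Ω] {i : Ω}
    (S : Subfield (IntermediateField.adjoin (RatFunc κ) {i}))
    (hκ : ∀ x : κ, algebraMap κ (IntermediateField.adjoin (RatFunc κ) {i}) x ∈ S)
    (hX : algebraMap (RatFunc κ) (IntermediateField.adjoin (RatFunc κ) {i}) RatFunc.X ∈ S)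
    (hi : IntermediateField.AdjoinSimple.gen (RatFunc κ) i ∈ S)
    (y : IntermediateField.adjoin (RatFunc κ) {i}) : y ∈ S := by
  let M := (S.map (algebraMap _ Ω)).toIntermediateField (K := RatFunc κ) fun x =>
    ⟨_, mem_of_adjoin_eq_top (F := κ) (k := RatFunc κ) RatFunc.adjoin_X S hκ hX x, rfl⟩
  have h : IntermediateField.adjoin (RatFunc κ) {i} ≤ M :=
    IntermediateField.adjoin_le_iff.2 (Set.singleton_subset_iff.2 ⟨_, hi, rfl⟩)
  obtain ⟨x, hx, hxy⟩ := h y.2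
  rwa [← Subtype.ext hxy]

end Main

/-- Let `κ` be a field, `ℓ` a prime different from `char κ`, and `K = κ(t)` the
rational function field.  Then `vcd_ℓ(K) = vcd_ℓ(κ) + 1`. -/
theorem vcd_ratFunc (κ : Type) [Field κ] (ℓ : ℕ) (hℓ : ℓ.Prime)
    (hchar : ℓ ≠ ringChar κ) :
    vcdl ℓ (RatFunc κ) = vcdl ℓ κ + 1 := by
  let j : AlgebraicClosure κ →ₐ[κ] AlgebraicClosure (RatFunc κ) := IsAlgClosed.lift
  let k := IntermediateField.adjoin (RatFunc κ) {sqrtNegOne (RatFunc κ)}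
  let F := IntermediateField.adjoin κ {sqrtNegOne κ}
  have hi : sqrtNegOne (RatFunc κ) ∈ k := IntermediateField.mem_adjoin_simple_self _ _
  have hj : ∀ x : F, j x ∈ k := by
    have h : F ≤ (k.restrictScalars κ).comap j := by
      refine IntermediateField.adjoin_le_iff.2 (Set.singleton_subset_iff.2 ?_)
      change j (sqrtNegOne κ) ∈ k
      rcases map_sqrtNegOne j.toRingHom with h | h
      · exact (congrArg (· ∈ k) h).mpr hi
      · exact (congrArg (· ∈ k) h).mpr (neg_mem hi)
    exact fun x => h x.2
  let a : F →+* k := (j.toRingHom.comp (algebraMap F _)).codRestrict k hj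
  refine contCohomDim_algEquiv_of_ringHom a j.toRingHom (fun x => rfl)
    (t := algebraMap (RatFunc κ) k RatFunc.X) ?_ ?_ hℓ ?_
  · exact injective_eval₂RingHom_algebraMap_X j
  · intro S hS ht
    refine mem_of_ratFunc_le S (fun x => ?_) ht ?_
    · convert hS (algebraMap κ F x) using 1
      exact Subtype.ext (j.commutes x).symm
    · have h := hS (IntermediateField.AdjoinSimple.gen κ (sqrtNegOne κ))
      rcases map_sqrtNegOne j.toRingHom with h' | h'
      · convert h using 1
        exact Subtype.ext h'.symm
      · convert neg_mem h using 1
        exact Subtype.ext (neg_eq_iff_eq_neg.2 h').symm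
  · intro h
    have h0 : (ℓ : κ) = 0 := (algebraMap κ F).injective (by rwa [map_natCast, map_zero])
    rw [ringChar.spec, Nat.dvd_prime hℓ] at h0
    rcases h0 with h1 | h1
    · exact CharP.ringChar_ne_one h1
    · exact hchar h1.symm
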